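/- There exist constants c, c₂, c₃ > 0 such that for every prime p and all integers L, N with 0 < L+1 < L+N < p and c₃·p^(4/5)·(log p)^(8/5) ≤ N ≤ c₂·p^(7/8)·log p, one has |A_N / A_N| ≥ c·N·Q^(1/3)·(log Q)^(−2/3), where Q = N/(√p·(log p)²) (as a real number). -/

import Mathlib

/-- For a prime `p` and integers `L, N`, `A_N = {n! mod p : L+1 ≤ n ≤ L+N} ⊆ ZMod p`. -/
def intervalFactorials (p L N : ℕ) : Finset (ZMod p) :=
  (Finset.Icc (L + 1) (L + N)).image (fun n => (n.factorial : ZMod p))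

/-- The ratio set `A_N / A_N = {a·b⁻¹ : a, b ∈ A_N}`. -/
def intervalFactorialsRatio (p L N : ℕ) : Finset (ZMod p) :=
  Finset.image₂ (fun a b => a * b⁻¹) (intervalFactorials p L N) (intervalFactorials p L N)

section
open Polynomial

/-- `WD w P m`: every monomial `X^a Y^k` of `P` satisfies `a + w k ≤ m`. -/
def WD {R : Type*} [CommRing R] (w : ℕ) (P : R[X][X]) (m : ℕ) : Prop :=
  ∀ k, P.coeff k ≠ 0 → (P.coeff k).natDegree + w * k ≤ m

namespace WD
variable {R : Type*} [CommRing R] {w m n : ℕ} {P Q : R[X][X]}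

theorem mono (h : WD w P m) (hmn : m ≤ n) : WD w P n := fun k hk => (h k hk).trans hmn

theorem zero : WD w (0 : R[X][X]) m := fun k hk => by simp at hk

theorem add (hP : WD w P m) (hQ : WD w Q m) : WD w (P + Q) m := by
  intro k hk
  rw [coeff_add] at hk ⊢
  by_cases h1 : P.coeff k = 0
  · rw [h1, zero_add] at hk ⊢; exact hQ k hk
  by_cases h2 : Q.coeff k = 0
  · rw [h2, add_zero] at hk ⊢; exact hP k hk
  have := natDegree_add_le (P.coeff k) (Q.coeff k)
  have := hP k h1
  have := hQ k h2
  omega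

theorem neg (hP : WD w P m) : WD w (-P) m := by
  intro k hk
  rw [coeff_neg] at hk ⊢
  rw [natDegree_neg]
  exact hP k (by simpa using hk)

theorem sub (hP : WD w P m) (hQ : WD w Q m) : WD w (P - Q) m := by
  rw [sub_eq_add_neg]; exact hP.add hQ.neg

theorem sum {ι : Type*} (s : Finset ι) (f : ι → R[X][X]) (h : ∀ i ∈ s, WD w (f i) m) :
    WD w (∑ i ∈ s, f i) m := by
  classical
  induction s using Finset.induction_on with
  | empty => simpa using zero
  | insert a s ha ih =>
    rw [Finset.sum_insert ha]
    exact (h a (by simp)).add (ih fun i hi => h i (by simp [hi]))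

theorem mul (hP : WD w P m) (hQ : WD w Q n) : WD w (P * Q) (m + n) := by
  intro k hk
  rw [coeff_mul] at hk ⊢
  by_cases hw : w * k ≤ m + n
  swap
  · exfalso
    apply hk
    apply Finset.sum_eq_zero
    rintro ⟨i, j⟩ hij
    rw [Finset.HasAntidiagonal.mem_antidiagonal] at hij
    by_contra h
    have h1 := hP i (left_ne_zero_of_mul h)
    have h2 := hQ j (right_ne_zero_of_mul h)
    simp only at hij
    subst hij
    rw [mul_add] at hw
    omega
  have : (∑ x ∈ Finset.HasAntidiagonal.antidiagonal k, P.coeff x.1 * Q.coeff x.2).natDegree ≤ m + n - w * k := by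
    apply natDegree_sum_le_of_forall_le
    rintro ⟨i, j⟩ hij
    rw [Finset.HasAntidiagonal.mem_antidiagonal] at hij
    simp only at hij ⊢
    by_cases h : P.coeff i * Q.coeff j = 0
    · rw [h]; simp
    have h1 := hP i (left_ne_zero_of_mul h)
    have h2 := hQ j (right_ne_zero_of_mul h)
    have := natDegree_mul_le (p := P.coeff i) (q := Q.coeff j)
    subst hij
    rw [mul_add]
    omega
  omega

theorem C {a : R[X]} (h : a.natDegree ≤ m) : WD w (C a) m := by
  intro k hk
  rw [coeff_C] at hk ⊢
  split_ifs at hk ⊢ with h0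
  · subst h0; simpa using h
  · simp at hk

theorem one : WD w (1 : R[X][X]) m := by
  rw [← map_one Polynomial.C]; exact WD.C (by simp)

theorem X : WD w (X : R[X][X]) w := by
  intro k hk
  rw [coeff_X] at hk ⊢
  split_ifs at hk ⊢ with h0
  · subst h0; simp
  · simp at hk

theorem pow (hP : WD w P m) (j : ℕ) : WD w (P ^ j) (j * m) := by
  induction j with
  | zero => simpa using one
  | succ j ih => rw [pow_succ, add_mul, one_mul]; exact ih.mul hP

theorem X_pow (j : ℕ) : WD w ((Polynomial.X : R[X][X]) ^ j) (w * j) := by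
  rw [mul_comm]; exact X.pow j

theorem monomial {a : R[X]} {k : ℕ} (h : a.natDegree + w * k ≤ m) :
    WD w (Polynomial.monomial k a) m := by
  intro j hj
  rw [coeff_monomial] at hj ⊢
  split_ifs at hj ⊢ with h0
  · subst h0; exact h
  · simp at hj

theorem modByMonic [Nontrivial R] {Φ : R[X][X]} (hΦ : Φ.Monic) (hW : WD w Φ (w * Φ.natDegree))
    (hP : WD w P m) : WD w (P %ₘ Φ) m := by
  induction h : P.natDegree using Nat.strong_induction_on generalizing P with
  | _ n ih =>
    subst h
    by_cases hd : P.degree < Φ.degree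
    · rwa [(modByMonic_eq_self_iff hΦ).2 hd]
    by_cases hP0 : P = 0
    · subst hP0; simpa using zero
    have hle : Φ.degree ≤ P.degree := not_lt.1 hd
    set T := Polynomial.C P.leadingCoeff * Polynomial.X ^ (P.natDegree - Φ.natDegree) with hT
    have hTW : WD w (Φ * T) m := by
      have hn : Φ.natDegree ≤ P.natDegree := natDegree_le_natDegree hle
      have h1 := hP P.natDegree (by simpa using hP0)
      have := hW.mul ((WD.C (w := w) (le_refl P.leadingCoeff.natDegree)).mul
        (X_pow (R := R) (w := w) (P.natDegree - Φ.natDegree)))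
      refine this.mono ?_
      have e : w * P.natDegree = w * Φ.natDegree + w * (P.natDegree - Φ.natDegree) := by
        rw [← mul_add]; congr 1; omega
      rw [coeff_natDegree] at h1
      omega
    have hlt : (P - Φ * T).degree < P.degree := div_wf_lemma ⟨hle, hP0⟩ hΦ
    have hmod : P %ₘ Φ = (P - Φ * T) %ₘ Φ := by
      rw [sub_modByMonic, self_mul_modByMonic hΦ, sub_zero]
    rw [hmod]
    by_cases h0 : P - Φ * T = 0
    · rw [h0, zero_modByMonic]; exact zero
    exact ih _ (natDegree_lt_natDegree h0 hlt) (hP.sub hTW) rfl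

end WD

section Norm
variable {k : Type*} [Field k] {w m d : ℕ} {Φ : k[X][X]}

theorem natDegree_norm_mk_le (hΦ : Φ.Monic) (hd : Φ.natDegree = d) (hW : WD w Φ (w * d))
    {P : k[X][X]} (hP : WD w P m) :
    (Algebra.norm k[X] (AdjoinRoot.mk Φ P)).natDegree ≤ d * m := by
  subst hd
  set pb := AdjoinRoot.powerBasis' hΦ with hpb
  rw [Algebra.norm_eq_matrix_det pb.basis, Matrix.det_apply]
  apply natDegree_sum_le_of_forall_le
  intro σ _
  by_cases hz : (∏ i, (Algebra.leftMulMatrix pb.basis) (AdjoinRoot.mk Φ P) (σ i) i) = 0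
  · rw [hz]; simp
  have hdim : pb.dim = Φ.natDegree := rfl
  have hentry : ∀ i j : Fin pb.dim,
      (Algebra.leftMulMatrix pb.basis) (AdjoinRoot.mk Φ P) i j =
        ((P * X ^ (j : ℕ)) %ₘ Φ).coeff i := by
    intro i j
    rw [Algebra.leftMulMatrix_eq_repr_mul, pb.coe_basis]
    simp only [hpb, AdjoinRoot.powerBasis'_gen]
    rw [← AdjoinRoot.mk_X, ← map_pow, ← map_mul]
    change (AdjoinRoot.modByMonicHom hΦ _).coeff _ = _
    rw [AdjoinRoot.modByMonicHom_mk]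
  have h1 : ∀ i : Fin pb.dim,
      ((Algebra.leftMulMatrix pb.basis) (AdjoinRoot.mk Φ P) (σ i) i).natDegree + w * (σ i) ≤
        m + w * i := by
    intro i
    have hne : (Algebra.leftMulMatrix pb.basis) (AdjoinRoot.mk Φ P) (σ i) i ≠ 0 :=
      fun h => hz (Finset.prod_eq_zero (Finset.mem_univ i) h)
    rw [hentry] at hne ⊢
    exact (WD.modByMonic hΦ hW (hP.mul (WD.X_pow _))) _ hne
  have h2 := Finset.sum_le_sum fun i (_ : i ∈ Finset.univ) => h1 i
  rw [Finset.sum_add_distrib, Finset.sum_add_distrib,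
    Equiv.sum_comp σ (fun i : Fin pb.dim => w * (i : ℕ))] at h2
  simp only [Finset.sum_const, Finset.card_univ, Fintype.card_fin, smul_eq_mul] at h2
  have h3 := natDegree_prod_le Finset.univ
    (fun i => (Algebra.leftMulMatrix pb.basis) (AdjoinRoot.mk Φ P) (σ i) i)
  refine (natDegree_smul_le _ _).trans (h3.trans ?_)
  rw [← hdim]
  omega

/-- The evaluation homomorphism `k[X][Y]/Φ → k` at a zero `(x, y)` of `Φ`. -/
noncomputable def ptHom (Φ : k[X][X]) (x y : k) (h : Φ.evalEval x y = 0) :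
    AdjoinRoot Φ →ₐ[k] k :=
  { AdjoinRoot.lift (evalRingHom x) y (by rw [eval₂_evalRingHom]; exact h) with
    commutes' := fun r => by
      change AdjoinRoot.lift (evalRingHom x) y _ (algebraMap k (AdjoinRoot Φ) r) = r
      rw [IsScalarTower.algebraMap_apply k k[X] (AdjoinRoot Φ), AdjoinRoot.algebraMap_eq,
        AdjoinRoot.lift_of]
      simp }

theorem ptHom_mk (x y : k) (h : Φ.evalEval x y = 0) (P : k[X][X]) :
    ptHom Φ x y h (AdjoinRoot.mk Φ P) = P.evalEval x y := by
  have h' : Φ.eval₂ (evalRingHom x) y = 0 := by rw [eval₂_evalRingHom]; exact h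
  change AdjoinRoot.lift (evalRingHom x) y h' (AdjoinRoot.mk Φ P) = _
  rw [AdjoinRoot.lift_mk, eval₂_evalRingHom]

open Ideal in
theorem finiteDimensional_quotient_of_basis {F S ι : Type*} [Field F] [CommRing S] [IsDomain S]
    [Algebra F[X] S] [Finite ι] [Algebra F S] [IsScalarTower F F[X] S]
    (b : Module.Basis ι F[X] S) {I : Ideal S} (hI : I ≠ ⊥) : FiniteDimensional F (S ⧸ I) := by
  have := Fintype.ofFinite ι
  classical
  exact Module.Finite.equiv (quotientEquivDirectSum F b hI).symm

/-- The points of a bivariate polynomial at which `H` vanishes are at most `deg (norm H)` many. -/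
theorem card_points_le_natDegree_norm (hΦ : Φ.Monic) (hirr : Irreducible Φ)
    {P : k[X][X]} (hH : AdjoinRoot.mk Φ P ≠ 0) (Z : Finset (k × k))
    (hZ : ∀ z ∈ Z, Φ.evalEval z.1 z.2 = 0) (hZP : ∀ z ∈ Z, P.evalEval z.1 z.2 = 0) :
    Z.card ≤ (Algebra.norm k[X] (AdjoinRoot.mk Φ P)).natDegree := by
  have : IsDomain (AdjoinRoot Φ) := AdjoinRoot.isDomain_of_prime hirr.prime
  set H := AdjoinRoot.mk Φ P with hHdef
  set b := (AdjoinRoot.powerBasis' hΦ).basis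
  rw [← finrank_quotient_span_eq_natDegree_norm b hH]
  have hfin : FiniteDimensional k (AdjoinRoot Φ ⧸ Ideal.span {H}) :=
    finiteDimensional_quotient_of_basis b (by simpa using hH)
  let φ : Z → (AdjoinRoot Φ ⧸ Ideal.span {H} →ₐ[k] k) := fun z =>
    Ideal.Quotient.liftₐ _ (ptHom Φ z.1.1 z.1.2 (hZ _ z.2)) (by
      intro a ha
      obtain ⟨c, rfl⟩ := Ideal.mem_span_singleton'.1 ha
      rw [map_mul, hHdef, ptHom_mk, hZP _ z.2, mul_zero])
  have hφ : ∀ z Q, φ z (Ideal.Quotient.mk _ (AdjoinRoot.mk Φ Q)) = Q.evalEval z.1.1 z.1.2 := by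
    intro z Q
    rw [← ptHom_mk z.1.1 z.1.2 (hZ _ z.2) Q]
    rfl
  have hinj : Function.Injective φ := by
    intro z z' h
    have h1 := hφ z (C X)
    have h2 := hφ z X
    rw [h, hφ] at h1 h2
    simp only [evalEval_C, eval_X, evalEval_X] at h1 h2
    exact Subtype.ext (Prod.ext h1.symm h2.symm)
  have hli := (linearIndependent_toLinearMap k (AdjoinRoot Φ ⧸ Ideal.span {H}) k).comp φ hinj
  have := hli.fintype_card_le_finrank
  rw [Fintype.card_coe] at this
  refine this.trans (le_of_eq ?_)
  exact Subspace.dual_finrank_eq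
end Norm

end

section
open Polynomial

theorem dvd_algebraMap_norm_of_free {R S : Type*} [CommRing R] [CommRing S] [Algebra R S]
    [Module.Free R S] [Module.Finite R S] (u : S) : u ∣ algebraMap R S (Algebra.norm R u) := by
  have h := LinearMap.aeval_self_charpoly (Algebra.lmul R S u)
  have h2 : aeval u (Algebra.lmul R S u).charpoly = 0 := by
    have h3 := congrArg (fun f : Module.End R S => f 1) h
    rw [aeval_algHom_apply] at h3
    simpa using h3
  rw [← divX_mul_X_add (Algebra.lmul R S u).charpoly] at h2
  simp only [map_add, map_mul, aeval_X, aeval_C] at h2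
  change u ∣ algebraMap R S (LinearMap.det (Algebra.lmul R S u))
  rw [LinearMap.det_eq_sign_charpoly_coeff, map_mul]
  refine Dvd.dvd.mul_left ?_ _
  exact ⟨-aeval u (Algebra.lmul R S u).charpoly.divX, by linear_combination h2⟩

namespace PowerSeries

/-- Small-order combinations of `p^r`-th powers of linearly independent series do not vanish. -/
theorem sum_mul_pow_ne_zero {F ι : Type*} [Field F] [Fintype ι] (p r : ℕ) [Fact p.Prime]
    [CharP F p] [PerfectRing F p] {κ e : ι → PowerSeries F} (hκ : LinearIndependent F κ)
    (he : e ≠ 0) (hord : ∀ c : ι → F, ∑ j, c j • e j ≠ 0 →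
      ∃ s < p ^ r, coeff s (∑ j, c j • e j) ≠ 0) :
    ∑ j, e j * κ j ^ p ^ r ≠ 0 := by
  classical
  have : ExpChar F p := ExpChar.prime Fact.out
  have : ExpChar (PowerSeries F) p := by
    have : CharP (PowerSeries F) p := charP_of_injective_ringHom (C_injective (R := F)) p
    exact ExpChar.prime Fact.out
  set E : ℕ → PowerSeries F := fun n => ∑ j, (coeff n (κ j)) ^ p ^ r • e j with hE
  have hex : ∃ n, E n ≠ 0 := by
    by_contra! hall
    obtain ⟨i, hi⟩ := Function.ne_iff.1 he
    obtain ⟨m, hm⟩ := exists_coeff_ne_zero_iff_ne_zero.2 hi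
    set g : ι → F := fun j => (iterateFrobeniusEquiv F p r).symm (coeff m (e j)) with hg
    have hgp : ∀ j, g j ^ p ^ r = coeff m (e j) := fun j => by
      rw [← iterateFrobeniusEquiv_def F p r, hg]; simp
    have h0 : ∑ j, g j • κ j = 0 := by
      ext n
      apply (iterateFrobenius F p r).injective
      rw [map_zero, map_sum, map_zero, map_sum]
      have := congrArg (coeff m) (hall n)
      rw [hE] at this
      simp only [map_sum, map_zero] at this
      rw [← this]
      refine Finset.sum_congr rfl fun j _ => ?_
      rw [iterateFrobenius_def, coeff_smul, coeff_smul, smul_eq_mul, smul_eq_mul, mul_pow, hgp,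
        mul_comm]
    have := Fintype.linearIndependent_iff.1 hκ g h0 i
    apply hm
    rw [← hgp, this, zero_pow (pow_ne_zero _ (Fact.out : p.Prime).ne_zero)]
  set n := Nat.find hex with hn
  have hnE : E n ≠ 0 := Nat.find_spec hex
  have hlt : ∀ i < n, E i = 0 := fun i hi => by simpa using Nat.find_min hex hi
  obtain ⟨s, hs, hsc⟩ := hord _ hnE
  have hκe : ∀ j, ∃ ρ, κ j = ∑ i ∈ Finset.range (n + 1), C (coeff i (κ j)) * X ^ i
      + X ^ (n + 1) * ρ := by
    intro j
    have : X ^ (n + 1) ∣ κ j - ∑ i ∈ Finset.range (n + 1), C (coeff i (κ j)) * X ^ i := by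
      rw [X_pow_dvd_iff]
      intro m hm
      simp only [map_sub, map_sum, coeff_C_mul_X_pow]
      rw [Finset.sum_ite_eq, if_pos (by simpa using hm), sub_self]
    obtain ⟨ρ, hρ⟩ := this
    exact ⟨ρ, by rw [← hρ]; ring⟩
  choose ρ hρ using hκe
  have hpow : ∀ j, κ j ^ p ^ r = ∑ i ∈ Finset.range (n + 1), C (coeff i (κ j) ^ p ^ r) *
      X ^ (i * p ^ r) + X ^ ((n + 1) * p ^ r) * ρ j ^ p ^ r := by
    intro j
    conv_lhs => rw [hρ j]
    rw [add_pow_expChar_pow, sum_pow_char_pow, mul_pow, ← pow_mul]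
    congr 1
    refine Finset.sum_congr rfl fun i _ => ?_
    rw [mul_pow, ← pow_mul, map_pow]
  have hsum : ∑ j, e j * κ j ^ p ^ r = X ^ (n * p ^ r) * E n +
      X ^ ((n + 1) * p ^ r) * ∑ j, e j * ρ j ^ p ^ r := by
    have h1 : ∑ j, e j * κ j ^ p ^ r = ∑ i ∈ Finset.range (n + 1), X ^ (i * p ^ r) * E i +
        X ^ ((n + 1) * p ^ r) * ∑ j, e j * ρ j ^ p ^ r := by
      simp_rw [hpow, mul_add, Finset.sum_add_distrib, hE, Finset.mul_sum]
      rw [Finset.sum_comm]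
      congr 1
      · refine Finset.sum_congr rfl fun i _ => Finset.sum_congr rfl fun j _ => ?_
        rw [smul_eq_C_mul]; ring
      · refine Finset.sum_congr rfl fun j _ => ?_
        ring
    rw [h1, Finset.sum_range_succ, Finset.sum_eq_zero, zero_add]
    intro i hi
    rw [hlt i (by simpa using hi), mul_zero]
  intro hzero
  rw [hsum] at hzero
  have := congrArg (coeff (s + n * p ^ r)) hzero
  rw [map_add, coeff_X_pow_mul, map_zero, coeff_X_pow_mul', if_neg, add_zero] at this
  · exact hsc this
  · rw [add_mul, one_mul]; omega

end PowerSeries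

section Embedding
variable {F : Type*} [Field F] [IsAlgClosed F] {Φ : F[X][X]}

theorem exists_powerSeries_embedding (hΦ : Φ.Monic) (hirr : Irreducible Φ)
    (hsep : derivative Φ ≠ 0) :
    ∃ σ : AdjoinRoot Φ →ₐ[F] PowerSeries F, ∀ (w m : ℕ) (P : F[X][X]),
      WD w Φ (w * Φ.natDegree) → WD w P m → AdjoinRoot.mk Φ P ≠ 0 →
      ∃ s ≤ Φ.natDegree * m, PowerSeries.coeff s (σ (AdjoinRoot.mk Φ P)) ≠ 0 := by
  have : IsDomain (AdjoinRoot Φ) := AdjoinRoot.isDomain_of_prime hirr.prime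
  have : Module.Free F[X] (AdjoinRoot Φ) := Module.Free.of_basis (AdjoinRoot.powerBasis' hΦ).basis
  have : Module.Finite F[X] (AdjoinRoot Φ) := hΦ.finite_adjoinRoot
  have hd : Φ.natDegree ≠ 0 := by
    intro h
    apply hsep
    rw [natDegree_eq_zero.1 h |>.choose_spec.symm, derivative_C]
  have hθ : AdjoinRoot.mk Φ (derivative Φ) ≠ 0 := by
    rw [Ne, AdjoinRoot.mk_eq_zero]
    intro h
    have := natDegree_le_of_dvd h hsep
    have := natDegree_derivative_lt hd
    omega
  set Nθ := Algebra.norm F[X] (AdjoinRoot.mk Φ (derivative Φ)) with hNθ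
  have hN0 : Nθ ≠ 0 := Algebra.norm_ne_zero_iff.2 hθ
  obtain ⟨x0, hx0⟩ : ∃ x0, Nθ.eval x0 ≠ 0 := by
    by_contra! h
    exact hN0 (zero_of_eval_zero _ h)
  obtain ⟨y0, hy0⟩ := IsAlgClosed.exists_root (Φ.map (evalRingHom x0)) (by
    rw [hΦ.degree_map, degree_eq_natDegree hΦ.ne_zero]
    exact_mod_cast hd)
  have hpt : Φ.evalEval x0 y0 = 0 := by
    rw [← eval₂_evalRingHom, ← eval_map]; exact hy0
  have hder : (derivative Φ).evalEval x0 y0 ≠ 0 := by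
    intro h
    obtain ⟨v, hv⟩ := dvd_algebraMap_norm_of_free (R := F[X]) (AdjoinRoot.mk Φ (derivative Φ))
    apply hx0
    have := congrArg (ptHom Φ x0 y0 hpt) hv
    rw [map_mul, ptHom_mk, h, zero_mul, ← hNθ, AdjoinRoot.algebraMap_eq, ← AdjoinRoot.mk_C,
      ptHom_mk, evalEval_C] at this
    exact this
  set τ : F[X] →ₐ[F] PowerSeries F := aeval (PowerSeries.C x0 + PowerSeries.X) with hτ
  have hτcoe : ∀ f : F[X], τ f = ((taylor x0 f : F[X]) : PowerSeries F) := by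
    intro f
    have : τ = (Polynomial.coeToPowerSeries.algHom F).comp (taylorAlgHom x0) := by
      apply algHom_ext
      simp [hτ, Polynomial.coeToPowerSeries.algHom_apply, add_comm]
    rw [this]
    simp [Polynomial.coeToPowerSeries.algHom_apply]
  have hconst : ∀ f : F[X], PowerSeries.constantCoeff (τ f) = f.eval x0 := by
    intro f
    rw [hτcoe, Polynomial.constantCoeff_coe, taylor_coeff_zero]
  have hconst2 : ∀ P : F[X][X], PowerSeries.constantCoeff
      ((P.map (τ : F[X] →+* PowerSeries F)).eval (PowerSeries.C y0)) = P.evalEval x0 y0 := by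
    intro P
    rw [eval_map, hom_eval₂, PowerSeries.constantCoeff_C, ← eval₂_evalRingHom]
    congr 1
    ext f <;> simp [hconst]
  obtain ⟨y, hy, -⟩ := HenselianRing.is_henselian (I := Ideal.span {(PowerSeries.X : PowerSeries F)})
    (Φ.map (τ : F[X] →+* PowerSeries F)) (hΦ.map _) (PowerSeries.C y0)
    (by rw [Ideal.mem_span_singleton, PowerSeries.X_dvd_iff, hconst2, hpt])
    (by
      apply RingHom.isUnit_map
      rw [PowerSeries.isUnit_iff_constantCoeff, derivative_map, hconst2]
      exact isUnit_iff_ne_zero.2 hder)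
  set σ0 := AdjoinRoot.lift (τ : F[X] →+* PowerSeries F) y (by rw [← eval_map]; exact hy) with hσ0
  have hσ0of : ∀ f : F[X], σ0 (algebraMap F[X] (AdjoinRoot Φ) f) = τ f := fun f => by
    rw [AdjoinRoot.algebraMap_eq, hσ0, AdjoinRoot.lift_of]; rfl
  refine ⟨{ σ0 with commutes' := fun r => ?_ }, ?_⟩
  · change σ0 _ = _
    rw [IsScalarTower.algebraMap_apply F F[X] (AdjoinRoot Φ), hσ0of]
    exact τ.commutes r
  · intro w m P hW hP hne
    change ∃ s ≤ Φ.natDegree * m, PowerSeries.coeff s (σ0 (AdjoinRoot.mk Φ P)) ≠ 0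
    by_contra! hall
    have hdvd : (PowerSeries.X : PowerSeries F) ^ (Φ.natDegree * m + 1) ∣ σ0 (AdjoinRoot.mk Φ P) :=
      PowerSeries.X_pow_dvd_iff.2 fun s hs => hall s (by omega)
    have h2 := hdvd.trans (map_dvd σ0 (dvd_algebraMap_norm_of_free (R := F[X]) (AdjoinRoot.mk Φ P)))
    rw [hσ0of, hτcoe, PowerSeries.X_pow_dvd_iff] at h2
    have h3 := natDegree_norm_mk_le hΦ rfl hW hP
    have h4 : taylor x0 (Algebra.norm F[X] (AdjoinRoot.mk Φ P)) = 0 := by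
      ext i
      by_cases hi : i ≤ Φ.natDegree * m
      · have := h2 i (by omega)
        rwa [Polynomial.coeff_coe] at this
      · rw [coeff_eq_zero_of_natDegree_lt, coeff_zero]
        rw [natDegree_taylor]; omega
    rw [map_eq_zero_iff _ (taylor_injective x0)] at h4
    exact Algebra.norm_ne_zero_iff.2 hne h4

end Embedding

end

section
open Polynomial

section Fil
variable {k : Type*} [Field k]

/-- The elements of `k[X][Y]/Φ` represented by polynomials of weight at most `m`. -/
noncomputable def fil (w : ℕ) (Φ : k[X][X]) (m : ℕ) : Submodule k (AdjoinRoot Φ) where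
  carrier := {u | ∃ P, WD w P m ∧ AdjoinRoot.mk Φ P = u}
  add_mem' := by
    rintro _ _ ⟨P, hP, rfl⟩ ⟨Q, hQ, rfl⟩
    exact ⟨P + Q, hP.add hQ, map_add _ _ _⟩
  zero_mem' := ⟨0, WD.zero, map_zero _⟩
  smul_mem' := by
    rintro c _ ⟨P, hP, rfl⟩
    refine ⟨C (C c) * P, by simpa using (WD.C (w := w) (m := 0) (a := C c) (by simp)).mul hP, ?_⟩
    rw [map_mul, AdjoinRoot.mk_C, ← AdjoinRoot.algebraMap_eq, Algebra.smul_def,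
      IsScalarTower.algebraMap_apply k k[X] (AdjoinRoot Φ)]
    rfl

variable {w m n d : ℕ} {Φ : k[X][X]}

theorem mk_mem_fil {P : k[X][X]} (h : WD w P m) : AdjoinRoot.mk Φ P ∈ fil w Φ m := ⟨P, h, rfl⟩

theorem fil_mono (h : m ≤ n) : fil w Φ m ≤ fil w Φ n := by
  rintro _ ⟨P, hP, rfl⟩
  exact ⟨P, hP.mono h, rfl⟩

theorem mul_mem_fil {u v : AdjoinRoot Φ} (hu : u ∈ fil w Φ m) (hv : v ∈ fil w Φ n) :
    u * v ∈ fil w Φ (m + n) := by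
  obtain ⟨P, hP, rfl⟩ := hu
  obtain ⟨Q, hQ, rfl⟩ := hv
  exact ⟨P * Q, hP.mul hQ, map_mul _ _ _⟩

theorem pow_mem_fil {u : AdjoinRoot Φ} (hu : u ∈ fil w Φ m) (j : ℕ) :
    u ^ j ∈ fil w Φ (j * m) := by
  obtain ⟨P, hP, rfl⟩ := hu
  exact ⟨P ^ j, hP.pow j, map_pow _ _ _⟩

theorem one_mem_fil : (1 : AdjoinRoot Φ) ∈ fil w Φ m := ⟨1, WD.one, map_one _⟩

/-- The monomial `X^a Y^b` in `k[X][Y]/Φ`. -/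
noncomputable def mon (Φ : k[X][X]) (a b : ℕ) : AdjoinRoot Φ :=
  AdjoinRoot.mk Φ (C (X ^ a) * X ^ b)

theorem mon_mem_fil {a b : ℕ} (h : a + w * b ≤ m) : mon Φ a b ∈ fil w Φ m :=
  mk_mem_fil (((WD.C (by simp)).mul (WD.X_pow b)).mono h)

theorem linearIndependent_mon (hΦ : Φ.Monic) (A : ℕ) :
    LinearIndependent k (fun i : Fin A × Fin Φ.natDegree => mon Φ i.1 i.2) := by
  have h := ((basisMonomials k).smulTower (AdjoinRoot.powerBasis' hΦ).basis).linearIndependent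
  have h2 := h.comp (fun i : Fin A × Fin Φ.natDegree => ((i.1 : ℕ), i.2)) (by
    rintro ⟨a, b⟩ ⟨a', b'⟩ h
    have h1 := congrArg Prod.fst h
    have h2 := congrArg Prod.snd h
    exact Prod.ext (Fin.ext h1) h2)
  convert h2 using 2 with i
  rw [Function.comp_apply, Module.Basis.smulTower_apply, PowerBasis.coe_basis]
  simp only [coe_basisMonomials, AdjoinRoot.powerBasis'_gen, mon, map_mul, AdjoinRoot.mk_C, map_pow,
    AdjoinRoot.mk_X, Algebra.smul_def, AdjoinRoot.algebraMap_eq, monomial_one_right_eq_X_pow]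

theorem fil_finrank (hΦ : Φ.Monic) (hW : WD w Φ (w * Φ.natDegree)) :
    FiniteDimensional k (fil w Φ m) ∧
      Module.finrank k (fil w Φ m) ≤ Φ.natDegree * (m + 1) := by
  set f : (Fin Φ.natDegree × Fin (m + 1) → k) →ₗ[k] AdjoinRoot Φ :=
    Fintype.linearCombination k (fun i : Fin Φ.natDegree × Fin (m + 1) => mon Φ i.2 i.1) with hf
  have hle : fil w Φ m ≤ LinearMap.range f := by
    rintro _ ⟨P, hP, rfl⟩
    rw [hf, Fintype.range_linearCombination]
    have hP' := WD.modByMonic hΦ hW hP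
    rw [← AdjoinRoot.mk_leftInverse hΦ (AdjoinRoot.mk Φ P), AdjoinRoot.modByMonicHom_mk]
    by_cases h1 : Φ = 1
    · subst h1; simp
    rw [(P %ₘ Φ).as_sum_range' _ (natDegree_modByMonic_lt P hΦ h1), map_sum]
    refine Submodule.sum_mem _ fun i hi => ?_
    rw [Finset.mem_range] at hi
    by_cases h0 : (P %ₘ Φ).coeff i = 0
    · rw [h0]; simp
    have hb := hP' i h0
    rw [((P %ₘ Φ).coeff i).as_sum_range' (m + 1) (by omega), map_sum, map_sum]
    refine Submodule.sum_mem _ fun a ha => ?_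
    rw [Finset.mem_range] at ha
    have : AdjoinRoot.mk Φ (monomial i (monomial a (((P %ₘ Φ).coeff i).coeff a))) =
        (((P %ₘ Φ).coeff i).coeff a) • mon Φ a i := by
      rw [mon, ← C_mul_X_pow_eq_monomial, map_mul, map_mul, AdjoinRoot.mk_C, AdjoinRoot.mk_C,
        ← C_mul_X_pow_eq_monomial, map_mul, Algebra.smul_def,
        IsScalarTower.algebraMap_apply k k[X] (AdjoinRoot Φ), mul_assoc]
      rfl
    rw [this]
    exact Submodule.smul_mem _ _ (Submodule.subset_span ⟨(⟨i, hi⟩, ⟨a, ha⟩), rfl⟩)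
  have := Submodule.finrank_mono hle
  refine ⟨Submodule.finiteDimensional_of_le hle, this.trans ?_⟩
  refine (LinearMap.finrank_range_le f).trans ?_
  simp

theorem coeff_X_pow_modByMonic_mem_fil {Θ : (AdjoinRoot Φ)[X]} (hΘ : Θ.Monic)
    (hΘc : ∀ j < Θ.natDegree, Θ.coeff j ∈ fil w Φ (w * (Θ.natDegree - j))) (b : ℕ) :
    ∀ j < Θ.natDegree, ((X : (AdjoinRoot Φ)[X]) ^ b %ₘ Θ).coeff j ∈
      fil w Φ (w * (b + Θ.natDegree - j)) := by
  nontriviality AdjoinRoot Φ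
  induction b with
  | zero =>
    intro j hj
    rw [pow_zero, (modByMonic_eq_self_iff hΘ).2, coeff_one]
    · split_ifs
      · exact one_mem_fil
      · exact zero_mem _
    · rw [degree_one, degree_eq_natDegree hΘ.ne_zero]
      exact_mod_cast (by omega : 0 < Θ.natDegree)
  | succ b ih =>
    intro j hj
    set r := (X : (AdjoinRoot Φ)[X]) ^ b %ₘ Θ with hr
    have h1 : (X : (AdjoinRoot Φ)[X]) ^ (b + 1) %ₘ Θ =
        X * r - C (r.coeff (Θ.natDegree - 1)) * Θ := by
      have hne : Θ ≠ 1 := by rintro rfl; simp at hj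
      have hrd : r.natDegree < Θ.natDegree := natDegree_modByMonic_lt _ hΘ hne
      have : (X : (AdjoinRoot Φ)[X]) ^ (b + 1) = (X * r - C (r.coeff (Θ.natDegree - 1)) * Θ) +
          Θ * (C (r.coeff (Θ.natDegree - 1)) + X * (X ^ b /ₘ Θ)) := by
        have := modByMonic_add_div ((X : (AdjoinRoot Φ)[X]) ^ b) Θ
        rw [pow_succ]
        nth_rewrite 1 [← this]
        rw [hr]
        ring
      rw [this, add_modByMonic, self_mul_modByMonic hΘ, add_zero, modByMonic_eq_self_iff hΘ]
      rw [degree_eq_natDegree hΘ.ne_zero, degree_lt_iff_coeff_zero]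
      intro i hi
      rw [coeff_sub, coeff_C_mul]
      obtain ⟨i, rfl⟩ : ∃ i', i = i' + 1 := ⟨i - 1, by omega⟩
      rw [coeff_X_mul]
      rcases eq_or_lt_of_le hi with h | h
      · rw [← h, hΘ.coeff_natDegree, mul_one, h, Nat.add_sub_cancel, sub_self]
      · rw [coeff_eq_zero_of_natDegree_lt (by omega), coeff_eq_zero_of_natDegree_lt h, mul_zero,
          sub_self]
    rw [h1, coeff_sub, coeff_C_mul]
    refine Submodule.sub_mem _ ?_ ?_
    · rcases j with _ | j
      · simp
      · rw [coeff_X_mul]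
        refine fil_mono (Nat.mul_le_mul_left _ (by omega)) (ih j (by omega))
    · refine fil_mono ?_ (mul_mem_fil (ih (Θ.natDegree - 1) (by omega)) (hΘc j hj))
      rw [← mul_add]
      exact Nat.mul_le_mul_left _ (by omega)
end Fil

section Stepanov

/-- Stepanov's method: an auxiliary function of small degree vanishes on the points
with `x ^ q = x` and `Θ(x, y, y ^ q) = 0`, where `q = p ^ s * p ^ r`. -/
theorem card_le_of_auxiliary {F : Type*} [Field F] [IsAlgClosed F] (p : ℕ) [Fact p.Prime]
    [CharP F p] {Φ : F[X][X]} (hΦ : Φ.Monic) (hirr : Irreducible Φ) (hsep : derivative Φ ≠ 0)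
    {w : ℕ} (hW : WD w Φ (w * Φ.natDegree)) {Θ : (AdjoinRoot Φ)[X]} (hΘ : Θ.Monic)
    (hΘc : ∀ j < Θ.natDegree, Θ.coeff j ∈ fil w Φ (w * (Θ.natDegree - j)))
    {r s A M : ℕ} (hA : Φ.natDegree * (A + w * Φ.natDegree) < p ^ r)
    (hM : Θ.natDegree * Φ.natDegree * (p ^ s * (A + w * Φ.natDegree) + M + w * Φ.natDegree +
      w * Θ.natDegree + 1) < Φ.natDegree * A * (Φ.natDegree * M))
    (Z : Finset (F × F)) (hZ : ∀ z ∈ Z, ∃ h : Φ.evalEval z.1 z.2 = 0,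
      z.1 ^ p ^ (r + s) = z.1 ∧
      Θ.eval₂ (ptHom Φ z.1 z.2 h : AdjoinRoot Φ →+* F) (z.2 ^ p ^ (r + s)) = 0) :
    Z.card ≤ Φ.natDegree * (A + w * Φ.natDegree + p ^ r * (M + w * Φ.natDegree)) := by
  classical
  have : IsDomain (AdjoinRoot Φ) := AdjoinRoot.isDomain_of_prime hirr.prime
  set d := Φ.natDegree with hd
  set e := Θ.natDegree with he
  set n := p ^ s * (A + w * d) + (M + w * d + w * e) with hn
  have hmonI : ∀ i : Fin A × Fin d, mon Φ i.1 i.2 ∈ fil w Φ (A + w * d) := fun i =>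
    mon_mem_fil (Nat.add_le_add i.1.2.le (Nat.mul_le_mul_left _ i.2.2.le))
  set g : (Fin A × Fin d) × (Fin M × Fin d) → Fin e → AdjoinRoot Φ := fun t j =>
    mon Φ t.1.1 t.1.2 ^ p ^ s * (mon Φ t.2.1 0 * ((X : (AdjoinRoot Φ)[X]) ^ (t.2.2 : ℕ) %ₘ Θ).coeff j)
    with hg
  have hgmem : ∀ t j, g t j ∈ fil w Φ n := by
    intro t j
    refine mul_mem_fil (pow_mem_fil (hmonI t.1) _) ?_
    refine fil_mono ?_ (mul_mem_fil (mon_mem_fil (m := t.2.1) (by simp))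
      (coeff_X_pow_modByMonic_mem_fil hΘ hΘc t.2.2 j j.2))
    rw [add_assoc, ← mul_add]
    exact Nat.add_le_add t.2.1.2.le (Nat.mul_le_mul_left _ (by omega))
  obtain ⟨hfin, hrank⟩ := fil_finrank (m := n) hΦ hW
  set T : ((Fin A × Fin d) × (Fin M × Fin d) → F) →ₗ[F] (Fin e → fil w Φ n) :=
    Fintype.linearCombination F (fun t j => (⟨g t j, hgmem t j⟩ : fil w Φ n)) with hT
  have hker : LinearMap.ker T ≠ ⊥ := by
    apply LinearMap.ker_ne_bot_of_finrank_lt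
    rw [Module.finrank_pi_fintype, Finset.sum_const, Module.finrank_fintype_fun_eq_card]
    simp only [Finset.card_univ, Fintype.card_fin, smul_eq_mul, Fintype.card_prod]
    calc e * Module.finrank F (fil w Φ n) ≤ e * (d * (n + 1)) := Nat.mul_le_mul_left _ hrank
      _ < d * A * (d * M) := by
        refine lt_of_eq_of_lt ?_ hM
        rw [hn]; ring
      _ = A * d * (M * d) := by ring
  obtain ⟨c', hc'mem, hc'0⟩ := Submodule.exists_mem_ne_zero_of_ne_bot hker
  have hc'g : ∀ j, ∑ t, c' t • g t j = 0 := by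
    intro j
    have h1 : T c' = 0 := hc'mem
    have h2 := congrArg (fun f => ((f j : fil w Φ n) : AdjoinRoot Φ)) h1
    simpa [hT, Fintype.linearCombination_apply, Finset.sum_apply] using h2
  have : ExpChar F p := ExpChar.prime Fact.out
  set c : (Fin A × Fin d) × (Fin M × Fin d) → F := fun t =>
    (iterateFrobeniusEquiv F p s).symm (c' t) with hc
  have hcp : ∀ t, c t ^ p ^ s = c' t := fun t => by
    rw [← iterateFrobeniusEquiv_def F p s, hc]; simp
  set E : Fin M × Fin d → AdjoinRoot Φ := fun j => ∑ i, c (i, j) • mon Φ (i : Fin A × Fin d).1 i.2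
    with hE
  have hEmem : ∀ j, E j ∈ fil w Φ (A + w * d) := fun j =>
    Submodule.sum_mem _ fun i _ => Submodule.smul_mem _ _ (hmonI i)
  set H : AdjoinRoot Φ := ∑ j, E j * mon Φ (j : Fin M × Fin d).1 j.2 ^ p ^ r with hH
  obtain ⟨σ, hσ⟩ := exists_powerSeries_embedding hΦ hirr hsep
  have hσ' : ∀ m, ∀ u ∈ fil w Φ m, u ≠ 0 → ∃ s ≤ d * m, PowerSeries.coeff s (σ u) ≠ 0 := by
    rintro m _ ⟨P, hP, rfl⟩ hu
    exact hσ w m P hW hP hu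
  have hex : ∀ P : F[X][X], ∃ m, WD w P m := fun P =>
    ⟨∑ k ∈ P.support, ((P.coeff k).natDegree + w * k), fun k hk =>
      Finset.single_le_sum (f := fun k => (P.coeff k).natDegree + w * k)
        (fun _ _ => Nat.zero_le _) (mem_support_iff.2 hk)⟩
  have hσinj : Function.Injective σ := by
    rw [injective_iff_map_eq_zero]
    intro u hu
    by_contra hne
    obtain ⟨P, rfl⟩ := AdjoinRoot.mk_surjective u
    obtain ⟨m, hm⟩ := hex P
    obtain ⟨s, -, hs⟩ := hσ w m P hW hm hne
    rw [hu] at hs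
    simp at hs
  have hE0 : E ≠ 0 := by
    intro h0
    apply hc'0
    ext ⟨i, j⟩
    have h1 : ∑ i, c (i, j) • mon Φ (i : Fin A × Fin d).1 i.2 = 0 := congrFun h0 j
    have := Fintype.linearIndependent_iff.1 (linearIndependent_mon hΦ A) (fun i => c (i, j)) h1 i
    rw [← hcp, this, zero_pow (pow_ne_zero _ (Fact.out : p.Prime).ne_zero)]
    rfl
  have hHne : H ≠ 0 := by
    intro h0
    have h1 := PowerSeries.sum_mul_pow_ne_zero p r
      (κ := fun j : Fin M × Fin d => σ (mon Φ j.1 j.2)) (e := fun j => σ (E j))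
      ((linearIndependent_mon hΦ M).map' σ.toLinearMap (LinearMap.ker_eq_bot.2 hσinj))
      (by
        intro h
        apply hE0
        ext1 j
        exact hσinj (by rw [congrFun h j]; simp))
      (by
        intro a ha
        have h2 : ∑ j, a j • σ (E j) = σ (∑ j, a j • E j) := by simp
        rw [h2] at ha ⊢
        obtain ⟨s, hs, hs'⟩ := hσ' _ (∑ j, a j • E j)
          (Submodule.sum_mem _ fun j _ => Submodule.smul_mem _ _ (hEmem j))
          (by rintro h; exact ha (by rw [h, map_zero]))
        exact ⟨s, by omega, hs'⟩)
    apply h1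
    have h2 := congrArg σ h0
    rw [hH] at h2
    simpa using h2
  have hHmem : H ∈ fil w Φ (A + w * d + p ^ r * (M + w * d)) :=
    Submodule.sum_mem _ fun j _ => mul_mem_fil (hEmem j) (pow_mem_fil (mon_mem_fil
      (Nat.add_le_add j.1.2.le (Nat.mul_le_mul_left _ j.2.2.le))) _)
  obtain ⟨P, hP, hPH⟩ := hHmem
  refine (card_points_le_natDegree_norm hΦ hirr (hPH ▸ hHne) Z (fun z hz => (hZ z hz).1) ?_).trans
    (natDegree_norm_mk_le hΦ rfl hW hP)
  intro z hz
  obtain ⟨h, hx, hy⟩ := hZ z hz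
  rw [← ptHom_mk z.1 z.2 h, hPH]
  set φ := ptHom Φ z.1 z.2 h with hφ
  have hmon : ∀ a b, φ (mon Φ a b) = z.1 ^ a * z.2 ^ b := by
    intro a b
    rw [hφ, mon, ptHom_mk, evalEval_mul, evalEval_C, evalEval_pow, evalEval_X, eval_pow, eval_X]
  have hyp : ∀ b : ℕ, (z.2 ^ p ^ (r + s)) ^ b = ∑ j : Fin e,
      φ (((X : (AdjoinRoot Φ)[X]) ^ b %ₘ Θ).coeff j) * (z.2 ^ p ^ (r + s)) ^ (j : ℕ) := by
    intro b
    have h1 := congrArg (eval₂ (φ : AdjoinRoot Φ →+* F) (z.2 ^ p ^ (r + s)))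
      (modByMonic_add_div ((X : (AdjoinRoot Φ)[X]) ^ b) Θ)
    rw [eval₂_add, eval₂_mul, hy, zero_mul, add_zero, eval₂_X_pow] at h1
    rw [← h1]
    by_cases hΘ1 : Θ = 1
    · exfalso
      rw [hΘ1] at hy
      simp at hy
    rw [eval₂_eq_sum_range' _ (natDegree_modByMonic_lt _ hΘ hΘ1), Finset.sum_range]
    rfl
  have : (φ H) ^ p ^ s = 0 := by
    have h1 : (φ H) ^ p ^ s = ∑ j : Fin e, φ (∑ t, c' t • g t j) * (z.2 ^ p ^ (r + s)) ^ (j : ℕ) := by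
      rw [hH, map_sum, sum_pow_char_pow]
      have h2 : ∀ j : Fin M × Fin d, (φ (E j * mon Φ j.1 j.2 ^ p ^ r)) ^ p ^ s =
          ∑ i : Fin A × Fin d, c' (i, j) * (φ (mon Φ i.1 i.2)) ^ p ^ s *
            (z.1 ^ (j.1 : ℕ) * ∑ l : Fin e, φ (((X : (AdjoinRoot Φ)[X]) ^ (j.2 : ℕ) %ₘ Θ).coeff l) *
              (z.2 ^ p ^ (r + s)) ^ (l : ℕ)) := by
        intro j
        rw [map_mul, mul_pow, hE, map_sum, sum_pow_char_pow, Finset.sum_mul]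
        refine Finset.sum_congr rfl fun i _ => ?_
        rw [map_smul, smul_eq_mul, mul_pow, hcp, map_pow, ← pow_mul, ← pow_add, hmon j.1 j.2,
          mul_pow (z.1 ^ _), pow_right_comm z.1, hx, pow_right_comm z.2, hyp]
      simp_rw [h2, map_sum, Finset.sum_mul, Finset.mul_sum]
      conv_rhs => rw [Finset.sum_comm, Fintype.sum_prod_type_right]
      refine Finset.sum_congr rfl fun j _ => ?_
      refine Finset.sum_congr rfl fun i _ => ?_
      refine Finset.sum_congr rfl fun jj _ => ?_
      rw [map_smul, smul_eq_mul, hg]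
      simp only [map_mul, map_pow]
      rw [hmon (j.1 : ℕ) 0, pow_zero, mul_one]
      ring
    rw [h1]
    simp [hc'g]
  exact pow_eq_zero_iff (pow_ne_zero _ (Fact.out : p.Prime).ne_zero) |>.1 this

end Stepanov

end

section
open Polynomial

theorem card_le_mul_of_pow_eq {F : Type*} [Field F] {Φ : F[X][X]} (hΦ : Φ.Monic) {q : ℕ}
    (hq : 1 < q) (Z : Finset (F × F)) (hZ : ∀ z ∈ Z, Φ.evalEval z.1 z.2 = 0 ∧ z.1 ^ q = z.1) :
    Z.card ≤ Φ.natDegree * q := by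
  classical
  have h1 : ∀ x ∈ Z.image Prod.fst, (Z.filter fun z => z.1 = x).card ≤ Φ.natDegree := by
    intro x _
    have hm : (Φ.map (evalRingHom x)).Monic := hΦ.map _
    calc (Z.filter fun z => z.1 = x).card
        = ((Z.filter fun z => z.1 = x).image Prod.snd).card := by
          rw [Finset.card_image_of_injOn]
          rintro ⟨a, b⟩ h ⟨a', b'⟩ h' hb
          simp only [Finset.coe_filter, Set.mem_ofPred_eq] at h h'
          exact Prod.ext (h.2.trans h'.2.symm) hb
      _ ≤ (Φ.map (evalRingHom x)).roots.toFinset.card := by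
          apply Finset.card_le_card
          intro y hy
          simp only [Finset.mem_image, Finset.mem_filter] at hy
          obtain ⟨⟨a, b⟩, ⟨hz, rfl⟩, rfl⟩ := hy
          rw [Multiset.mem_toFinset, mem_roots hm.ne_zero, IsRoot.def, eval_map, eval₂_evalRingHom]
          exact (hZ _ hz).1
      _ ≤ _ := (Multiset.toFinset_card_le _).trans
          ((card_roots' _).trans (natDegree_map_le))
  have h2 : (Z.image Prod.fst).card ≤ q := by
    have hne : (X ^ q - X : F[X]) ≠ 0 := FiniteField.X_pow_card_sub_X_ne_zero F hq
    calc (Z.image Prod.fst).card ≤ (X ^ q - X : F[X]).roots.toFinset.card := by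
          apply Finset.card_le_card
          intro x hx
          obtain ⟨z, hz, rfl⟩ := Finset.mem_image.1 hx
          rw [Multiset.mem_toFinset, mem_roots hne, IsRoot.def]
          simp [(hZ z hz).2]
      _ ≤ (X ^ q - X : F[X]).natDegree := (Multiset.toFinset_card_le _).trans (card_roots' _)
      _ = q := FiniteField.X_pow_card_sub_X_natDegree_eq F hq
  exact (Finset.card_le_mul_card_image Z _ h1).trans (Nat.mul_le_mul_left _ h2)

theorem stepanov_parameters {d w e p R Q : ℕ} (hd : 0 < d) (hQ : Q ≤ p * R)
    (hR : 2 * (d + w * d ^ 2 + e) + 2 ≤ R) :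
    ∃ A M, d * (A + w * d) < R ∧
      e * d * (Q * (A + w * d) + M + w * d + w * e + 1) < d * A * (d * M) ∧
      d * M ≤ e * Q + d * (2 + 2 * p * (e ^ 2 + e * w * d ^ 2) + 2 * e * d * (w * d + w * e + 1)) := by
  obtain ⟨t, ht⟩ : ∃ t, t = (R - 1) / d := ⟨_, rfl⟩
  have h1 : d * t ≤ R - 1 := by rw [ht]; exact Nat.mul_div_le _ _
  have h2 : R - 1 < d * t + d := by rw [ht]; exact Nat.lt_mul_div_succ _ hd |>.trans_eq (by ring)
  have h3 : w * d ≤ t := by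
    by_contra! h
    have : d * t ≤ d * (w * d) := Nat.mul_le_mul_left _ h.le
    have : d * (w * d) = w * d ^ 2 := by ring
    omega
  obtain ⟨A, rfl⟩ := Nat.exists_eq_add_of_le' h3
  set C1 := 1 + 2 * p * (e ^ 2 + e * w * d ^ 2) + 2 * e * d * (w * d + w * e + 1) with hC1
  obtain ⟨v, hv⟩ : ∃ v, v = e * Q / d := ⟨_, rfl⟩
  have h4 : d * v ≤ e * Q := by rw [hv]; exact Nat.mul_div_le _ _
  have h5 : e * Q < d * v + d := by rw [hv]; exact Nat.lt_mul_div_succ _ hd |>.trans_eq (by ring)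
  refine ⟨A, v + (C1 + 1), by omega, ?_, ?_⟩
  swap
  · rw [mul_add, show 2 + 2 * p * (e ^ 2 + e * w * d ^ 2) + 2 * e * d * (w * d + w * e + 1) = C1 + 1
      by rw [hC1]; ring]
    omega
  obtain ⟨D, hD⟩ : ∃ D, D = d * A := ⟨_, rfl⟩
  have h6 : R + 2 * e ≤ 2 * D := by
    have : d * (A + w * d) = d * A + w * d ^ 2 := by ring
    omega
  obtain ⟨N, hN⟩ : ∃ N, N = d * (v + (C1 + 1)) := ⟨_, rfl⟩
  have h7 : e * Q + C1 ≤ N := by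
    have : C1 ≤ d * C1 := Nat.le_mul_of_pos_left _ hd
    have : d * (v + (C1 + 1)) = d * v + d * C1 + d := by ring
    omega
  rw [← hD, ← hN]
  have h8 : e * d * (Q * (A + w * d) + (v + (C1 + 1)) + w * d + w * e + 1) =
      e * Q * D + e * Q * (w * d ^ 2) + e * N + e * d * (w * d + w * e + 1) := by
    rw [hD, hN]; ring
  rw [h8]
  zify at h6 h7 hQ hR hC1 ⊢
  obtain ⟨f, hf⟩ : ∃ f : ℤ, f = (D : ℤ) - e := ⟨_, rfl⟩
  have hDf : (D : ℤ) = f + e := by linarith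
  have hfR : (R : ℤ) ≤ 2 * f := by linarith
  have hR1 : (1 : ℤ) ≤ R := by nlinarith [Nat.zero_le d, Nat.zero_le e, sq_nonneg (d : ℤ)]
  have key1 : f * (e * Q + C1) ≤ f * N := mul_le_mul_of_nonneg_left h7 (by linarith)
  have key2 : (R : ℤ) * C1 ≤ 2 * f * C1 := mul_le_mul_of_nonneg_right hfR (by positivity)
  have key3 : ((e : ℤ) ^ 2 + e * w * d ^ 2) * Q ≤ (e ^ 2 + e * w * d ^ 2) * (p * R) :=
    mul_le_mul_of_nonneg_left hQ (by positivity)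
  have key4 : (e : ℤ) * d * (w * d + w * e + 1) * 1 ≤ e * d * (w * d + w * e + 1) * R :=
    mul_le_mul_of_nonneg_left hR1 (by positivity)
  have key5 : (R : ℤ) * C1 = R + 2 * ((e ^ 2 + e * w * d ^ 2) * (p * R)) +
      2 * (e * d * (w * d + w * e + 1) * R) := by rw [hC1]; ring
  rw [hDf]
  nlinarith

/-- Stepanov's bound, uniformly in the curve. -/
theorem stepanov_bound (p d w e : ℕ) [Fact p.Prime] (hd : 0 < d) :
    ∃ C : ℕ, ∀ {F : Type} [Field F] [IsAlgClosed F] [CharP F p] {Φ : F[X][X]} (_ : Φ.Monic)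
      (_ : Φ.natDegree = d) (_ : Irreducible Φ) (_ : derivative Φ ≠ 0) (_ : WD w Φ (w * d))
      {Θ : (AdjoinRoot Φ)[X]} (_ : Θ.Monic) (_ : Θ.natDegree = e)
      (_ : ∀ j < e, Θ.coeff j ∈ fil w Φ (w * (e - j))) (k : ℕ) (_ : k ≠ 0)
      (Z : Finset (F × F)) (_ : ∀ z ∈ Z, ∃ h : Φ.evalEval z.1 z.2 = 0, z.1 ^ p ^ k = z.1 ∧
        Θ.eval₂ (ptHom Φ z.1 z.2 h : AdjoinRoot Φ →+* F) (z.2 ^ p ^ k) = 0),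
      (Z.card : ℝ) ≤ e * p ^ k + C * √(p ^ k) := by
  set C0 := 2 + 2 * p * (e ^ 2 + e * w * d ^ 2) + 2 * e * d * (w * d + w * e + 1) with hC0
  set R0 := 2 * (d + w * d ^ 2 + e) + 2 with hR0
  refine ⟨1 + d * C0 + w * d ^ 2 + d * p * R0, ?_⟩
  intro F _ _ _ Φ hΦ hdeg hirr hsep hW Θ hΘ he hΘc k hk Z hZ
  have hp : p.Prime := Fact.out
  obtain ⟨r, s, hrs, hs⟩ : ∃ r s, k = r + s ∧ (s = r ∨ s = r + 1) :=
    ⟨k / 2, k - k / 2, by omega, by omega⟩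
  have hQ : p ^ s ≤ p * p ^ r := by
    rcases hs with rfl | rfl
    · exact Nat.le_mul_of_pos_left _ hp.pos
    · rw [pow_succ']
  have hRs : ((p ^ r : ℕ) : ℝ) ≤ √((p : ℝ) ^ k) := by
    apply Real.le_sqrt_of_sq_le
    rw [hrs]
    push_cast
    rw [← pow_mul]
    exact pow_le_pow_right₀ (by exact_mod_cast hp.one_le) (by omega)
  have main : Z.card ≤ e * p ^ k + (1 + d * C0 + w * d ^ 2 + d * p * R0) * p ^ r := by
    rcases le_or_gt R0 (p ^ r) with h | h
    · obtain ⟨A, M, hA, hM, hdM⟩ := stepanov_parameters (w := w) (e := e) hd hQ h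
      subst hdeg he
      have := card_le_of_auxiliary p hΦ hirr hsep hW hΘ hΘc hA hM Z (by rwa [← hrs])
      rw [← hC0] at hdM
      refine this.trans ?_
      have h1 : Φ.natDegree * (A + w * Φ.natDegree + p ^ r * (M + w * Φ.natDegree)) =
        Φ.natDegree * (A + w * Φ.natDegree) + p ^ r * (Φ.natDegree * M) +
          p ^ r * (w * Φ.natDegree ^ 2) := by ring
      have h2 := Nat.mul_le_mul_left (p ^ r) hdM
      have h3 : p ^ r * (Θ.natDegree * p ^ s + Φ.natDegree * C0) =
        Θ.natDegree * p ^ k + (Φ.natDegree * C0) * p ^ r := by rw [hrs, pow_add]; ring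
      have h4 : 0 ≤ Φ.natDegree * p * R0 * p ^ r := Nat.zero_le _
      nlinarith
    · have := card_le_mul_of_pow_eq hΦ (Nat.one_lt_pow hk hp.one_lt) Z
        (fun z hz => ⟨(hZ z hz).1, (hZ z hz).2.1⟩)
      rw [hdeg] at this
      have h1 : d * p ^ k ≤ d * p * R0 * p ^ r := by
        rw [hrs, pow_add, mul_assoc, mul_assoc]
        apply Nat.mul_le_mul_left
        calc p ^ r * p ^ s ≤ p ^ r * (p * p ^ r) := Nat.mul_le_mul_left _ hQ
          _ ≤ p ^ r * (p * R0) := by gcongr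
          _ = _ := by ring
      have h2 : d * p * R0 * p ^ r ≤ (1 + d * C0 + w * d ^ 2 + d * p * R0) * p ^ r :=
        Nat.mul_le_mul_right _ (by omega)
      omega
  calc (Z.card : ℝ) ≤ ((e * p ^ k + (1 + d * C0 + w * d ^ 2 + d * p * R0) * p ^ r : ℕ) : ℝ) := by
        exact_mod_cast main
    _ = e * p ^ k + ((1 + d * C0 + w * d ^ 2 + d * p * R0 : ℕ) : ℝ) * ((p ^ r : ℕ) : ℝ) := by
        push_cast; ring
    _ ≤ _ := by gcongr

end

section
open Polynomial

/-- The finite set of elements `x` of a field with `x ^ q = x`. -/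
noncomputable def fixedPts (F : Type*) [Field F] (q : ℕ) : Finset F := by
  classical exact (X ^ q - X : F[X]).roots.toFinset

theorem mem_fixedPts {F : Type*} [Field F] {q : ℕ} (hq : 1 < q) {x : F} :
    x ∈ fixedPts F q ↔ x ^ q = x := by
  classical
  have h : (X ^ q - X : F[X]) ≠ 0 := FiniteField.X_pow_card_sub_X_ne_zero F hq
  simp [fixedPts, mem_roots h, sub_eq_zero]

theorem card_fixedPts {F : Type*} [Field F] [IsAlgClosed F] (p : ℕ) [Fact p.Prime] [CharP F p]
    {k : ℕ} (hk : k ≠ 0) : (fixedPts F (p ^ k)).card = p ^ k := by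
  classical
  have h1 : 1 < p ^ k := Nat.one_lt_pow hk (Fact.out : p.Prime).one_lt
  have hsep : (X ^ p ^ k - X : F[X]).Separable := galois_poly_separable p _ (dvd_pow_self p hk)
  rw [fixedPts, Multiset.toFinset_card_of_nodup (nodup_roots hsep),
    IsAlgClosed.card_roots_eq_natDegree, FiniteField.X_pow_card_sub_X_natDegree_eq F h1]

/-- The zeros of a bivariate polynomial with both coordinates fixed by `x ↦ x ^ q`. -/
noncomputable def affinePts {F : Type*} [Field F] (Φ : F[X][X]) (q : ℕ) : Finset (F × F) := by
  classical exact (fixedPts F q ×ˢ fixedPts F q).filter fun z => Φ.evalEval z.1 z.2 = 0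

theorem mem_affinePts {F : Type*} [Field F] {Φ : F[X][X]} {q : ℕ} (hq : 1 < q) {z : F × F} :
    z ∈ affinePts Φ q ↔ z.1 ^ q = z.1 ∧ z.2 ^ q = z.2 ∧ Φ.evalEval z.1 z.2 = 0 := by
  classical
  simp [affinePts, mem_fixedPts hq, and_assoc]

theorem derivative_ne_zero_of_natDegree_lt {R : Type*} [CommRing R] [IsDomain R] {p : ℕ} [CharP R p]
    {Φ : R[X]} (hΦ : Φ.Monic) (hd : 0 < Φ.natDegree) (hdp : Φ.natDegree < p) :
    derivative Φ ≠ 0 := by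
  intro h
  have h1 : (derivative Φ).coeff (Φ.natDegree - 1) = 0 := by rw [h, coeff_zero]
  rw [coeff_derivative, Nat.sub_add_cancel hd, hΦ.coeff_natDegree, one_mul] at h1
  have h2 : ((Φ.natDegree : ℕ) : R) = 0 := by
    rw [← h1, Nat.cast_sub hd]; simp
  rw [CharP.cast_eq_zero_iff R p] at h2
  exact absurd (Nat.le_of_dvd hd h2) (by omega)

theorem card_affinePts_le (p d w : ℕ) [Fact p.Prime] (hd : 0 < d) (hdp : d < p) :
    ∃ C : ℕ, ∀ {F : Type} [Field F] [IsAlgClosed F] [CharP F p] {Φ : F[X][X]} (_ : Φ.Monic)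
      (_ : Φ.natDegree = d) (_ : Irreducible Φ) (_ : WD w Φ (w * d)) (k : ℕ) (_ : k ≠ 0),
      ((affinePts Φ (p ^ k)).card : ℝ) ≤ p ^ k + C * √(p ^ k) := by
  obtain ⟨C, hC⟩ := stepanov_bound p d w 1 hd
  refine ⟨C, fun {F} _ _ _ {Φ} hΦ hd' hirr hW k hk => ?_⟩
  have hder : derivative Φ ≠ 0 :=
    derivative_ne_zero_of_natDegree_lt (p := p) hΦ (by omega) (by omega)
  have : Nontrivial (AdjoinRoot Φ) := (AdjoinRoot.isDomain_of_prime hirr.prime).toNontrivial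
  have hq : 1 < p ^ k := Nat.one_lt_pow hk (Fact.out : p.Prime).one_lt
  have := hC hΦ hd' hirr hder hW (Θ := X - Polynomial.C (AdjoinRoot.root Φ)) (monic_X_sub_C _)
    (natDegree_X_sub_C _) (by
      intro j hj
      obtain rfl : j = 0 := by omega
      simp only [coeff_sub, coeff_X_zero, coeff_C_zero, zero_sub, Nat.sub_zero, mul_one]
      exact Submodule.neg_mem _ (mk_mem_fil WD.X)) k hk (affinePts Φ (p ^ k)) (by
      intro z hz
      rw [mem_affinePts hq] at hz
      refine ⟨hz.2.2, hz.1, ?_⟩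
      have hr : (ptHom Φ z.1 z.2 hz.2.2 : AdjoinRoot Φ →+* F) (AdjoinRoot.root Φ) = z.2 := by
        have := ptHom_mk z.1 z.2 hz.2.2 (X : F[X][X])
        rw [evalEval_X] at this
        exact this
      rw [eval₂_sub, eval₂_X, eval₂_C, hr, hz.2.1, sub_self])
  simpa using this

/-- The coefficients of `Φ(T)/(T - y)`, where `y` is the class of `Y`. -/
theorem coeff_divByMonic_root_mem_fil {F : Type*} [Field F] {Φ : F[X][X]} {w d : ℕ}
    (hd : Φ.natDegree = d) (hW : WD w Φ (w * d)) (j : ℕ) :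
    ((Φ.map (AdjoinRoot.of Φ)) /ₘ (X - Polynomial.C (AdjoinRoot.root Φ))).coeff j ∈
      fil w Φ (w * (d - 1 - j)) := by
  rw [coeff_divByMonic_X_sub_C]
  refine Submodule.sum_mem _ fun i hi => ?_
  rw [Finset.mem_Icc] at hi
  have hid : i ≤ d := hd ▸ hi.2.trans natDegree_map_le
  rw [coeff_map]
  by_cases h0 : Φ.coeff i = 0
  · rw [h0, map_zero, mul_zero]; exact Submodule.zero_mem _
  have h1 := hW i h0
  have h2 : AdjoinRoot.of Φ (Φ.coeff i) ∈ fil w Φ (w * (d - i)) :=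
    mk_mem_fil (P := C (Φ.coeff i)) (WD.C (by rw [Nat.mul_sub]; omega))
  have h3 := mul_mem_fil (pow_mem_fil (mk_mem_fil (Φ := Φ) (WD.X (w := w))) (i - (j + 1))) h2
  refine fil_mono ?_ h3
  rw [mul_comm, ← Nat.mul_add]
  exact Nat.mul_le_mul_left _ (by omega)

theorem sub_le_card_affinePts (p d w : ℕ) [Fact p.Prime] (hd : 0 < d) (hdp : d < p) :
    ∃ C : ℕ, ∀ {F : Type} [Field F] [IsAlgClosed F] [CharP F p] {Φ : F[X][X]} (_ : Φ.Monic)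
      (_ : Φ.natDegree = d) (_ : Irreducible Φ) (_ : WD w Φ (w * d)) (k : ℕ) (_ : k ≠ 0)
      (_ : ∀ x y, x ^ p ^ k = x → Φ.evalEval x y = 0 → Φ.evalEval x (y ^ p ^ k) = 0),
      (p : ℝ) ^ k - C * √(p ^ k) ≤ ((affinePts Φ (p ^ k)).card : ℝ) := by
  obtain ⟨C, hC⟩ := stepanov_bound p d w (d - 1) hd
  refine ⟨C + d * (d * (w * d)), fun {F} _ _ _ {Φ} hΦ hd' hirr hW k hk hfrob => ?_⟩
  classical
  have hder : derivative Φ ≠ 0 :=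
    derivative_ne_zero_of_natDegree_lt (p := p) hΦ (by omega) (by omega)
  have : IsDomain (AdjoinRoot Φ) := AdjoinRoot.isDomain_of_prime hirr.prime
  have hq : 1 < p ^ k := Nat.one_lt_pow hk (Fact.out : p.Prime).one_lt
  set q := p ^ k with hqdef
  -- all points over fixed abscissae
  set T : Finset (F × F) := (fixedPts F q).biUnion fun x =>
    ((Φ.map (evalRingHom x)).roots.toFinset.image fun y => (x, y)) with hT
  have hmapM : ∀ x : F, (Φ.map (evalRingHom x)).Monic := fun x => hΦ.map _
  have hmapeval : ∀ x y : F, (Φ.map (evalRingHom x)).eval y = Φ.evalEval x y := by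
    intro x y; rw [eval_map, eval₂_evalRingHom]
  have hTmem : ∀ z : F × F, z ∈ T ↔ z.1 ^ q = z.1 ∧ Φ.evalEval z.1 z.2 = 0 := by
    rintro ⟨x, y⟩
    simp only [hT, Finset.mem_biUnion, Finset.mem_image, Multiset.mem_toFinset, mem_fixedPts hq,
      Prod.mk.injEq, mem_roots (hmapM _).ne_zero, IsRoot.def, hmapeval]
    constructor
    · rintro ⟨a, ha, b, hb, rfl, rfl⟩; exact ⟨ha, hb⟩
    · rintro ⟨ha, hb⟩; exact ⟨x, ha, y, hb, rfl, rfl⟩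
  -- bad points
  have hP0 : AdjoinRoot.mk Φ (derivative Φ) ≠ 0 := by
    rw [Ne, AdjoinRoot.mk_eq_zero]
    intro hdvd
    have := natDegree_le_of_dvd hdvd hder
    have h2 := natDegree_derivative_lt (p := Φ) (by omega)
    omega
  have hWder : WD w (derivative Φ) (w * d) := by
    intro i hi
    rw [coeff_derivative] at hi ⊢
    have h0 : Φ.coeff (i + 1) ≠ 0 := left_ne_zero_of_mul hi
    have h1 := hW _ h0
    have h2 : (Φ.coeff (i + 1) * ((i : F[X]) + 1)).natDegree ≤ (Φ.coeff (i + 1)).natDegree := by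
      refine natDegree_mul_le.trans ?_
      have : ((i : F[X]) + 1).natDegree = 0 := by
        have := natDegree_natCast (R := F) (i + 1)
        simpa using this
      omega
    rw [Nat.mul_add] at h1
    omega
  set Bd : Finset F := ((T.filter fun z => (derivative Φ).evalEval z.1 z.2 = 0)).image Prod.fst
    with hBd
  have hBdcard : Bd.card ≤ d * (w * d) := by
    refine Finset.card_image_le.trans ?_
    refine (card_points_le_natDegree_norm hΦ hirr hP0 _ ?_ ?_).trans
      (natDegree_norm_mk_le hΦ hd' hW hWder)
    · intro z hz; exact ((hTmem z).1 (Finset.mem_filter.1 hz).1).2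
    · intro z hz; exact (Finset.mem_filter.1 hz).2
  have hTcard : d * q ≤ T.card + d * (d * (w * d)) := by
    have h1 : ∀ x ∈ fixedPts F q \ Bd,
        ((Φ.map (evalRingHom x)).roots.toFinset.image fun y => (x, y)).card = d := by
      intro x hx
      rw [Finset.mem_sdiff] at hx
      rw [Finset.card_image_of_injective _ (Prod.mk_right_injective x),
        Multiset.toFinset_card_of_nodup, IsAlgClosed.card_roots_eq_natDegree,
        (hΦ.natDegree_map _), hd']
      rw [Multiset.nodup_iff_count_le_one]
      intro y
      rw [count_roots]
      by_contra hlt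
      rw [not_le, one_lt_rootMultiplicity_iff_isRoot (hmapM x).ne_zero] at hlt
      apply hx.2
      rw [hBd, Finset.mem_image]
      refine ⟨(x, y), ?_, rfl⟩
      rw [Finset.mem_filter, hTmem]
      rw [IsRoot.def, IsRoot.def, hmapeval, derivative_map, eval_map, eval₂_evalRingHom] at hlt
      exact ⟨⟨(mem_fixedPts hq).1 hx.1, hlt.1⟩, hlt.2⟩
    have h2 : ((fixedPts F q \ Bd).biUnion fun x =>
        ((Φ.map (evalRingHom x)).roots.toFinset.image fun y => (x, y))).card
        = (fixedPts F q \ Bd).card * d := by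
      rw [Finset.card_biUnion, Finset.sum_congr rfl h1, Finset.sum_const, smul_eq_mul]
      intro x _ x' _ hne
      rw [Function.onFun, Finset.disjoint_left]
      rintro ⟨a, b⟩ ha hb
      simp only [Finset.mem_image, Prod.mk.injEq] at ha hb
      obtain ⟨_, _, rfl, _⟩ := ha
      obtain ⟨_, _, rfl, _⟩ := hb
      exact hne rfl
    have h3 := Finset.card_le_card (Finset.biUnion_subset_biUnion_of_subset_left
      (fun x => ((Φ.map (evalRingHom x)).roots.toFinset.image fun y => (x, y)))
      (Finset.sdiff_subset (s := fixedPts F q) (t := Bd)))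
    rw [h2] at h3
    have h4 : q ≤ (fixedPts F q \ Bd).card + d * (w * d) := by
      have := Finset.le_card_sdiff Bd (fixedPts F q)
      rw [card_fixedPts p hk] at this
      omega
    calc d * q ≤ d * ((fixedPts F q \ Bd).card + d * (w * d)) := Nat.mul_le_mul_left _ h4
      _ = (fixedPts F q \ Bd).card * d + d * (d * (w * d)) := by ring
      _ ≤ _ := Nat.add_le_add_right h3 _
  -- points with non-fixed ordinate
  set Φm := Φ.map (AdjoinRoot.of Φ) with hΦm
  have hΦmM : Φm.Monic := hΦ.map _
  set Θ := Φm /ₘ (X - Polynomial.C (AdjoinRoot.root Φ)) with hΘ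
  have hroot : IsRoot Φm (AdjoinRoot.root Φ) := AdjoinRoot.isRoot_root Φ
  have hmul : (X - Polynomial.C (AdjoinRoot.root Φ)) * Θ = Φm := mul_divByMonic_eq_iff_isRoot.2 hroot
  have hΘM : Θ.Monic := (monic_X_sub_C _).of_mul_monic_left (hmul ▸ hΦmM)
  have hΘd : Θ.natDegree = d - 1 := by
    rw [hΘ, natDegree_divByMonic _ (monic_X_sub_C _), natDegree_X_sub_C, hΦm,
      hΦ.natDegree_map, hd']
  set W := T.filter fun z => z.2 ^ q ≠ z.2 with hWW
  have hmain := hC hΦ hd' hirr hder hW hΘM hΘd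
    (fun j _ => coeff_divByMonic_root_mem_fil hd' hW j) k hk
    W (by
      intro z hz
      rw [hWW, Finset.mem_filter, hTmem] at hz
      refine ⟨hz.1.2, hz.1.1, ?_⟩
      have h1 := hfrob z.1 z.2 hz.1.1 hz.1.2
      have h2 : Φm.eval₂ (ptHom Φ z.1 z.2 hz.1.2 : AdjoinRoot Φ →+* F) (z.2 ^ q) = 0 := by
        rw [hΦm, eval₂_map]
        have : (ptHom Φ z.1 z.2 hz.1.2 : AdjoinRoot Φ →+* F).comp (AdjoinRoot.of Φ)
            = evalRingHom z.1 := by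
          ext a
          · simpa [evalEval_C] using ptHom_mk z.1 z.2 hz.1.2 (Polynomial.C (Polynomial.C a))
          · simpa [evalEval_C] using ptHom_mk z.1 z.2 hz.1.2 (Polynomial.C X)
        rw [this, eval₂_evalRingHom]
        exact h1
      rw [← hmul, eval₂_mul, mul_eq_zero] at h2
      refine h2.resolve_left ?_
      have hr : (ptHom Φ z.1 z.2 hz.1.2 : AdjoinRoot Φ →+* F) (AdjoinRoot.root Φ) = z.2 := by
        have := ptHom_mk z.1 z.2 hz.1.2 (X : F[X][X])
        rw [evalEval_X] at this
        exact this
      rw [eval₂_sub, eval₂_X, eval₂_C, hr]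
      exact sub_ne_zero.2 hz.2)
  have hsplit : T.card ≤ (affinePts Φ q).card + W.card := by
    rw [hWW, ← Finset.card_filter_add_card_filter_not (s := T) (fun z => z.2 ^ q ≠ z.2), add_comm]
    gcongr
    intro z hz
    rw [Finset.mem_filter, hTmem] at hz
    rw [mem_affinePts hq]
    exact ⟨hz.1.1, not_not.1 hz.2, hz.1.2⟩
  have hq1 : (1 : ℝ) ≤ √(p ^ k) := by
    rw [Real.one_le_sqrt]
    exact_mod_cast hq.le
  have h5 : ((d * q : ℕ) : ℝ) ≤ (((affinePts Φ q).card + W.card +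
    d * (d * (w * d)) : ℕ) : ℝ) := by exact_mod_cast hTcard.trans (by omega)
  have h6 : ((d - 1 : ℕ) : ℝ) = d - 1 := by rw [Nat.cast_sub hd]; simp
  rw [h6] at hmain
  have h7 : (q : ℝ) = (p : ℝ) ^ k := by rw [hqdef]; push_cast; rfl
  push_cast at h5 ⊢
  rw [h7] at h5
  have h8 : (d : ℝ) * (d * (w * d)) ≤ d * (d * (w * d)) * √(p ^ k) :=
    le_mul_of_one_le_right (by positivity) hq1
  linarith

end

section
open Polynomial

section ArtinSchreier
variable {F : Type*} [Field F] {p : ℕ} [Fact p.Prime] [CharP F p]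

omit [CharP F p] in
theorem artinSchreier_monic (c : F) : (X ^ p - X + C c : F[X]).Monic := by
  have : (X ^ p - X + C c : F[X]) = X ^ p + (- X + C c) := by ring
  rw [this]
  refine monic_X_pow_add ?_
  have h : (1 : ℕ) < p := (Fact.out : p.Prime).one_lt
  refine (degree_add_le _ _).trans_lt (max_lt ?_ ?_)
  · rw [degree_neg, degree_X]; exact_mod_cast h
  · exact degree_C_le.trans_lt (by exact_mod_cast (by omega))

omit [CharP F p] in
theorem artinSchreier_natDegree (c : F) : (X ^ p - X + C c : F[X]).natDegree = p := by
  have : (X ^ p - X + C c : F[X]) = X ^ p + (- X + C c) := by ring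
  rw [this]
  have h : (1 : ℕ) < p := (Fact.out : p.Prime).one_lt
  rw [natDegree_add_eq_left_of_degree_lt, natDegree_X_pow]
  rw [degree_X_pow]
  refine (degree_add_le _ _).trans_lt (max_lt ?_ ?_)
  · rw [degree_neg, degree_X]; exact_mod_cast h
  · exact degree_C_le.trans_lt (by exact_mod_cast (by omega))

theorem artinSchreier_comp (c : F) :
    (X ^ p - X + C c : F[X]).comp (X + C 1) = X ^ p - X + C c := by
  have : (X + C 1 : F[X]) ^ p = X ^ p + C 1 := by
    rw [add_pow_char (R := F[X]), ← C_pow, one_pow]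
  simp only [add_comp, sub_comp, pow_comp, X_comp, C_comp, this]
  ring

theorem exists_eq_comp_artinSchreier (c : F) {g : F[X]} (hg : g.comp (X + C 1) = g) :
    ∃ h : F[X], h.comp (X ^ p - X + C c) = g := by
  set A : F[X] := X ^ p - X + C c with hA
  have hAM : A.Monic := artinSchreier_monic c
  have hAd : A.natDegree = p := artinSchreier_natDegree c
  have hp := (Fact.out : p.Prime)
  induction hn : g.natDegree using Nat.strong_induction_on generalizing g with
  | _ n ih =>
    by_cases hlt : g.natDegree < p
    · refine ⟨C (g.eval 0), ?_⟩
      rw [C_comp]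
      have hev : ∀ m : ℕ, g.eval (m : F) = g.eval 0 := by
        intro m
        induction m with
        | zero => simp
        | succ m ihm =>
          rw [← ihm]
          conv_rhs => rw [← hg]
          simp [eval_comp]
      symm
      have hinj : Function.Injective fun i : Fin p => ((i : ℕ) : F) := by
        intro i j hij
        have := (CharP.natCast_eq_natCast (R := F) p).1 hij
        rw [Nat.ModEq, Nat.mod_eq_of_lt i.2, Nat.mod_eq_of_lt j.2] at this
        exact Fin.ext this
      refine eq_of_natDegree_lt_card_of_eval_eq g _ hinj ?_ ?_
      · intro i; simp [hev]
      · simp [hlt]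
    · have hdiv := modByMonic_add_div g A
      have hAc : A.comp (X + C 1) = A := artinSchreier_comp c
      have hcomp : (g %ₘ A).comp (X + C 1) + A * (g /ₘ A).comp (X + C 1) = g := by
        conv_rhs => rw [← hg]
        conv_rhs => rw [← hdiv]
        rw [add_comp, mul_comp, hAc]
      have hdegr : ((g %ₘ A).comp (X + C 1)).degree < A.degree := by
        have h1 := degree_modByMonic_lt g hAM
        by_cases h0 : (g %ₘ A) = 0
        · rw [h0, zero_comp]; rw [h0] at h1; exact h1
        · refine lt_of_le_of_lt degree_le_natDegree ?_
          rw [natDegree_comp, natDegree_X_add_C, mul_one, ← degree_eq_natDegree h0]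
          exact h1
      have huniq := div_modByMonic_unique (f := g) _ _ hAM ⟨hcomp, hdegr⟩
      have hdlt : (g /ₘ A).natDegree < n := by
        rw [natDegree_divByMonic _ hAM, hAd]
        have := hp.pos
        omega
      have hrlt : (g %ₘ A).natDegree < n := by
        have := natDegree_modByMonic_lt g hAM (by
          intro h; rw [h, natDegree_one] at hAd; have := hp.pos; omega)
        omega
      obtain ⟨h1, hh1⟩ := ih _ hdlt huniq.1.symm rfl
      obtain ⟨h2, hh2⟩ := ih _ hrlt huniq.2.symm rfl
      refine ⟨h2 + X * h1, ?_⟩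
      rw [add_comp, mul_comp, X_comp, hh1, hh2, hdiv]

theorem irreducible_map_artinSchreier (c : F) {Φ : F[X][X]} (hΦ : Φ.Monic)
    (hirr : Irreducible Φ) (hdp : Φ.natDegree < p) :
    Irreducible (Φ.map (compRingHom (X ^ p - X + C c))) := by
  classical
  set A : F[X] := X ^ p - X + C c with hA
  set α := compRingHom A with hα
  have hAd : A.natDegree = p := artinSchreier_natDegree c
  have hp := (Fact.out : p.Prime)
  have hαinj : Function.Injective α := by
    rw [injective_iff_map_eq_zero]
    intro f hf
    have : f.comp A = 0 := hf
    rw [comp_eq_zero_iff] at this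
    rcases this with h | ⟨_, h⟩
    · exact h
    · rw [h, natDegree_C] at hAd; have := hp.pos; omega
  set Ψ := Φ.map α with hΨ
  have hΨM : Ψ.Monic := hΦ.map _
  have hΨd : Ψ.natDegree = Φ.natDegree := hΦ.natDegree_map _
  have hΨu : ¬ IsUnit Ψ := by
    rw [hΨM.isUnit_iff]
    intro h
    have h1 : Φ = 1 := map_injective _ hαinj (by rw [← hΨ, h, Polynomial.map_one])
    exact hirr.not_isUnit (h1 ▸ isUnit_one)
  -- a monic irreducible factor
  obtain ⟨G, H, hGM, hGirr, hGH⟩ : ∃ G H : F[X][X], G.Monic ∧ Irreducible G ∧ G * H = Ψ := by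
    obtain ⟨G, hG, H, hGH⟩ := WfDvdMonoid.exists_irreducible_factor hΨu hΨM.ne_zero
    have hlc : G.leadingCoeff * H.leadingCoeff = 1 := by
      rw [← leadingCoeff_mul, ← hGH, hΨM.leadingCoeff]
    have hu : IsUnit H.leadingCoeff := IsUnit.of_mul_eq_one_right _ hlc
    have hu' : IsUnit (C H.leadingCoeff : F[X][X]) := hu.map C
    refine ⟨C H.leadingCoeff * G, C G.leadingCoeff * H, ?_, ?_, ?_⟩
    · rw [Monic, leadingCoeff_mul, leadingCoeff_C, mul_comm, hlc]
    · obtain ⟨u, hu⟩ := hu'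
      rw [← hu]
      exact (irreducible_units_mul u).2 hG
    · rw [hGH]
      calc C H.leadingCoeff * G * (C G.leadingCoeff * H)
          = C (G.leadingCoeff * H.leadingCoeff) * (G * H) := by rw [C_mul]; ring
        _ = _ := by rw [hlc, C_1, one_mul]
  set σ : F[X] ≃+* F[X] := (algEquivAevalXAddC (1 : F)).toRingEquiv with hσ
  have hσap : ∀ f, σ f = f.comp (X + C 1) := fun f => by
    rw [comp_eq_aeval]; rfl
  set τ : F[X][X] ≃+* F[X][X] := mapEquiv σ with hτ
  have hτap : ∀ P, τ P = P.map (σ : F[X] →+* F[X]) := fun P => rfl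
  have hτcoeff : ∀ P i, (τ P).coeff i = (P.coeff i).comp (X + C 1) := fun P i => by
    rw [hτap, coeff_map]; exact hσap _
  have hτn : ∀ n P i, (τ^[n] P).coeff i = (P.coeff i).comp (X + C (n : F)) := by
    intro n
    induction n with
    | zero => intro P i; simp
    | succ n ih =>
      intro P i
      rw [Function.iterate_succ_apply', hτcoeff, ih, comp_assoc]
      congr 1
      simp
      ring
  have hτΨ : τ Ψ = Ψ := by
    ext1 i
    rw [hτcoeff, hΨ, coeff_map]
    change ((Φ.coeff i).comp A).comp _ = (Φ.coeff i).comp A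
    rw [comp_assoc, artinSchreier_comp]
  have hτp : τ^[p] G = G := by
    ext1 i
    rw [hτn]
    simp
  have hlift : ∀ P : F[X][X], τ P = P → P ∈ lifts α := by
    intro P hP
    rw [lifts_iff_coeff_lifts]
    intro i
    have h1 : (P.coeff i).comp (X + C 1) = P.coeff i := by rw [← hτcoeff, hP]
    obtain ⟨h, hh⟩ := exists_eq_comp_artinSchreier c h1
    exact ⟨h, hh⟩
  clear_value τ Ψ
  have hGfix : τ G = G := by
    have hper : Function.IsPeriodicPt τ p G := hτp
    rcases (Nat.dvd_prime hp).1 hper.minimalPeriod_dvd with h1 | h1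
    · exact Function.minimalPeriod_eq_one_iff_isFixedPt.1 h1
    exfalso
    have hinj := Function.iterate_injOn_Iio_minimalPeriod (f := τ) (x := G)
    rw [h1] at hinj
    have hirrn : ∀ n, Irreducible (τ^[n] G) ∧ (τ^[n] G).Monic ∧
        (τ^[n] G).natDegree = G.natDegree ∧ τ^[n] G ∣ Ψ := by
      intro n
      induction n with
      | zero => exact ⟨hGirr, hGM, rfl, H, hGH.symm⟩
      | succ n ih =>
        rw [Function.iterate_succ_apply' (⇑τ) n G]
        refine ⟨(MulEquiv.irreducible_iff τ).2 ih.1, ?_, ?_, ?_⟩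
        · rw [hτap]; exact ih.2.1.map _
        · rw [hτap, ih.2.1.natDegree_map, ih.2.2.1]
        · obtain ⟨t, ht⟩ := ih.2.2.2
          exact ⟨τ t, by rw [← map_mul, ← ht, hτΨ]⟩
    have hprod : ∏ n ∈ Finset.range p, τ^[n] G ∣ Ψ := by
      refine Finset.prod_dvd_of_isRelPrime ?_ (fun n _ => (hirrn n).2.2.2)
      intro m hm n hn hmn
      rw [Function.onFun, (hirrn m).1.isRelPrime_iff_not_dvd]
      intro hdvd
      have := eq_of_monic_of_dvd_of_natDegree_le (hirrn m).2.1 (hirrn n).2.1 hdvd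
        ((hirrn n).2.2.1.trans (hirrn m).2.2.1.symm).le
      exact hmn (hinj (by simpa using hm) (by simpa using hn) this.symm)
    have h2 := natDegree_le_of_dvd hprod hΨM.ne_zero
    rw [natDegree_prod_of_monic _ _ (fun n _ => (hirrn n).2.1),
      Finset.sum_congr rfl (fun n _ => (hirrn n).2.2.1), Finset.sum_const, Finset.card_range,
      smul_eq_mul, hΨd] at h2
    have h3 : 0 < G.natDegree := by
      rw [Nat.pos_iff_ne_zero]
      intro h0
      exact hGirr.not_isUnit ((hGM.natDegree_eq_zero.1 h0) ▸ isUnit_one)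
    nlinarith
  have hHfix : τ H = H := by
    have : G * τ H = G * H := by
      conv_lhs => rw [← hGfix]
      rw [← map_mul, hGH, hτΨ]
    exact mul_left_cancel₀ hGM.ne_zero this
  obtain ⟨G', hG'⟩ := (mem_lifts _).1 (hlift G hGfix)
  obtain ⟨H', hH'⟩ := (mem_lifts _).1 (hlift H hHfix)
  have hGH' : Φ = G' * H' := by
    refine map_injective _ hαinj ?_
    rw [Polynomial.map_mul, hG', hH', hGH, hΨ]
  rcases hirr.isUnit_or_isUnit hGH' with h | h
  · exact absurd (hG' ▸ h.map (mapRingHom α)) hGirr.not_isUnit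
  · have hHu : IsUnit H := hH' ▸ h.map (mapRingHom α)
    obtain ⟨u, rfl⟩ := hHu
    rw [← hGH]
    exact (irreducible_mul_units u).2 hGirr

end ArtinSchreier

/-- The number of points of `Φ` over the field with `p ^ k` elements whose abscissa has a given
trace down to the prime field. -/
theorem card_filter_trace_le (p d : ℕ) [Fact p.Prime] (hd : 0 < d) (hdp : d < p) :
    ∃ C : ℕ, ∀ {F : Type} [Field F] [IsAlgClosed F] [CharP F p] {Φ : F[X][X]} (_ : Φ.Monic)
      (_ : Φ.natDegree = d) (_ : Irreducible Φ) (_ : WD 1 Φ d) (k : ℕ) (_ : k ≠ 0) (c : F)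
      (Z : Finset (F × F)) (_ : Z ⊆ affinePts Φ (p ^ k))
      (_ : ∀ z ∈ Z, ∑ i ∈ Finset.range k, z.1 ^ p ^ i = c),
      (p : ℝ) * (Z.card : ℝ) ≤ p ^ k + C * √(p ^ k) := by
  classical
  obtain ⟨C, hC⟩ := card_affinePts_le p d p hd hdp
  refine ⟨C, fun {F} _ _ _ {Φ} hΦ hd' hirr hW k hk c Z hZ hZc => ?_⟩
  have hp := (Fact.out : p.Prime)
  have hq : 1 < p ^ k := Nat.one_lt_pow hk hp.one_lt
  rcases Z.eq_empty_or_nonempty with rfl | ⟨z₀, hz₀⟩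
  · simp; positivity
  set A : F[X] := X ^ p - X + Polynomial.C z₀.1 with hA
  set Ψ := Φ.map (compRingHom A) with hΨ
  have hev : ∀ t y, Ψ.evalEval t y = Φ.evalEval (A.eval t) y := by
    intro t y
    rw [← eval₂_evalRingHom, ← eval₂_evalRingHom, hΨ, eval₂_map]
    congr 1
    ext a <;> simp
  have hWΨ : WD p Ψ (p * d) := by
    intro i hi
    have h0 : Φ.coeff i ≠ 0 := by
      rintro h; apply hi; rw [hΨ, coeff_map, h, map_zero]
    have h1 := hW i h0
    rw [hΨ, coeff_map, coe_compRingHom_apply, natDegree_comp, artinSchreier_natDegree,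
      mul_comm, ← Nat.mul_add]
    exact Nat.mul_le_mul_left _ (by omega)
  have hmain := hC (hΦ.map (compRingHom A)) ((hΦ.natDegree_map _).trans hd')
    (irreducible_map_artinSchreier z₀.1 hΦ hirr (hd' ▸ hdp)) hWΨ k hk
  refine le_trans ?_ hmain
  rw [← Nat.cast_mul]
  refine Nat.cast_le.2 ?_
  have htr : ∀ t : F, ∑ i ∈ Finset.range k, (t ^ p - t) ^ p ^ i = t ^ p ^ k - t := by
    intro t
    have : ∀ i, (t ^ p - t) ^ p ^ i = t ^ p ^ (i + 1) - t ^ p ^ i := by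
      intro i
      rw [sub_pow_char_pow, ← pow_mul, ← pow_succ']
    rw [Finset.sum_congr rfl (fun i _ => this i), Finset.sum_range_sub (fun i => t ^ p ^ i)]
    simp
  set S : (F × F) → Finset (F × F) := fun z =>
    ((X ^ p - X + Polynomial.C (z₀.1 - z.1) : F[X]).roots.toFinset).image fun t => (t, z.2) with hS
  have hSmem : ∀ z u, u ∈ S z ↔ A.eval u.1 = z.1 ∧ u.2 = z.2 := by
    rintro z ⟨t, y⟩
    simp only [hS, Finset.mem_image, Multiset.mem_toFinset, Prod.mk.injEq,
      mem_roots (artinSchreier_monic (z₀.1 - z.1)).ne_zero, IsRoot.def]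
    have : ∀ t : F, (X ^ p - X + Polynomial.C (z₀.1 - z.1) : F[X]).eval t = 0 ↔ A.eval t = z.1 := by
      intro t
      simp only [hA, eval_add, eval_sub, eval_pow, eval_X, eval_C]
      constructor <;> intro h <;> linear_combination h
    constructor
    · rintro ⟨a, ha, rfl, rfl⟩; exact ⟨(this a).1 ha, rfl⟩
    · rintro ⟨ha, rfl⟩; exact ⟨t, (this t).2 ha, rfl, rfl⟩
  have hScard : ∀ z, (S z).card = p := by
    intro z
    rw [hS]
    dsimp only
    rw [Finset.card_image_of_injective _ (fun a b h => (Prod.mk.inj h).1),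
      Multiset.toFinset_card_of_nodup, IsAlgClosed.card_roots_eq_natDegree,
      artinSchreier_natDegree]
    refine nodup_roots ?_
    rw [separable_def]
    have : derivative (X ^ p - X + Polynomial.C (z₀.1 - z.1) : F[X]) = -1 := by
      rw [derivative_add, derivative_sub, derivative_X_pow, CharP.cast_eq_zero F p]
      simp
    rw [this]
    exact isCoprime_one_right.neg_right
  have hSsub : Z.biUnion S ⊆ affinePts Ψ (p ^ k) := by
    intro u hu
    rw [Finset.mem_biUnion] at hu
    obtain ⟨z, hz, hu⟩ := hu
    rw [hSmem] at hu
    have hz1 := (mem_affinePts hq).1 (hZ hz)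
    rw [mem_affinePts hq]
    refine ⟨?_, by rw [hu.2, hz1.2.1], by rw [hev, hu.1, hu.2, hz1.2.2]⟩
    rw [← sub_eq_zero, ← htr]
    have h1 : u.1 ^ p - u.1 = z.1 - z₀.1 := by
      rw [← hu.1, hA]; simp
    rw [h1]
    simp only [sub_pow_char_pow]
    rw [Finset.sum_sub_distrib, hZc z hz, hZc z₀ hz₀, sub_self]
  calc p * Z.card = (Z.biUnion S).card := by
        rw [Finset.card_biUnion, Finset.sum_congr rfl (fun z _ => hScard z), Finset.sum_const,
          smul_eq_mul, mul_comm]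
        intro z _ z' _ hne
        rw [Function.onFun, Finset.disjoint_left]
        intro u hu hu'
        rw [hSmem] at hu hu'
        exact hne (Prod.ext (hu.1.symm.trans hu'.1) (hu.2.symm.trans hu'.2))
    _ ≤ _ := Finset.card_le_card hSsub

theorem norm_sum_addChar_affinePts_le (p d : ℕ) [Fact p.Prime] (hd : 0 < d) (hdp : d < p) :
    ∃ C : ℕ, ∀ {F : Type} [Field F] [IsAlgClosed F] [CharP F p] {Φ : F[X][X]} (_ : Φ.Monic)
      (_ : Φ.natDegree = d) (_ : Irreducible Φ) (_ : WD 1 Φ d) (k : ℕ) (_ : k ≠ 0)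
      (_ : ∀ x y, x ^ p ^ k = x → Φ.evalEval x y = 0 → Φ.evalEval x (y ^ p ^ k) = 0)
      (t : F × F → ZMod p) (_ : ∀ z ∈ affinePts Φ (p ^ k),
        ((t z).cast : F) = ∑ i ∈ Finset.range k, z.1 ^ p ^ i)
      (ψ : AddChar (ZMod p) ℂ) (_ : ψ ≠ 1),
      ‖∑ z ∈ affinePts Φ (p ^ k), ψ (t z)‖ ≤ C * √(p ^ k) := by
  classical
  obtain ⟨C₁, hC₁⟩ := card_filter_trace_le p d hd hdp
  obtain ⟨C₂, hC₂⟩ := sub_le_card_affinePts p d 1 hd hdp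
  refine ⟨p * (C₁ + C₂), fun {F} _ _ _ {Φ} hΦ hd' hirr hW k hk hfrob t ht ψ hψ => ?_⟩
  have hp := (Fact.out : p.Prime)
  have hp0 : (0 : ℝ) < p := by exact_mod_cast hp.pos
  set Z := affinePts Φ (p ^ k) with hZ
  set T : ZMod p → ℝ := fun c => ((Z.filter fun z => t z = c).card : ℝ) with hT
  have hup : ∀ c, p * T c ≤ p ^ k + C₁ * √(p ^ k) := fun c =>
    hC₁ hΦ hd' hirr hW k hk (c.cast : F) _ (Finset.filter_subset _ _) (by
      intro z hz
      rw [Finset.mem_filter] at hz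
      rw [← ht z hz.1, hz.2])
  have hsum : ∑ c, T c = Z.card := by
    rw [hT]
    dsimp only
    rw [← Nat.cast_sum, ← Finset.card_eq_sum_card_fiberwise (f := t) (t := Finset.univ)]
    intro z _; simp
  have hlow := hC₂ hΦ hd' hirr (by rwa [one_mul]) k hk hfrob
  rw [← hZ, ← hsum] at hlow
  have hsq : (0 : ℝ) ≤ √(p ^ k) := Real.sqrt_nonneg _
  have habs : ∀ c, |T c - p ^ k / p| ≤ (C₁ + C₂) * √(p ^ k) := by
    intro c
    have h1 : ∑ c' ∈ Finset.univ.erase c, p * T c' ≤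
        ((p : ℝ) - 1) * (p ^ k + C₁ * √(p ^ k)) := by
      refine (Finset.sum_le_card_nsmul _ _ _ (fun c' _ => hup c')).trans ?_
      rw [Finset.card_erase_of_mem (Finset.mem_univ _), Finset.card_univ, ZMod.card, nsmul_eq_mul,
        Nat.cast_sub hp.one_le, Nat.cast_one]
    rw [← Finset.mul_sum] at h1
    have h2 := Finset.add_sum_erase Finset.univ T (Finset.mem_univ c)
    have h3 : p * T c = p * ∑ c, T c - p * ∑ c' ∈ Finset.univ.erase c, T c' := by
      rw [← h2]; ring
    have h4 : p * (T c - p ^ k / p) = p * T c - p ^ k := by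
      field_simp
    have h5 : |p * (T c - p ^ k / p)| ≤ p * ((C₁ + C₂) * √(p ^ k)) := by
      rw [h4, abs_le]
      have h6 := mul_le_mul_of_nonneg_left hlow hp0.le
      have h7 := hup c
      have hp1 : (1 : ℝ) ≤ p := by exact_mod_cast hp.one_le
      have h8 : 0 ≤ (C₁ : ℝ) * √(p ^ k) := by positivity
      have h9 : 0 ≤ (C₂ : ℝ) * √(p ^ k) := by positivity
      constructor
      · nlinarith
      · nlinarith
    rw [abs_mul, abs_of_pos hp0] at h5
    exact le_of_mul_le_mul_left h5 hp0
  have h1 : ∑ z ∈ Z, ψ (t z) = ∑ c, ((T c - p ^ k / p : ℝ) : ℂ) * ψ c := by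
    have h2 : ∑ z ∈ Z, ψ (t z) = ∑ c, (T c : ℂ) * ψ c := by
      rw [← Finset.sum_fiberwise Z t]
      refine Finset.sum_congr rfl fun c _ => ?_
      rw [Finset.sum_congr rfl (g := fun _ => ψ c)
        (fun z hz => by rw [(Finset.mem_filter.1 hz).2]), Finset.sum_const, nsmul_eq_mul]
      simp [hT]
    have h3 : ∑ c, ψ c = 0 := by
      rw [AddChar.sum_eq_zero_iff_ne_zero]
      exact hψ
    rw [h2]
    simp only [Complex.ofReal_sub, sub_mul, Finset.sum_sub_distrib, ← Finset.mul_sum, h3]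
    simp
  rw [h1]
  refine (norm_sum_le _ _).trans ?_
  have h2 : ∀ c ∈ (Finset.univ : Finset (ZMod p)),
      ‖((T c - p ^ k / p : ℝ) : ℂ) * ψ c‖ ≤ (C₁ + C₂) * √(p ^ k) := by
    intro c _
    rw [norm_mul, AddChar.norm_apply, mul_one, Complex.norm_real]
    exact habs c
  refine (Finset.sum_le_card_nsmul _ _ _ h2).trans ?_
  rw [Finset.card_univ, ZMod.card, nsmul_eq_mul]
  push_cast
  rw [mul_assoc]

end

section
open PowerSeries

theorem exists_norm_coeff_le {P G : PowerSeries ℂ} (hPG : d⁄dX ℂ P = P * G) {C r ρ : ℝ}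
    (hr : 0 < r) (hC : 0 ≤ C) (hG : ∀ k, ‖coeff k G‖ ≤ C * r ^ (k + 1)) (hρ : r < ρ) :
    ∃ K : ℝ, 0 ≤ K ∧ ∀ n, ‖coeff n P‖ ≤ K * ρ ^ n := by
  have hρ0 : 0 < ρ := hr.trans hρ
  obtain ⟨n₀, hn₀⟩ := exists_nat_ge (C * (r / (ρ - r)))
  have hterm : ∀ i, 0 ≤ ‖coeff i P‖ / ρ ^ i := fun i => by positivity
  refine ⟨∑ i ∈ Finset.range (n₀ + 1), ‖coeff i P‖ / ρ ^ i,
    Finset.sum_nonneg fun i _ => hterm i, ?_⟩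
  set K := ∑ i ∈ Finset.range (n₀ + 1), ‖coeff i P‖ / ρ ^ i with hK
  have hK0 : 0 ≤ K := Finset.sum_nonneg fun i _ => hterm i
  intro n
  induction n using Nat.strong_induction_on with
  | _ n ih =>
    by_cases hn : n < n₀ + 1
    · rw [← div_le_iff₀ (by positivity)]
      exact Finset.single_le_sum (f := fun i => ‖coeff i P‖ / ρ ^ i) (fun i _ => hterm i)
        (Finset.mem_range.2 hn)
    · obtain ⟨m, rfl⟩ : ∃ m, n = m + 1 := ⟨n - 1, by omega⟩
      have h1 : coeff m (d⁄dX ℂ P) = coeff (m + 1) P * (m + 1) := coeff_derivative P m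
      rw [hPG, coeff_mul] at h1
      have h2 : ‖coeff (m + 1) P‖ * (m + 1) ≤
          ∑ x ∈ Finset.HasAntidiagonal.antidiagonal m, (K * ρ ^ x.1) * (C * r ^ (x.2 + 1)) := by
        have : ‖coeff (m + 1) P‖ * (m + 1) = ‖coeff (m + 1) P * (m + 1)‖ := by
          rw [norm_mul]; congr 1
          have := Complex.norm_natCast (m + 1)
          push_cast at this; exact this.symm
        rw [this, ← h1]
        refine norm_sum_le_of_le _ fun x hx => ?_
        rw [norm_mul]
        have hx1 : x.1 < m + 1 := by
          have := Finset.HasAntidiagonal.mem_antidiagonal.1 hx; omega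
        exact mul_le_mul (ih _ hx1) (hG _) (norm_nonneg _) (by positivity)
      set s := r / ρ with hs
      have hs1 : s < 1 := (div_lt_one hρ0).2 hρ
      have hs0 : 0 < s := by positivity
      have h3 : ∑ x ∈ Finset.HasAntidiagonal.antidiagonal m, (K * ρ ^ x.1) * (C * r ^ (x.2 + 1)) =
          K * ρ ^ (m + 1) * (C * ∑ j ∈ Finset.range (m + 1), s ^ (j + 1)) := by
        rw [Finset.Nat.sum_antidiagonal_eq_sum_range_succ (fun i j => (K * ρ ^ i) * (C * r ^ (j + 1))),
          ← Finset.sum_range_reflect (fun j => s ^ (j + 1)), Finset.mul_sum, Finset.mul_sum]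
        refine Finset.sum_congr rfl fun i hi => ?_
        rw [Finset.mem_range] at hi
        have h4 : m + 1 - 1 - i + 1 = m - i + 1 := by omega
        have h5 : ρ ^ (m + 1) = ρ ^ i * ρ ^ (m - i + 1) := by rw [← pow_add]; congr 1; omega
        rw [h4, h5, hs, div_pow]
        field_simp
      have h4 : ∑ j ∈ Finset.range (m + 1), s ^ (j + 1) ≤ r / (ρ - r) := by
        have h5 : ∑ j ∈ Finset.range (m + 1), s ^ (j + 1) = s * ∑ j ∈ Finset.range (m + 1), s ^ j := by
          rw [Finset.mul_sum]; exact Finset.sum_congr rfl fun j _ => pow_succ' _ _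
        have h6 : ∑ j ∈ Finset.range (m + 1), s ^ j ≤ (1 - s)⁻¹ := by
          rw [← tsum_geometric_of_lt_one hs0.le hs1]
          exact (summable_geometric_of_lt_one hs0.le hs1).sum_le_tsum _
            (fun i _ => by positivity)
        have h7 : r / (ρ - r) = s * (1 - s)⁻¹ := by
          have : ρ - r ≠ 0 := by linarith
          rw [hs]; field_simp
        rw [h5, h7]
        exact mul_le_mul_of_nonneg_left h6 hs0.le
      have h5 : C * ∑ j ∈ Finset.range (m + 1), s ^ (j + 1) ≤ m + 1 := by
        refine ((mul_le_mul_of_nonneg_left h4 hC).trans hn₀).trans ?_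
        exact_mod_cast (by omega : n₀ ≤ m + 1)
      rw [h3] at h2
      have h6 := h2.trans (mul_le_mul_of_nonneg_left h5 (by positivity))
      exact le_of_mul_le_mul_right h6 (by positivity)

theorem norm_constantCoeff_le_of_coeff_eq_zero {P G : PowerSeries ℂ} (hPG : d⁄dX ℂ P = P * G)
    (hP0 : constantCoeff P = 1) {C r : ℝ} (hr : 0 < r) (hC : 0 ≤ C)
    (hG : ∀ k, ‖coeff k G‖ ≤ C * r ^ (k + 1)) {D : ℕ} (hD : ∀ n, D < n → coeff n P = 0) :
    ‖constantCoeff G‖ ≤ D * r := by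
  -- the inverse power series
  set E := P⁻¹ with hE
  have hPu : constantCoeff P ≠ 0 := by rw [hP0]; exact one_ne_zero
  have hPE : P * E = 1 := PowerSeries.mul_inv_cancel P hPu
  have hEG : d⁄dX ℂ E = E * (-G) := by
    have h1 : d⁄dX ℂ (P * E) = 0 := by rw [hPE]; simp
    rw [Derivation.leibniz, hPG, smul_eq_mul, smul_eq_mul] at h1
    have h2 : P * d⁄dX ℂ E = P * (E * (-G)) := by linear_combination h1
    have hPne : P ≠ 0 := by rintro h; simp [h] at hPu
    exact mul_left_cancel₀ hPne h2
  set A : Polynomial ℂ := trunc (D + 1) P with hA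
  have hAP : (A : PowerSeries ℂ) = P := by
    ext n
    rw [Polynomial.coeff_coe, hA, coeff_trunc]
    split_ifs with h
    · rfl
    · exact (hD n (by omega)).symm
  have hroots : ∀ z : ℂ, A.eval z = 0 → r⁻¹ ≤ ‖z‖ := by
    intro z hz
    by_contra hlt
    push Not at hlt
    obtain ⟨ρ, hρ, hρz⟩ : ∃ ρ, r < ρ ∧ ρ * ‖z‖ < 1 := by
      have h1 : r * ‖z‖ < 1 := by
        have := mul_lt_mul_of_pos_left hlt hr
        rwa [mul_inv_cancel₀ hr.ne'] at this
      rcases eq_or_ne ‖z‖ 0 with h0 | h0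
      · exact ⟨r + 1, by linarith, by rw [h0]; simp⟩
      · have hz0 : 0 < ‖z‖ := lt_of_le_of_ne (norm_nonneg _) h0.symm
        obtain ⟨ρ, h2, h3⟩ := exists_between ((lt_div_iff₀ hz0).2 h1)
        exact ⟨ρ, h2, (lt_div_iff₀ hz0).1 h3⟩
    obtain ⟨K, hK0, hK⟩ := exists_norm_coeff_le hEG hr hC (by simpa using hG) hρ
    have hsE : Summable fun n => ‖coeff n E * z ^ n‖ := by
      refine Summable.of_nonneg_of_le (fun n => norm_nonneg _) (fun n => ?_)
        ((summable_geometric_of_lt_one (r := ρ * ‖z‖)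
          (mul_nonneg (hr.trans hρ).le (norm_nonneg _)) hρz).mul_left K)
      rw [norm_mul, norm_pow, mul_pow, ← mul_assoc]
      exact mul_le_mul_of_nonneg_right (hK n) (by positivity)
    have hsA : Summable fun n => ‖coeff n P * z ^ n‖ := by
      refine summable_of_ne_finset_zero (s := Finset.range (D + 1)) fun n hn => ?_
      rw [hD n (by simpa using hn)]; simp
    have hAz : ∑' n, coeff n P * z ^ n = 0 := by
      rw [tsum_eq_sum (s := Finset.range (D + 1)) (fun n hn => by
        rw [hD n (by simpa using hn)]; simp)]
      rw [← hz, Polynomial.eval_eq_sum_range' (n := D + 1) (by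
        rw [hA]; exact natDegree_trunc_lt P D)]
      refine Finset.sum_congr rfl fun n hn => ?_
      rw [← Polynomial.coeff_coe, hAP]
    have hprod := tsum_mul_tsum_eq_tsum_sum_antidiagonal_of_summable_norm hsA hsE
    rw [hAz, zero_mul] at hprod
    have h1 : ∀ n, ∑ kl ∈ Finset.HasAntidiagonal.antidiagonal n, coeff kl.1 P * z ^ kl.1 * (coeff kl.2 E * z ^ kl.2)
        = if n = 0 then 1 else 0 := by
      intro n
      have h2 : ∑ kl ∈ Finset.HasAntidiagonal.antidiagonal n, coeff kl.1 P * z ^ kl.1 * (coeff kl.2 E * z ^ kl.2)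
          = coeff n (P * E) * z ^ n := by
        rw [coeff_mul, Finset.sum_mul]
        refine Finset.sum_congr rfl fun x hx => ?_
        rw [← Finset.HasAntidiagonal.mem_antidiagonal.1 hx, pow_add]; ring
      rw [h2, hPE, coeff_one]
      split_ifs with h
      · simp [h]
      · simp
    rw [tsum_congr h1, tsum_ite_eq] at hprod
    exact zero_ne_one hprod
  have hA0 : A.eval 0 = 1 := by
    rw [← Polynomial.coeff_zero_eq_eval_zero, ← Polynomial.coeff_coe, hAP]
    simpa using hP0
  have hA1 : A.derivative.eval 0 = constantCoeff G := by
    rw [← Polynomial.coeff_zero_eq_eval_zero, Polynomial.coeff_derivative, ← Polynomial.coeff_coe,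
      hAP]
    have h1 : coeff 0 (d⁄dX ℂ P) = coeff (0 + 1) P * ((0 : ℕ) + 1) := coeff_derivative P 0
    rw [hPG, coeff_mul] at h1
    simp [hP0] at h1
    simp [h1]
  have hsplit := IsAlgClosed.splits A
  have h1 := hsplit.eval_derivative_div_eval_of_ne_zero (x := 0) (by rw [hA0]; exact one_ne_zero)
  rw [hA0, hA1, div_one] at h1
  rw [h1]
  have hcard : (A.roots.card : ℝ) ≤ D := by
    have h2 : A.natDegree ≤ D := Nat.lt_succ_iff.1 (by rw [hA]; exact natDegree_trunc_lt P D)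
    exact_mod_cast (Polynomial.card_roots' A).trans h2
  refine (norm_multiset_sum_le _).trans ?_
  refine (Multiset.sum_le_card_nsmul _ r ?_).trans ?_
  · intro x hx
    simp only [Multiset.mem_map, exists_exists_and_eq_and] at hx
    obtain ⟨a, ha, rfl⟩ := hx
    have hz := hroots a (Polynomial.isRoot_of_mem_roots ha)
    rw [zero_sub, norm_div, norm_one, norm_neg, one_div]
    rwa [inv_le_comm₀ (lt_of_lt_of_le (by positivity) hz) hr]
  · rw [Multiset.card_map, Multiset.card_map, nsmul_eq_mul]
    exact mul_le_mul_of_nonneg_right hcard hr.le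

theorem norm_constantCoeff_sub_le_of_periodic {P G : PowerSeries ℂ} (hPG : d⁄dX ℂ P = P * G)
    (hP0 : constantCoeff P = 1) {q C r : ℝ} (hr : 0 < r) (hrq : r < q) (hC : 0 ≤ C)
    (hG : ∀ k, ‖coeff k G - (q : ℂ) ^ (k + 1)‖ ≤ C * r ^ (k + 1)) {D d : ℕ} (hd : 0 < d)
    (hD : ∀ n, D ≤ n → coeff (n + d) P = coeff n P * q ^ d) :
    ‖constantCoeff G - q‖ ≤ D * r := by
  have hq0 : 0 < q := hr.trans hrq
  set u : PowerSeries ℂ := 1 - PowerSeries.C (q : ℂ) * X with hu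
  set W : PowerSeries ℂ := PowerSeries.mk fun k => (q : ℂ) ^ (k + 1) with hW
  have hc : ∀ n, coeff (n + 1) (P * u) = coeff (n + 1) P - q * coeff n P := by
    intro n
    have : P * u = P - PowerSeries.C (q : ℂ) * P * X := by rw [hu]; ring
    rw [this, map_sub, coeff_succ_mul_X, coeff_C_mul]
  have huW : u * W = PowerSeries.C (q : ℂ) := by
    have : u * W = W - PowerSeries.C (q : ℂ) * W * X := by rw [hu]; ring
    rw [this]
    ext n
    rcases n with _ | n
    · simp [hW]
    · rw [map_sub, coeff_succ_mul_X, coeff_C_mul, hW, coeff_mk, coeff_mk, coeff_C]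
      simp [pow_succ']
  have hdu : d⁄dX ℂ u = - PowerSeries.C (q : ℂ) := by
    rw [hu, map_sub, Derivation.leibniz]
    simp
  have hA : d⁄dX ℂ (P * u) = (P * u) * (G - W) := by
    rw [Derivation.leibniz, hdu, hPG, smul_eq_mul, smul_eq_mul, ← huW]
    ring
  have hA0 : constantCoeff (P * u) = 1 := by rw [map_mul, hP0, hu]; simp
  have hG' : ∀ k, ‖coeff k (G - W)‖ ≤ C * r ^ (k + 1) := by
    intro k; rw [map_sub, hW, coeff_mk]; exact hG k
  have hconst : constantCoeff G - q = constantCoeff (G - W) := by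
    rw [map_sub, hW]
    rw [← coeff_zero_eq_constantCoeff_apply (PowerSeries.mk _), coeff_mk]; simp
  rw [hconst]
  refine norm_constantCoeff_le_of_coeff_eq_zero hA hA0 hr hC hG' ?_
  intro n hn
  obtain ⟨ρ, hρ, hρq⟩ := exists_between hrq
  obtain ⟨K, hK0, hK⟩ := exists_norm_coeff_le hA hr hC hG' hρ
  have hρ0 := hr.trans hρ
  have hper : ∀ m, D < m → coeff (m + d) (P * u) = coeff m (P * u) * q ^ d := by
    intro m hm
    obtain ⟨m, rfl⟩ : ∃ m', m = m' + 1 := ⟨m - 1, by omega⟩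
    have : m + 1 + d = m + d + 1 := by ring
    rw [this, hc, hc, ← this, hD _ (by omega), hD _ (by omega)]; ring
  have hperj : ∀ j, coeff (n + j * d) (P * u) = coeff n (P * u) * (q ^ d) ^ j := by
    intro j
    induction j with
    | zero => simp
    | succ j ih =>
      have : n + (j + 1) * d = n + j * d + d := by ring
      rw [this, hper _ (by omega), ih]; ring
  have hle : ∀ j : ℕ, ‖coeff n (P * u)‖ ≤ K * ρ ^ n * ((ρ / q) ^ d) ^ j := by
    intro j
    have h1 := hK (n + j * d)
    rw [hperj, norm_mul, norm_pow, norm_pow, Complex.norm_real, Real.norm_of_nonneg hq0.le,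
      ← le_div_iff₀ (by positivity)] at h1
    refine h1.trans (le_of_eq ?_)
    rw [pow_add, mul_comm j d, pow_mul, div_pow, div_pow]
    ring
  have hlim : Filter.Tendsto (fun j : ℕ => K * ρ ^ n * ((ρ / q) ^ d) ^ j) Filter.atTop (nhds 0) := by
    have := (tendsto_pow_atTop_nhds_zero_of_lt_one (r := (ρ / q) ^ d) (by positivity)
      (pow_lt_one₀ (by positivity) ((div_lt_one hq0).2 hρq) hd.ne')).const_mul (K * ρ ^ n)
    simpa using this
  have := ge_of_tendsto' hlim hle
  exact norm_le_zero_iff.1 this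

end

section
open Polynomial

section LinearAlgebra
variable {R V U W : Type*} [Field R] [AddCommGroup V] [Module R V] [Module.Finite R V]
  [AddCommGroup U] [Module R U] [AddCommGroup W] [Module R W]

open Module.Basis in
theorem trace_eq_trace_restrict_add_trace_mapQ (N : Submodule R V) (e : V →ₗ[R] V)
    (he : N ≤ N.comap e) :
    LinearMap.trace R V e =
      LinearMap.trace R N (e.restrict he) + LinearMap.trace R (V ⧸ N) (N.mapQ N e he) := by
  classical
  let m := Module.Free.ChooseBasisIndex R N
  let bW : Module.Basis m R N := Module.Free.chooseBasis R N
  let n := Module.Free.ChooseBasisIndex R (V ⧸ N)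
  let bQ : Module.Basis n R (V ⧸ N) := Module.Free.chooseBasis R (V ⧸ N)
  let b := sumQuot bW bQ
  rw [LinearMap.trace_eq_matrix_trace R b, LinearMap.trace_eq_matrix_trace R bW,
    LinearMap.trace_eq_matrix_trace R bQ, Matrix.trace, Matrix.trace, Matrix.trace,
    Fintype.sum_sum_type]
  congr 1
  · refine Finset.sum_congr rfl fun i _ => ?_
    simp only [b, Matrix.diag_apply, LinearMap.toMatrix_apply, sumQuot_inl]
    apply sumQuot_repr_inl_of_mem
  · refine Finset.sum_congr rfl fun i _ => ?_
    simp only [b, Matrix.diag_apply, LinearMap.toMatrix_apply, sumQuot_repr_inr]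
    rw [← sumQuot_inr bW bQ i, N.mapQ_apply]
    simp

theorem trace_eq_add_of_exact {i : U →ₗ[R] V} {π : V →ₗ[R] W} (hi : Function.Injective i)
    (hπ : Function.Surjective π) (hex : LinearMap.range i = LinearMap.ker π)
    {fU : U →ₗ[R] U} {fV : V →ₗ[R] V} {fW : W →ₗ[R] W} (h1 : ∀ u, fV (i u) = i (fU u))
    (h2 : ∀ v, π (fV v) = fW (π v)) :
    LinearMap.trace R V fV = LinearMap.trace R U fU + LinearMap.trace R W fW := by
  have he : LinearMap.ker π ≤ (LinearMap.ker π).comap fV := by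
    intro v hv
    rw [Submodule.mem_comap, LinearMap.mem_ker, h2, LinearMap.mem_ker.1 hv, map_zero]
  rw [trace_eq_trace_restrict_add_trace_mapQ _ fV he]
  congr 1
  · let e1 : U ≃ₗ[R] LinearMap.ker π :=
      (LinearEquiv.ofInjective i hi).trans (LinearEquiv.ofEq _ _ hex)
    rw [← LinearMap.trace_conj' fU e1]
    congr 1
    ext ⟨v, hv⟩
    obtain ⟨u, hu⟩ := e1.surjective ⟨v, hv⟩
    rw [← hu]
    simp only [LinearEquiv.conj_apply, LinearMap.comp_apply, LinearEquiv.coe_coe,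
      LinearEquiv.symm_apply_apply]
    exact h1 u
  · let e2 : (V ⧸ LinearMap.ker π) ≃ₗ[R] W := LinearMap.quotKerEquivOfSurjective π hπ
    rw [← LinearMap.trace_conj' _ e2]
    congr 1
    ext w
    obtain ⟨v, rfl⟩ := hπ w
    have hv : e2.symm (π v) = Submodule.Quotient.mk v := by
      rw [LinearEquiv.symm_apply_eq]; rfl
    simp only [LinearEquiv.conj_apply, LinearMap.comp_apply, LinearEquiv.coe_coe]
    rw [hv, Submodule.mapQ_apply]
    exact h2 v

theorem trace_pi_eq_sum {ι : Type*} [Fintype ι] {M : ι → Type*} [∀ i, AddCommGroup (M i)]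
    [∀ i, Module R (M i)] [∀ i, Module.Finite R (M i)] (f : ∀ i, M i →ₗ[R] M i) :
    LinearMap.trace R (∀ i, M i) (LinearMap.pi fun i => f i ∘ₗ LinearMap.proj i) =
      ∑ i, LinearMap.trace R (M i) (f i) := by
  classical
  have h : LinearMap.pi (fun i => f i ∘ₗ LinearMap.proj i) =
      ∑ i, (LinearMap.single R M i) ∘ₗ (f i ∘ₗ LinearMap.proj i) := by
    ext1 i
    ext1 x
    funext j
    simp [Finset.sum_apply]
  rw [h, map_sum]
  refine Finset.sum_congr rfl fun i _ => ?_
  rw [LinearMap.trace_comp_comm', LinearMap.comp_assoc]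
  congr 1
  ext x
  simp

end LinearAlgebra

section Dedekind
variable {O : Type*} [CommRing O] [IsDedekindDomain O] {k : Type*} [Field k] [Algebra k O]

theorem exists_exact_quotient_mul {I J : Ideal O} (hI : I ≠ ⊥) (hJ : J ≠ ⊥) :
    ∃ i : (O ⧸ J) →ₗ[O] (O ⧸ (I * J)), Function.Injective i ∧ ∀ v : O ⧸ (I * J),
      v ∈ LinearMap.range i ↔ Ideal.Quotient.factor (Ideal.mul_le_left : I * J ≤ I) v = 0 := by
  obtain ⟨a, ha⟩ := IsDedekindDomain.exists_sup_span_eq (I := I * J) (J := I) Ideal.mul_le_left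
    (mul_ne_zero hI hJ)
  have haI : a ∈ I := by
    rw [← ha]; exact Ideal.mem_sup_right (Ideal.mem_span_singleton_self a)
  obtain ⟨D, hD⟩ := Ideal.dvd_iff_le.2 ((Ideal.span_singleton_le_iff_mem I).2 haI)
  have hcop : J ⊔ D = ⊤ := by
    rw [hD, ← Ideal.mul_sup] at ha
    have : I * (J ⊔ D) = I * ⊤ := by rw [ha, Ideal.mul_top]
    exact mul_left_cancel₀ hI this
  have key : ∀ u, a * u ∈ I * J ↔ u ∈ J := by
    intro u
    constructor
    · intro h
      rw [← Ideal.span_singleton_le_iff_mem, ← Ideal.span_singleton_mul_span_singleton, hD,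
        mul_assoc, ← Ideal.dvd_iff_le, mul_dvd_mul_iff_left hI] at h
      have hc : IsCoprime J D := Ideal.isCoprime_iff_sup_eq.2 hcop
      have := hc.dvd_of_dvd_mul_left h
      rwa [Ideal.dvd_span_singleton] at this
    · intro h
      exact Ideal.mul_mem_mul haI h
  refine ⟨Submodule.mapQ J (I * J) (LinearMap.mulLeft O a) ?_, ?_, ?_⟩
  · intro u hu
    exact (key u).2 hu
  · rw [← LinearMap.ker_eq_bot, LinearMap.ker_eq_bot']
    intro u hu
    obtain ⟨u, rfl⟩ := Ideal.Quotient.mk_surjective u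
    have : a * u ∈ I * J := Ideal.Quotient.eq_zero_iff_mem.1 hu
    exact Ideal.Quotient.eq_zero_iff_mem.2 ((key u).1 this)
  · intro v
    obtain ⟨v, rfl⟩ := Ideal.Quotient.mk_surjective v
    rw [Ideal.Quotient.factor_mk, Ideal.Quotient.eq_zero_iff_mem]
    constructor
    · rintro ⟨u, hu⟩
      obtain ⟨u, rfl⟩ := Ideal.Quotient.mk_surjective u
      have h1 : a * u - v ∈ I * J := Ideal.Quotient.eq.1 hu
      have h2 := I.sub_mem (I.mul_mem_right u haI) (Ideal.mul_le_left h1)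
      simpa using h2
    · intro hv
      rw [← ha, Submodule.mem_sup] at hv
      obtain ⟨x, hx, z, hz, rfl⟩ := hv
      obtain ⟨u, rfl⟩ := Ideal.mem_span_singleton.1 hz
      refine ⟨Ideal.Quotient.mk J u, ?_⟩
      change Ideal.Quotient.mk (I * J) (a * u) = _
      rw [Ideal.Quotient.eq]
      simpa using (I * J).neg_mem hx

theorem finrank_trace_quotient_mul {I J : Ideal O} (hI : I ≠ ⊥) (hJ : J ≠ ⊥)
    [Module.Finite k (O ⧸ (I * J))] (x : O) :
    Module.finrank k (O ⧸ (I * J)) = Module.finrank k (O ⧸ I) + Module.finrank k (O ⧸ J) ∧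
    Algebra.trace k (O ⧸ (I * J)) (Ideal.Quotient.mk _ x) =
      Algebra.trace k (O ⧸ I) (Ideal.Quotient.mk _ x) +
        Algebra.trace k (O ⧸ J) (Ideal.Quotient.mk _ x) := by
  obtain ⟨i, hi, hr⟩ := exists_exact_quotient_mul hI hJ
  let i' : (O ⧸ J) →ₗ[k] (O ⧸ (I * J)) :=
    { toFun := i, map_add' := map_add i
      map_smul' := fun c v => by
        rw [RingHom.id_apply, ← algebraMap_smul O c v, map_smul, algebraMap_smul] }
  let π : (O ⧸ (I * J)) →ₗ[k] (O ⧸ I) :=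
    (Ideal.Quotient.factorₐ k (Ideal.mul_le_left : I * J ≤ I)).toLinearMap
  have hπ : Function.Surjective π := Ideal.Quotient.factor_surjective Ideal.mul_le_left
  have hex : LinearMap.range i' = LinearMap.ker π := by
    ext v
    exact hr v
  have hi' : Function.Injective i' := hi
  constructor
  · have h1 := LinearMap.finrank_range_add_finrank_ker π
    rw [← hex, LinearMap.finrank_range_of_inj hi', LinearMap.range_eq_top.2 hπ, finrank_top] at h1
    exact h1.symm
  · rw [Algebra.trace_apply, Algebra.trace_apply, Algebra.trace_apply, add_comm]
    refine trace_eq_add_of_exact hi' hπ hex ?_ ?_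
    · intro u
      change Ideal.Quotient.mk _ x * i u = i (Ideal.Quotient.mk _ x * u)
      have h1 : (Ideal.Quotient.mk J x) * u = x • u := rfl
      have h2 : (Ideal.Quotient.mk (I * J) x) * i u = x • i u := rfl
      rw [h1, h2, map_smul]
    · intro v
      change Ideal.Quotient.factor Ideal.mul_le_left (_ * v) = _
      rw [map_mul, Ideal.Quotient.factor_mk]
      rfl

end Dedekind

section Principal
variable {k : Type*} [Field k]

theorem trace_quotient_span_X {a : k[X]} (ha : a.Monic) :
    Algebra.trace k (k[X] ⧸ Ideal.span {a}) (Ideal.Quotient.mk _ X) = -a.nextCoeff := by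
  by_cases h1 : a = 1
  · subst h1
    have : Subsingleton (k[X] ⧸ Ideal.span {(1 : k[X])}) :=
      Ideal.Quotient.subsingleton_iff.2 (by simp)
    rw [Subsingleton.elim (Ideal.Quotient.mk _ X) 0, map_zero]
    simp [nextCoeff]
  · have : Nontrivial (AdjoinRoot a) :=
      AdjoinRoot.nontrivial a fun h => h1 (ha.natDegree_eq_zero.1 (natDegree_eq_zero_iff_degree_le_zero.2 h.le))
    have := PowerBasis.trace_gen_eq_nextCoeff_minpoly (AdjoinRoot.powerBasis ha.ne_zero)
    rw [AdjoinRoot.minpoly_powerBasis_gen_of_monic ha] at this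
    exact this

theorem trace_quotient_span_eq_neg_nextCoeff_norm {S ι : Type*} [Finite ι] [CommRing S] [IsDomain S]
    [Algebra k[X] S] [Algebra k S] [IsScalarTower k k[X] S] (b : Module.Basis ι k[X] S) {f : S}
    (hf0 : f ≠ 0) (hf : (Algebra.norm k[X] f).Monic) :
    Algebra.trace k (S ⧸ Ideal.span {f}) (Ideal.Quotient.mk _ (algebraMap k[X] S X)) =
      -(Algebra.norm k[X] f).nextCoeff := by
  classical
  have := Fintype.ofFinite ι
  have : Module.Finite k[X] S := Module.Finite.of_basis b
  have : Module.Free k[X] S := Module.Free.of_basis b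
  have hI := Ideal.span_singleton_eq_bot.not.2 hf0
  set s := Ideal.smithCoeffs b (Ideal.span {f}) hI with hs
  have hs0 : ∀ i, s i ≠ 0 := fun i => Ideal.smithCoeffs_ne_zero b _ hI i
  have hN : Algebra.norm k[X] f = ∏ i, normalize (s i) := by
    have h1 := associated_norm_prod_smith b hf0
    refine eq_of_monic_of_associated hf
      (monic_prod_of_monic _ _ fun i _ => Polynomial.monic_normalize (hs0 i)) (h1.trans ?_)
    exact Associated.prod _ _ _ fun i _ => (normalize_associated (s i)).symm
  have hsp : ∀ i, Ideal.span {s i} = Ideal.span {normalize (s i)} := fun i =>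
    (Ideal.span_singleton_eq_span_singleton.2 (normalize_associated (s i))).symm
  let e := Ideal.quotientEquivPiSpan (Ideal.span {f}) b hI
  let e' : (S ⧸ Ideal.span {f}) ≃ₗ[k] ∀ i, k[X] ⧸ Ideal.span {s i} := e.restrictScalars k
  have hfin : ∀ i, Module.Finite k (k[X] ⧸ Ideal.span {s i}) := fun i =>
    (AdjoinRoot.powerBasis (hs0 i)).finite
  rw [hN, Monic.nextCoeff_prod, Algebra.trace_apply, ← LinearMap.trace_conj' _ e',
    ← Finset.sum_neg_distrib]
  · rw [← Finset.sum_congr rfl fun i _ => trace_quotient_span_X (Polynomial.monic_normalize (hs0 i))]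
    have : ∀ i, Algebra.trace k (k[X] ⧸ Ideal.span {normalize (s i)}) (Ideal.Quotient.mk _ X) =
        Algebra.trace k (k[X] ⧸ Ideal.span {s i}) (Ideal.Quotient.mk _ X) := fun i => by rw [hsp i]
    rw [Finset.sum_congr rfl fun i _ => this i]
    simp_rw [Algebra.trace_apply]
    rw [← trace_pi_eq_sum]
    congr 1
    refine LinearMap.ext fun v => ?_
    obtain ⟨v, rfl⟩ := e'.surjective v
    simp only [LinearEquiv.conj_apply, LinearMap.comp_apply, LinearEquiv.coe_coe,
      LinearEquiv.symm_apply_apply]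
    have h2 : Algebra.lmul k (S ⧸ Ideal.span {f}) (Ideal.Quotient.mk _ (algebraMap k[X] S X)) v =
        (X : k[X]) • v := by
      rw [Algebra.smul_def]; rfl
    have h3 : e' ((X : k[X]) • v) = (X : k[X]) • e' v := map_smul e _ _
    change e' (Algebra.lmul k (S ⧸ Ideal.span {f}) (Ideal.Quotient.mk _ (algebraMap k[X] S X)) v) = _
    rw [h2, h3]
    funext i
    simp only [Pi.smul_apply, LinearMap.pi_apply, LinearMap.comp_apply, LinearMap.proj_apply]
    obtain ⟨u, hu⟩ := Ideal.Quotient.mk_surjective (e' v i)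
    rw [← hu]; rfl
  · intro i _
    exact Polynomial.monic_normalize (hs0 i)

end Principal

end

section
open Polynomial

section IdealSeries
variable {k : Type*} [Field k] {O : Type*} [CommRing O] [Algebra k O]

/-- The degree of an ideal: the dimension of its residue ring over the base field. -/
noncomputable def idealDeg (k : Type*) [Field k] {O : Type*} [CommRing O] [Algebra k O]
    (I : Ideal O) : ℕ :=
  Module.finrank k (O ⧸ I)

/-- The value at the ideal `I` of the character `I ↦ ψ (Tr (x : O ⧸ I))`. -/
noncomputable def idealChar (ψ : AddChar k ℂ) (x : O) (I : Ideal O) : ℂ :=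
  ψ (Algebra.trace k (O ⧸ I) (Ideal.Quotient.mk I x))

theorem idealDeg_top : idealDeg k (⊤ : Ideal O) = 0 := by
  have : Subsingleton (O ⧸ (⊤ : Ideal O)) := Ideal.Quotient.subsingleton_iff.2 rfl
  exact Module.finrank_zero_of_subsingleton

theorem idealChar_top (ψ : AddChar k ℂ) (x : O) : idealChar ψ x (⊤ : Ideal O) = 1 := by
  have : Subsingleton (O ⧸ (⊤ : Ideal O)) := Ideal.Quotient.subsingleton_iff.2 rfl
  rw [idealChar, Subsingleton.elim (Ideal.Quotient.mk ⊤ x) 0, map_zero, AddChar.map_zero_eq_one]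

variable [IsDedekindDomain O] [Algebra k[X] O] [IsScalarTower k k[X] O] [Module.Finite k[X] O]
  [Module.Free k[X] O]

theorem finite_quotient_ideal (k : Type*) [Field k] {O : Type*} [CommRing O] [Algebra k O]
    [IsDedekindDomain O] [Algebra k[X] O] [IsScalarTower k k[X] O] [Module.Finite k[X] O]
    [Module.Free k[X] O] {I : Ideal O} (hI : I ≠ ⊥) : Module.Finite k (O ⧸ I) :=
  finiteDimensional_quotient_of_basis (Module.Free.chooseBasis k[X] O) hI

theorem eq_top_of_idealDeg_eq_zero {I : Ideal O} (hI : I ≠ ⊥) (h : idealDeg k I = 0) : I = ⊤ := by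
  have := finite_quotient_ideal k hI
  have := (Module.finrank_eq_zero_iff_of_free (R := k) (M := O ⧸ I)).1 h
  exact Ideal.Quotient.subsingleton_iff.1 this

theorem idealDeg_pos {P : Ideal O} (hP : P ≠ ⊥) (hP' : P.IsPrime) : 0 < idealDeg k P :=
  Nat.pos_of_ne_zero fun h => hP'.ne_top (eq_top_of_idealDeg_eq_zero hP h)

theorem idealDeg_mul {I J : Ideal O} (hI : I ≠ ⊥) (hJ : J ≠ ⊥) :
    idealDeg k (I * J) = idealDeg k I + idealDeg k J := by
  have := finite_quotient_ideal k (mul_ne_zero hI hJ)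
  exact (finrank_trace_quotient_mul (k := k) hI hJ 0).1

theorem idealChar_mul (ψ : AddChar k ℂ) (x : O) {I J : Ideal O} (hI : I ≠ ⊥) (hJ : J ≠ ⊥) :
    idealChar ψ x (I * J) = idealChar ψ x I * idealChar ψ x J := by
  have := finite_quotient_ideal k (mul_ne_zero hI hJ)
  rw [idealChar, (finrank_trace_quotient_mul (k := k) hI hJ x).2, AddChar.map_add_eq_mul]
  rfl

theorem idealDeg_pow {I : Ideal O} (hI : I ≠ ⊥) (r : ℕ) : idealDeg k (I ^ r) = r * idealDeg k I := by
  induction r with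
  | zero => rw [pow_zero, Ideal.one_eq_top, idealDeg_top, zero_mul]
  | succ r ih => rw [pow_succ, idealDeg_mul (pow_ne_zero r hI) hI, ih, add_mul, one_mul]

theorem idealChar_pow (ψ : AddChar k ℂ) (x : O) {I : Ideal O} (hI : I ≠ ⊥) (r : ℕ) :
    idealChar ψ x (I ^ r) = idealChar ψ x I ^ r := by
  induction r with
  | zero => rw [pow_zero, Ideal.one_eq_top, idealChar_top, pow_zero]
  | succ r ih => rw [pow_succ, idealChar_mul ψ x (pow_ne_zero r hI) hI, ih, pow_succ]

theorem exists_monic_mem {I : Ideal O} (hI : I ≠ ⊥) :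
    ∃ g : k[X], g.Monic ∧ g.natDegree = idealDeg k I ∧ algebraMap k[X] O g ∈ I := by
  have := finite_quotient_ideal k hI
  set f := Algebra.lmul k (O ⧸ I) (Ideal.Quotient.mk I (algebraMap k[X] O X)) with hf
  refine ⟨f.charpoly, f.charpoly_monic, f.charpoly_natDegree, ?_⟩
  have h1 := f.aeval_self_charpoly
  rw [hf, Polynomial.aeval_algHom_apply, ← hf] at h1
  have h2 : aeval (Ideal.Quotient.mk I (algebraMap k[X] O X)) f.charpoly = 0 := by
    have := LinearMap.congr_fun h1 1
    simpa using this
  rw [← Ideal.Quotient.eq_zero_iff_mem, ← h2]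
  have h3 := Polynomial.aeval_algHom_apply
    ((Ideal.Quotient.mkₐ k I).comp (IsScalarTower.toAlgHom k k[X] O)) X f.charpoly
  rw [aeval_X_left_apply] at h3
  exact h3.symm

theorem finite_setOf_idealDeg_le [Finite k] (n : ℕ) :
    {I : Ideal O | I ≠ ⊥ ∧ idealDeg k I ≤ n}.Finite := by
  have : Fintype (Ideal O)ˣ := Fintype.ofSubsingleton 1
  have h1 : {g : k[X] | g ≠ 0 ∧ g.natDegree ≤ n}.Finite := by
    have hfin : Finite (degreeLT k (n + 1)) := Module.finite_of_finite k
    refine Set.Finite.subset (Set.toFinite (degreeLT k (n + 1) : Set k[X])) ?_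
    rintro g ⟨hg, hn⟩
    rw [SetLike.mem_coe, mem_degreeLT, ← natDegree_lt_iff_degree_lt hg]
    omega
  refine Set.Finite.subset (h1.biUnion (t := fun g => {I : Ideal O | I ∣ Ideal.span {algebraMap k[X] O g}})
    fun g hg => ?_) ?_
  · have hne : Ideal.span {algebraMap k[X] O g} ≠ 0 := by
      rw [Ideal.zero_eq_bot, Ne, Ideal.span_singleton_eq_bot]
      rw [map_eq_zero_iff _ (FaithfulSMul.algebraMap_injective k[X] O)]
      exact hg.1
    have := UniqueFactorizationMonoid.fintypeSubtypeDvd _ hne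
    exact Set.finite_coe_iff.1 (Finite.of_fintype {I : Ideal O // I ∣ Ideal.span {algebraMap k[X] O g}})
  · rintro I ⟨hI, hn⟩
    obtain ⟨g, hg, hgn, hgI⟩ := exists_monic_mem (k := k) hI
    rw [Set.mem_iUnion₂]
    exact ⟨g, ⟨hg.ne_zero, hgn.trans_le hn⟩, by simpa [Ideal.dvd_span_singleton] using hgI⟩

/-- The finite set of nonzero ideals of degree at most `n`. -/
noncomputable def idealsDegLE (k O : Type*) [Field k] [CommRing O] [Algebra k O]
    [IsDedekindDomain O] [Algebra k[X] O] [IsScalarTower k k[X] O] [Module.Finite k[X] O]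
    [Module.Free k[X] O] [Finite k] (n : ℕ) : Finset (Ideal O) :=
  (finite_setOf_idealDeg_le (k := k) n).toFinset

theorem mem_idealsDegLE [Finite k] {n : ℕ} {I : Ideal O} :
    I ∈ idealsDegLE k O n ↔ I ≠ ⊥ ∧ idealDeg k I ≤ n := by simp [idealsDegLE]

variable [Finite k]

open Classical in
/-- The coefficients of the `L`-series of the character `idealChar ψ x`. -/
noncomputable def idealCoeff (ψ : AddChar k ℂ) (x : O) (n : ℕ) : ℂ :=
  ∑ I ∈ (idealsDegLE k O n).filter fun I => idealDeg k I = n, idealChar ψ x I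

theorem idealCoeff_zero (ψ : AddChar k ℂ) (x : O) : idealCoeff ψ x 0 = 1 := by
  classical
  rw [idealCoeff]
  have : (idealsDegLE k O 0).filter (fun I => idealDeg k I = 0) = {⊤} := by
    ext I
    simp only [Finset.mem_filter, mem_idealsDegLE, Finset.mem_singleton]
    constructor
    · rintro ⟨⟨h1, _⟩, h2⟩
      exact eq_top_of_idealDeg_eq_zero h1 h2
    · rintro rfl
      simp [idealDeg_top, top_ne_bot]
  rw [this, Finset.sum_singleton, idealChar_top]

open Classical in
theorem idealDeg_eq_sum {n : ℕ} {I : Ideal O} (hI : I ≠ ⊥) (hn : idealDeg k I = n) :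
    (n : ℂ) = ∑ P ∈ (idealsDegLE k O n).filter Ideal.IsPrime, ∑ r ∈ Finset.Icc 1 n,
      if P ^ r ∣ I then (idealDeg k P : ℂ) else 0 := by
  have hdeg : ∀ m : Multiset (Ideal O), (∀ P ∈ m, P ≠ ⊥) →
      idealDeg k m.prod = (m.map (idealDeg k)).sum := by
    intro m
    induction m using Multiset.induction_on with
    | empty => intro _; simp [Ideal.one_eq_top, idealDeg_top]
    | cons P m ih =>
      intro h
      have hm : m.prod ≠ ⊥ := by
        rw [← Ideal.zero_eq_bot, Ne, Multiset.prod_eq_zero_iff]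
        intro h0
        exact h _ (Multiset.mem_cons_of_mem h0) rfl
      rw [Multiset.prod_cons, idealDeg_mul (h P (Multiset.mem_cons_self _ _)) hm,
        ih fun Q hQ => h Q (Multiset.mem_cons_of_mem hQ), Multiset.map_cons, Multiset.sum_cons]
  set m := UniqueFactorizationMonoid.normalizedFactors I with hm
  have hmP : ∀ P ∈ m, Prime P := fun P hP =>
    UniqueFactorizationMonoid.prime_of_normalized_factor P hP
  have h1 : n = ∑ P ∈ m.toFinset, m.count P * idealDeg k P := by
    rw [← hn, ← Ideal.prod_normalizedFactors_eq_self hI, ← hm, hdeg m fun P hP => (hmP P hP).ne_zero,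
      Finset.sum_multiset_map_count]
    rfl
  have hcount : ∀ P : Ideal O, Prime P → m.count P * idealDeg k P ≤ n := by
    intro P hP
    by_cases hPm : P ∈ m.toFinset
    · rw [h1]
      exact Finset.single_le_sum (f := fun P => m.count P * idealDeg k P) (fun _ _ => Nat.zero_le _) hPm
    · rw [Multiset.mem_toFinset] at hPm
      rw [Multiset.count_eq_zero_of_notMem hPm]; simp
  have hprime : ∀ P ∈ (idealsDegLE k O n).filter Ideal.IsPrime, Prime P := by
    intro P hP
    rw [Finset.mem_filter, mem_idealsDegLE] at hP
    exact (Ideal.prime_iff_isPrime hP.1.1).2 hP.2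
  have hsub : m.toFinset ⊆ (idealsDegLE k O n).filter Ideal.IsPrime := by
    intro P hP
    have hPp := hmP P (Multiset.mem_toFinset.1 hP)
    rw [Finset.mem_filter, mem_idealsDegLE]
    refine ⟨⟨hPp.ne_zero, ?_⟩, Ideal.isPrime_of_prime hPp⟩
    refine le_trans ?_ (hcount P hPp)
    exact Nat.le_mul_of_pos_left _ (Multiset.count_pos.2 (Multiset.mem_toFinset.1 hP))
  have h2 : n = ∑ P ∈ (idealsDegLE k O n).filter Ideal.IsPrime, m.count P * idealDeg k P := by
    conv_lhs => rw [h1]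
    refine Finset.sum_subset hsub fun P _ hP => ?_
    rw [Multiset.mem_toFinset] at hP
    rw [Multiset.count_eq_zero_of_notMem hP, zero_mul]
  conv_lhs => rw [h2]
  rw [Nat.cast_sum]
  refine Finset.sum_congr rfl fun P hP => ?_
  have hPp := hprime P hP
  rw [← Finset.sum_filter, Finset.sum_const, nsmul_eq_mul, Nat.cast_mul]
  congr 2
  have hdvd : ∀ r, P ^ r ∣ I ↔ r ≤ m.count P := by
    intro r
    rw [pow_dvd_iff_le_emultiplicity,
      UniqueFactorizationMonoid.emultiplicity_eq_count_normalizedFactors hPp.irreducible hI,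
      normalize_eq, ← hm, Nat.cast_le]
  have hle : m.count P ≤ n := by
    refine le_trans ?_ (hcount P hPp)
    exact Nat.le_mul_of_pos_right _ (idealDeg_pos hPp.ne_zero (Ideal.isPrime_of_prime hPp))
  have : (Finset.Icc 1 n).filter (fun r => P ^ r ∣ I) = Finset.Icc 1 (m.count P) := by
    ext r
    simp only [Finset.mem_filter, Finset.mem_Icc, hdvd]
    omega
  rw [this, Nat.card_Icc, Nat.add_sub_cancel]

open Classical in
theorem sum_idealChar_of_dvd (ψ : AddChar k ℂ) (x : O) {n : ℕ} {Q : Ideal O} (hQ : Q ≠ ⊥) :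
    (∑ I ∈ (idealsDegLE k O n).filter (fun I => idealDeg k I = n),
      if Q ∣ I then idealChar ψ x I else 0) =
      if idealDeg k Q ≤ n then idealChar ψ x Q * idealCoeff ψ x (n - idealDeg k Q) else 0 := by
  rw [← Finset.sum_filter]
  split_ifs with h
  · rw [idealCoeff, Finset.mul_sum]
    symm
    refine Finset.sum_bij (fun J _ => Q * J) ?_ ?_ ?_ ?_
    · intro J hJ
      simp only [Finset.mem_filter, mem_idealsDegLE] at hJ ⊢
      have := idealDeg_mul (k := k) hQ hJ.1.1
      exact ⟨⟨⟨mul_ne_zero hQ hJ.1.1, by omega⟩, by omega⟩, dvd_mul_right Q J⟩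
    · intro J _ J' _ h
      exact mul_left_cancel₀ hQ h
    · rintro I hI
      simp only [Finset.mem_filter, mem_idealsDegLE] at hI
      obtain ⟨J, rfl⟩ := hI.2
      have hJ : J ≠ ⊥ := right_ne_zero_of_mul hI.1.1.1
      have := idealDeg_mul (k := k) hQ hJ
      refine ⟨J, ?_, rfl⟩
      simp only [Finset.mem_filter, mem_idealsDegLE]
      exact ⟨⟨hJ, by omega⟩, by omega⟩
    · intro J hJ
      simp only [Finset.mem_filter, mem_idealsDegLE] at hJ
      rw [idealChar_mul ψ x hQ hJ.1.1]
  · refine Finset.sum_eq_zero fun I hI => ?_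
    exfalso
    simp only [Finset.mem_filter, mem_idealsDegLE] at hI
    obtain ⟨J, rfl⟩ := hI.2
    have := idealDeg_mul (k := k) hQ (right_ne_zero_of_mul hI.1.1.1)
    omega

open Classical in
/-- The power sums attached to `idealChar ψ x`, as sums over prime powers of degree `m`. -/
noncomputable def idealPowerSum (ψ : AddChar k ℂ) (x : O) (m : ℕ) : ℂ :=
  ∑ P ∈ (idealsDegLE k O m).filter Ideal.IsPrime, ∑ r ∈ Finset.Icc 1 m,
    if r * idealDeg k P = m then (idealDeg k P : ℂ) * idealChar ψ x P ^ r else 0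

open Classical in
theorem idealPowerSum_eq (ψ : AddChar k ℂ) (x : O) {m n : ℕ} (hmn : m ≤ n) :
    idealPowerSum ψ x m = ∑ P ∈ (idealsDegLE k O n).filter Ideal.IsPrime, ∑ r ∈ Finset.Icc 1 n,
      if r * idealDeg k P = m then (idealDeg k P : ℂ) * idealChar ψ x P ^ r else 0 := by
  rw [idealPowerSum]
  have h1 : ∀ P ∈ (idealsDegLE k O n).filter Ideal.IsPrime, ∑ r ∈ Finset.Icc 1 n,
      (if r * idealDeg k P = m then (idealDeg k P : ℂ) * idealChar ψ x P ^ r else 0) =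
      ∑ r ∈ Finset.Icc 1 m,
      if r * idealDeg k P = m then (idealDeg k P : ℂ) * idealChar ψ x P ^ r else 0 := by
    intro P hP
    rw [Finset.mem_filter, mem_idealsDegLE] at hP
    have hpos := idealDeg_pos (k := k) hP.1.1 hP.2
    symm
    refine Finset.sum_subset (Finset.Icc_subset_Icc_right hmn) fun r hr hr' => if_neg fun h => hr' ?_
    rw [Finset.mem_Icc] at hr ⊢
    exact ⟨hr.1, h ▸ Nat.le_mul_of_pos_right _ hpos⟩
  rw [Finset.sum_congr rfl h1]
  refine Finset.sum_subset ?_ ?_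
  · intro P hP
    simp only [Finset.mem_filter, mem_idealsDegLE] at hP ⊢
    exact ⟨⟨hP.1.1, hP.1.2.trans hmn⟩, hP.2⟩
  · intro P hP hP'
    refine Finset.sum_eq_zero fun r hr => if_neg fun h => hP' ?_
    simp only [Finset.mem_filter, mem_idealsDegLE, Finset.mem_Icc] at hP hr ⊢
    exact ⟨⟨hP.1.1, h ▸ Nat.le_mul_of_pos_left _ hr.1⟩, hP.2⟩

theorem mul_idealCoeff_eq_sum (ψ : AddChar k ℂ) (x : O) (n : ℕ) :
    (n : ℂ) * idealCoeff ψ x n =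
      ∑ m ∈ Finset.Icc 1 n, idealPowerSum ψ x m * idealCoeff ψ x (n - m) := by
  classical
  have h1 : (n : ℂ) * idealCoeff ψ x n = ∑ P ∈ (idealsDegLE k O n).filter Ideal.IsPrime,
      ∑ r ∈ Finset.Icc 1 n, (idealDeg k P : ℂ) *
        if r * idealDeg k P ≤ n then idealChar ψ x P ^ r * idealCoeff ψ x (n - r * idealDeg k P)
        else 0 := by
    rw [idealCoeff, Finset.mul_sum]
    have : ∀ I ∈ (idealsDegLE k O n).filter (fun I => idealDeg k I = n),
        (n : ℂ) * idealChar ψ x I = ∑ P ∈ (idealsDegLE k O n).filter Ideal.IsPrime,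
          ∑ r ∈ Finset.Icc 1 n, (idealDeg k P : ℂ) * if P ^ r ∣ I then idealChar ψ x I else 0 := by
      intro I hI
      simp only [Finset.mem_filter, mem_idealsDegLE] at hI
      conv_lhs => rw [idealDeg_eq_sum hI.1.1 hI.2]
      simp only [Finset.sum_mul]
      refine Finset.sum_congr rfl fun P _ => Finset.sum_congr rfl fun r _ => ?_
      split_ifs <;> simp
    rw [Finset.sum_congr rfl this, Finset.sum_comm]
    refine Finset.sum_congr rfl fun P hP => ?_
    simp only [Finset.mem_filter, mem_idealsDegLE] at hP
    rw [Finset.sum_comm]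
    refine Finset.sum_congr rfl fun r _ => ?_
    rw [← Finset.mul_sum, sum_idealChar_of_dvd ψ x (pow_ne_zero r hP.1.1),
      idealDeg_pow hP.1.1, idealChar_pow ψ x hP.1.1]
  have h2 : ∀ m ∈ Finset.Icc 1 n, idealPowerSum ψ x m * idealCoeff ψ x (n - m) =
      ∑ P ∈ (idealsDegLE k O n).filter Ideal.IsPrime, ∑ r ∈ Finset.Icc 1 n,
      if r * idealDeg k P = m then (idealDeg k P : ℂ) *
        (idealChar ψ x P ^ r * idealCoeff ψ x (n - r * idealDeg k P)) else 0 := by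
    intro m hm
    rw [Finset.mem_Icc] at hm
    rw [idealPowerSum_eq ψ x hm.2, Finset.sum_mul]
    refine Finset.sum_congr rfl fun P _ => ?_
    rw [Finset.sum_mul]
    refine Finset.sum_congr rfl fun r _ => ?_
    split_ifs with h
    · rw [h]; ring
    · simp
  rw [h1, Finset.sum_congr rfl h2, Finset.sum_comm (s := Finset.Icc 1 n)]
  refine Finset.sum_congr rfl fun P hP => ?_
  simp only [Finset.mem_filter, mem_idealsDegLE] at hP
  have hpos := idealDeg_pos (k := k) hP.1.1 hP.2
  rw [Finset.sum_comm]
  refine Finset.sum_congr rfl fun r hr => ?_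
  rw [Finset.mem_Icc] at hr
  have := Nat.mul_pos hr.1 hpos
  rw [Finset.sum_ite_eq]
  simp only [Finset.mem_Icc]
  by_cases hle : r * idealDeg k P ≤ n
  · rw [if_pos hle, if_pos ⟨this, hle⟩]
  · rw [if_neg hle, if_neg fun h => hle h.2, mul_zero]

end IdealSeries

end

section
open Polynomial

section NormLeading
variable {k : Type*} [Field k]

theorem natDegree_X_sq_mul_prod_sub_pow_le {ι : Type*} (S : Finset ι) {s : k[X]} {r : ι → k[X]}
    {n : ℕ} (hs : s.natDegree ≤ n) (hr : ∀ i, (X ^ 2 * r i).natDegree ≤ n) :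
    (X ^ 2 * (∏ i ∈ S, (s + r i) - s ^ S.card)).natDegree ≤ S.card * n := by
  classical
  have hr' : ∀ i, (r i).natDegree ≤ n := by
    intro i
    by_cases h : r i = 0
    · rw [h]; simp
    have := hr i
    rw [natDegree_X_pow_mul 2 h] at this
    omega
  induction S using Finset.induction_on with
  | empty => simp
  | insert a S ha ih =>
    rw [Finset.prod_insert ha, Finset.card_insert_of_notMem ha]
    have e : X ^ 2 * ((s + r a) * ∏ i ∈ S, (s + r i) - s ^ (S.card + 1)) =
        s * (X ^ 2 * (∏ i ∈ S, (s + r i) - s ^ S.card)) + (X ^ 2 * r a) * ∏ i ∈ S, (s + r i) := by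
      ring
    have h1 : (∏ i ∈ S, (s + r i)).natDegree ≤ S.card * n := by
      refine (natDegree_prod_le _ _).trans ?_
      rw [← smul_eq_mul]
      exact Finset.sum_le_card_nsmul _ _ _ fun i _ => natDegree_add_le_of_degree_le hs (hr' i)
    rw [e]
    refine natDegree_add_le_of_degree_le ?_ ?_
    · refine natDegree_mul_le.trans ?_
      rw [add_mul, one_mul]; omega
    · refine natDegree_mul_le.trans ?_
      have := hr a
      rw [add_mul, one_mul]; omega

theorem natDegree_X_sq_mul_norm_sub_le {d m n : ℕ} {Φ : k[X][X]} (hΦ : Φ.Monic)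
    (hd : Φ.natDegree = d) (hW : WD 1 Φ d) {s : k[X]} (hs : s.natDegree ≤ n) {P : k[X][X]}
    (hP : WD 1 P m) (hmn : m + 2 ≤ n) :
    (X ^ 2 * (Algebra.norm k[X] (AdjoinRoot.mk Φ (C s + P)) - s ^ d)).natDegree ≤ d * n := by
  classical
  subst hd
  have hW' : WD 1 Φ (1 * Φ.natDegree) := by rwa [one_mul]
  set pb := AdjoinRoot.powerBasis' hΦ with hpb
  have hdim : pb.dim = Φ.natDegree := rfl
  set R := (Algebra.leftMulMatrix pb.basis) (AdjoinRoot.mk Φ P) with hR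
  have hentry : ∀ i j : Fin pb.dim, R i j = ((P * X ^ (j : ℕ)) %ₘ Φ).coeff i := by
    intro i j
    rw [hR, Algebra.leftMulMatrix_eq_repr_mul, pb.coe_basis]
    simp only [hpb, AdjoinRoot.powerBasis'_gen]
    rw [← AdjoinRoot.mk_X, ← map_pow, ← map_mul]
    change (AdjoinRoot.modByMonicHom hΦ _).coeff _ = _
    rw [AdjoinRoot.modByMonicHom_mk]
  have hRdeg : ∀ i j : Fin pb.dim, R i j ≠ 0 → (R i j).natDegree + i ≤ m + j := by
    intro i j hne
    rw [hentry] at hne ⊢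
    have := (WD.modByMonic hΦ hW' (hP.mul (WD.X_pow j))) i hne
    simpa using this
  let E : Matrix (Fin pb.dim) (Fin pb.dim) k[X] := Matrix.diagonal (fun _ => s) + R
  have hM : (Algebra.leftMulMatrix pb.basis) (AdjoinRoot.mk Φ (C s + P)) =
E := by
    have hC : AdjoinRoot.mk Φ (C s) = algebraMap k[X] (AdjoinRoot Φ) s := rfl
    rw [map_add, map_add, hC, ← hR, AlgHom.commutes]
    rfl
  rw [Algebra.norm_eq_matrix_det pb.basis, hM, Matrix.det_apply, ← Finset.add_sum_erase _ _
    (Finset.mem_univ 1), add_sub_right_comm, mul_add, Finset.mul_sum]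
  have hR2 : ∀ i j : Fin pb.dim, R i j ≠ 0 → (X ^ 2 * R i j).natDegree + i ≤ n + j := by
    intro i j h
    have := hRdeg i j h
    rw [natDegree_X_pow_mul 2 h]
    omega
  refine natDegree_add_le_of_degree_le ?_ ?_
  · have h1 := natDegree_X_sq_mul_prod_sub_pow_le (Finset.univ : Finset (Fin pb.dim)) (s := s)
      (r := fun i => R i i) (n := n) hs (by
        intro i
        by_cases h : R i i = 0
        · rw [h]; simp
        have := hR2 i i h
        omega)
    rw [Finset.card_univ, Fintype.card_fin] at h1
    refine le_trans (le_of_eq ?_) h1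
    rw [Equiv.Perm.sign_one, one_smul]
    simp only [Equiv.Perm.one_apply, E, Matrix.add_apply, Matrix.diagonal_apply_eq]
    rfl
  · refine natDegree_sum_le_of_forall_le _ _ fun σ hσ => ?_
    have hσ1 : σ ≠ 1 := Finset.ne_of_mem_erase hσ
    obtain ⟨i₀, hi₀⟩ : ∃ i, σ i ≠ i := by
      by_contra h
      push Not at h
      exact hσ1 (Equiv.ext h)
    by_cases hz : (∏ i, E (σ i) i) = 0
    · rw [hz]; simp
    set F : Fin pb.dim → k[X] := fun i =>
      if i = i₀ then X ^ 2 * E (σ i) i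
      else E (σ i) i with hF
    have hprod : X ^ 2 * (∏ i, E (σ i) i) = ∏ i, F i := by
      rw [← Finset.mul_prod_erase _ _ (Finset.mem_univ i₀),
        ← Finset.mul_prod_erase _ F (Finset.mem_univ i₀), ← mul_assoc]
      congr 1
      · simp [hF]
      · refine Finset.prod_congr rfl fun i hi => ?_
        simp only [hF]
        rw [if_neg (Finset.ne_of_mem_erase hi)]
    have hFdeg : ∀ i, (F i).natDegree + σ i ≤ n + i := by
      intro i
      have hne : E (σ i) i ≠ 0 :=
        fun h => hz (Finset.prod_eq_zero (Finset.mem_univ i) h)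
      simp only [hF]
      split_ifs with h
      · rw [h] at hne ⊢
        simp only [E] at hne ⊢
        rw [Matrix.add_apply, Matrix.diagonal_apply_ne _ hi₀, zero_add] at hne ⊢
        exact hR2 _ _ hne
      · simp only [E] at hne ⊢
        rw [Matrix.add_apply] at hne ⊢
        by_cases hi : σ i = i
        · rw [hi, Matrix.diagonal_apply_eq]
          have : (R i i).natDegree ≤ n := by
            by_cases h0 : R i i = 0
            · rw [h0]; simp
            have := hRdeg i i h0
            omega
          have := natDegree_add_le_of_degree_le hs this
          omega
        · rw [Matrix.diagonal_apply_ne _ hi, zero_add] at hne ⊢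
          have := hRdeg _ _ hne
          omega
    have h2 := Finset.sum_le_sum fun i (_ : i ∈ Finset.univ) => hFdeg i
    rw [Finset.sum_add_distrib, Finset.sum_add_distrib,
      Equiv.sum_comp σ (fun i : Fin pb.dim => (i : ℕ))] at h2
    simp only [Finset.sum_const, Finset.card_univ, Fintype.card_fin, smul_eq_mul] at h2
    rw [mul_smul_comm, hprod]
    refine (natDegree_smul_le _ _).trans ((natDegree_prod_le _ _).trans ?_)
    rw [← hdim]
    omega

end NormLeading

end

section
open Polynomial

theorem LinearMap.det_eq_det_of_injective_of_comp_eq {R M N : Type*} [CommRing R] [IsDomain R]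
    [AddCommGroup M] [AddCommGroup N] [Module R M] [Module R N] [Module.Finite R M]
    [Module.Finite R N] [Module.Free R M] [Module.Free R N]
    (hMN : Module.finrank R M = Module.finrank R N) {i : M →ₗ[R] N} (hi : Function.Injective i)
    {f : M →ₗ[R] M} {g : N →ₗ[R] N} (h : g ∘ₗ i = i ∘ₗ f) : f.det = g.det := by
  classical
  let bM := Module.finBasis R M
  let bN := (Module.finBasis R N).reindex (finCongr hMN.symm)
  let T := LinearMap.toMatrix bM bN i
  have hT : T.det ≠ 0 := by
    intro h0
    obtain ⟨v, hv, hv0⟩ := Matrix.exists_mulVec_eq_zero_iff.2 h0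
    apply hv
    have h1 : i (bM.equivFun.symm v) = 0 := by
      apply bN.equivFun.injective
      have h2 := LinearMap.toMatrix_mulVec_repr bM bN i (bM.equivFun.symm v)
      have h3 : ⇑(bM.repr (bM.equivFun.symm v)) = v := bM.equivFun.apply_symm_apply v
      rw [h3] at h2
      exact h2.symm.trans (hv0.trans (map_zero bN.equivFun).symm)
    have h2 : bM.equivFun.symm v = 0 := hi (by rw [h1, map_zero])
    exact (LinearEquiv.map_eq_zero_iff _).1 h2
  have h1 : LinearMap.toMatrix bN bN g * T = T * LinearMap.toMatrix bM bM f := by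
    rw [← LinearMap.toMatrix_comp, h, LinearMap.toMatrix_comp bM bM bN]
  have h2 := congrArg Matrix.det h1
  rw [Matrix.det_mul, Matrix.det_mul, mul_comm, LinearMap.det_toMatrix,
    LinearMap.det_toMatrix] at h2
  exact (mul_left_cancel₀ hT h2).symm

section Order
variable {k : Type*} [Field k] {O : Type*} [CommRing O] [IsDedekindDomain O] [Algebra k[X] O]
  [Module.Finite k[X] O] [Module.Free k[X] O]
  {Φ : k[X][X]} {d : ℕ} (hΦ : Φ.Monic) (hd : Φ.natDegree = d)
  {ι : AdjoinRoot Φ →ₐ[k[X]] O} (hι : Function.Injective ι)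
  {Δ : k[X]} (hΔ : Δ ≠ 0) (hO : ∀ u : O, ∃ P : k[X][X], Δ • u = ι (AdjoinRoot.mk Φ P))

include hΦ hd hι hΔ hO

theorem finrank_eq_of_order : Module.finrank k[X] O = d := by
  have : Module.Finite k[X] (AdjoinRoot Φ) := (AdjoinRoot.powerBasis' hΦ).finite
  have : Module.Free k[X] (AdjoinRoot Φ) := Module.Free.of_basis (AdjoinRoot.powerBasis' hΦ).basis
  have h0 : Module.finrank k[X] (AdjoinRoot Φ) = d := by
    rw [(AdjoinRoot.powerBasis' hΦ).finrank, AdjoinRoot.powerBasis'_dim, hd]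
  refine le_antisymm ?_ ?_
  · let e : AdjoinRoot Φ ≃ₗ[k[X]] LinearMap.range ι.toLinearMap :=
      LinearEquiv.ofInjective ι.toLinearMap hι
    have : Module.Finite k[X] (LinearMap.range ι.toLinearMap) := Module.Finite.equiv e
    rw [← h0, e.finrank_eq]
    let j : O →ₗ[k[X]] LinearMap.range ι.toLinearMap :=
      LinearMap.codRestrict _ (LinearMap.lsmul k[X] O Δ) fun u => by
        obtain ⟨P, hP⟩ := hO u
        exact ⟨AdjoinRoot.mk Φ P, hP.symm⟩
    refine LinearMap.finrank_le_finrank_of_injective (f := j) ?_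
    intro u v huv
    have : Δ • u = Δ • v := congrArg Subtype.val huv
    exact smul_right_injective O hΔ this
  · rw [← h0]
    exact LinearMap.finrank_le_finrank_of_injective (f := ι.toLinearMap) hι

theorem norm_map_order (b : AdjoinRoot Φ) :
    Algebra.norm k[X] (ι b) = Algebra.norm k[X] b := by
  have : Module.Finite k[X] (AdjoinRoot Φ) := (AdjoinRoot.powerBasis' hΦ).finite
  have : Module.Free k[X] (AdjoinRoot Φ) := Module.Free.of_basis (AdjoinRoot.powerBasis' hΦ).basis
  symm
  rw [Algebra.norm_apply, Algebra.norm_apply]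
  refine LinearMap.det_eq_det_of_injective_of_comp_eq (i := ι.toLinearMap) ?_ hι ?_
  · rw [finrank_eq_of_order hΦ hd hι hΔ hO, (AdjoinRoot.powerBasis' hΦ).finrank,
      AdjoinRoot.powerBasis'_dim, hd]
  · ext u
    simp

/-- The norm of an element `X ^ M + t X ^ (M - 1) + (lower order terms)`. -/
theorem norm_monic_and_nextCoeff (hd0 : 0 < d) (hW : WD 1 Φ d) {M : ℕ} (hM : 2 ≤ M) (t : k) {u : O}
    {P : k[X][X]} (hP : WD 1 P (M - 2 + Δ.natDegree)) (hu : Δ • u = ι (AdjoinRoot.mk Φ P)) :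
    (Algebra.norm k[X] (algebraMap k[X] O (X ^ M + C t * X ^ (M - 1)) + u)).Monic ∧
    (Algebra.norm k[X] (algebraMap k[X] O (X ^ M + C t * X ^ (M - 1)) + u)).natDegree = d * M ∧
    (Algebra.norm k[X] (algebraMap k[X] O (X ^ M + C t * X ^ (M - 1)) + u)).nextCoeff = d * t := by
  set s : k[X] := X ^ M + C t * X ^ (M - 1) with hs
  set N := Algebra.norm k[X] (algebraMap k[X] O s + u) with hN
  have hslow : (C t * X ^ (M - 1)).natDegree < M :=
    (natDegree_C_mul_X_pow_le t (M - 1)).trans_lt (by omega)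
  have hsm : s.Monic := monic_X_pow_add (degree_C_mul_X_pow_le (M - 1) t |>.trans_lt (by
    exact_mod_cast (by omega : M - 1 < M)))
  have hsd : s.natDegree = M := by
    rw [hs, natDegree_add_eq_left_of_natDegree_lt (by rwa [natDegree_X_pow]), natDegree_X_pow]
  have hsn : s.nextCoeff = t := by
    rw [nextCoeff_of_natDegree_pos (by omega), hsd, hs, coeff_add, coeff_X_pow, coeff_C_mul_X_pow,
      if_neg (by omega), if_pos rfl, zero_add]
  have h1 : Δ ^ d * N = Algebra.norm k[X] (AdjoinRoot.mk Φ (C (Δ * s) + P)) := by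
    rw [← norm_map_order hΦ hd hι hΔ hO, map_add (AdjoinRoot.mk Φ), map_add ι, ← hu]
    have h2 : ι (AdjoinRoot.mk Φ (C (Δ * s))) = Δ • algebraMap k[X] O s := by
      have : AdjoinRoot.mk Φ (C (Δ * s)) = algebraMap k[X] (AdjoinRoot Φ) (Δ * s) := rfl
      rw [this, AlgHom.commutes, map_mul, Algebra.smul_def]
    rw [h2, ← smul_add, Algebra.smul_def, map_mul, Algebra.norm_algebraMap,
      finrank_eq_of_order hΦ hd hι hΔ hO]
  have h2 := natDegree_X_sq_mul_norm_sub_le hΦ hd hW (s := Δ * s) (n := M + Δ.natDegree)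
    (natDegree_mul_le.trans (by omega)) hP (by omega)
  have h3 : (X ^ 2 * (N - s ^ d)).natDegree ≤ d * M := by
    by_cases h0 : N - s ^ d = 0
    · rw [h0]; simp
    have e : X ^ 2 * (Algebra.norm k[X] (AdjoinRoot.mk Φ (C (Δ * s) + P)) - (Δ * s) ^ d) =
        Δ ^ d * (X ^ 2 * (N - s ^ d)) := by
      rw [← h1, mul_pow]; ring
    rw [e, natDegree_mul (pow_ne_zero d hΔ) (mul_ne_zero (pow_ne_zero 2 X_ne_zero) h0),
      natDegree_pow, mul_add] at h2
    omega
  have hdM : 2 ≤ d * M := le_trans hM (Nat.le_mul_of_pos_left M hd0)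
  have h4 : ∀ j, d * M ≤ j + 1 → (N - s ^ d).coeff j = 0 := by
    intro j hj
    rw [← coeff_X_pow_mul (N - s ^ d) 2 j]
    exact coeff_eq_zero_of_natDegree_lt (by omega)
  have hpm : (s ^ d).Monic := hsm.pow d
  have hpd : (s ^ d).natDegree = d * M := by rw [hsm.natDegree_pow, hsd]
  have hlt : (N - s ^ d).natDegree < d * M := by
    by_cases h0 : N - s ^ d = 0
    · rw [h0, natDegree_zero]; omega
    · rw [natDegree_X_pow_mul _ h0] at h3
      omega
  have hNe : N = s ^ d + (N - s ^ d) := (add_sub_cancel _ _).symm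
  have hNd : N.natDegree = d * M := by
    rw [hNe, natDegree_add_eq_left_of_natDegree_lt (by rwa [hpd]), hpd]
  refine ⟨?_, hNd, ?_⟩
  · rw [hNe]
    exact hpm.add_of_left (degree_lt_degree (by rwa [hpd]))
  · have h5 : (s ^ d).nextCoeff = d * t := by
      rw [hsm.nextCoeff_pow, hsn, nsmul_eq_mul]
    rw [← h5, nextCoeff_of_natDegree_pos (by omega), nextCoeff_of_natDegree_pos (by omega), hNd, hpd]
    have := h4 (d * M - 1) (by omega)
    rwa [coeff_sub, sub_eq_zero] at this

end Order

end

section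
open Polynomial

section Order
variable {k : Type*} [Field k] {O : Type*} [CommRing O] [Algebra k O] [IsDedekindDomain O]
  [Algebra k[X] O] [IsScalarTower k k[X] O] [Module.Finite k[X] O] [Module.Free k[X] O]
  {Φ : k[X][X]} {d : ℕ}

/-- An ideal of small degree contains a nonzero polynomial expression with coefficients of small
degree. -/
theorem exists_mem_ideal_of_idealDeg_lt (f : k[X][X] →ₐ[k[X]] O) {I : Ideal O} (hI : I ≠ ⊥) {r : ℕ}
    (h : idealDeg k I < d * r) :
    ∃ P : k[X][X], P ≠ 0 ∧ P.degree < d ∧ (∀ j, (P.coeff j).degree < r) ∧ f P ∈ I := by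
  have := finite_quotient_ideal k hI
  let T : (Fin d → degreeLT k r) →ₗ[k] k[X][X] :=
    ∑ i : Fin d, ((monomial (R := k[X]) (i : ℕ)).restrictScalars k) ∘ₗ (degreeLT k r).subtype ∘ₗ
      LinearMap.proj i
  have hT : ∀ g, T g = ∑ i : Fin d, monomial (i : ℕ) (g i : k[X]) := by
    intro g; simp [T]
  have hTc : ∀ g (j : ℕ), (T g).coeff j = if h : j < d then (g ⟨j, h⟩ : k[X]) else 0 := by
    intro g j
    rw [hT, finsetSum_coeff]
    simp only [coeff_monomial]
    split_ifs with h
    · rw [Finset.sum_eq_single ⟨j, h⟩]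
      · simp
      · intro b _ hb
        rw [if_neg]
        intro h'
        exact hb (Fin.ext h')
      · simp
    · refine Finset.sum_eq_zero fun b _ => if_neg ?_
      have := b.2
      omega
  let g : (Fin d → degreeLT k r) →ₗ[k] O ⧸ I :=
    (Ideal.Quotient.mkₐ k I).toLinearMap ∘ₗ (f.toLinearMap.restrictScalars k) ∘ₗ T
  have : Module.Finite k (degreeLT k r) := Module.Finite.equiv (degreeLTEquiv k r).symm
  have hker : LinearMap.ker g ≠ ⊥ := by
    apply LinearMap.ker_ne_bot_of_finrank_lt
    rw [Module.finrank_pi_fintype, (degreeLTEquiv k r).finrank_eq]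
    simpa [idealDeg] using h
  obtain ⟨v, hv, hv0⟩ := Submodule.exists_mem_ne_zero_of_ne_bot hker
  refine ⟨T v, ?_, ?_, ?_, ?_⟩
  · intro h0
    apply hv0
    ext1 i
    have := hTc v i
    rw [h0, dif_pos i.2, coeff_zero] at this
    exact Subtype.ext this.symm
  · rw [degree_lt_iff_coeff_zero]
    intro j hj
    rw [hTc, dif_neg (by omega)]
  · intro j
    rw [hTc]
    split_ifs with h
    · exact mem_degreeLT.1 (v ⟨j, h⟩).2
    · rw [degree_zero]; exact WithBot.bot_lt_coe r
  · have : g v = 0 := hv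
    exact Ideal.Quotient.eq_zero_iff_mem.1 this

/-- The elements of `O` whose pole order is bounded in terms of `m`. -/
def orderFil (ι : AdjoinRoot Φ →ₐ[k[X]] O) (Δ : k[X]) (m : ℕ) : Submodule k O where
  carrier := {u | ∃ P, WD 1 P (m + Δ.natDegree) ∧ Δ • u = ι (AdjoinRoot.mk Φ P)}
  zero_mem' := ⟨0, WD.zero, by simp⟩
  add_mem' := by
    rintro u v ⟨P, hP, hu⟩ ⟨Q, hQ, hv⟩
    exact ⟨P + Q, hP.add hQ, by rw [smul_add, hu, hv, map_add, map_add]⟩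
  smul_mem' := by
    rintro c u ⟨P, hP, hu⟩
    refine ⟨C (C c) * P, ?_, ?_⟩
    · have := (WD.C (R := k) (w := 1) (a := C c) (m := 0) (by simp)).mul hP
      rwa [zero_add] at this
    · have h1 : AdjoinRoot.mk Φ (C (C c)) = algebraMap k[X] _ (C c) := rfl
      have h2 : c • u = (C c : k[X]) • u := by
        rw [← mul_one (C c), ← smul_eq_C_mul, smul_assoc, one_smul]
      rw [map_mul, map_mul, h1, AlgHom.commutes, ← Algebra.smul_def, ← hu, h2, smul_comm]

theorem finite_setOf_WD [Finite k] (n : ℕ) : {P : k[X][X] | WD 1 P n}.Finite := by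
  refine Set.Finite.of_finite_image (f := fun P (i j : Fin (n + 1)) => (P.coeff i).coeff j)
    (Set.toFinite _) ?_
  intro P hP Q hQ h
  ext i j
  have key : ∀ R : k[X][X], WD 1 R n → (n < i ∨ n < j) → (R.coeff i).coeff j = 0 := by
    intro R hR hij
    by_cases h0 : R.coeff i = 0
    · rw [h0, coeff_zero]
    · have := hR i h0
      exact coeff_eq_zero_of_natDegree_lt (by omega)
  by_cases hij : n < i ∨ n < j
  · rw [key P hP hij, key Q hQ hij]
  · push Not at hij
    exact congrFun (congrFun h ⟨i, by omega⟩) ⟨j, by omega⟩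

theorem finite_orderFil [Finite k] (ι : AdjoinRoot Φ →ₐ[k[X]] O) {Δ : k[X]} (hΔ : Δ ≠ 0) (m : ℕ) :
    (orderFil ι Δ m : Set O).Finite := by
  have h1 := (finite_setOf_WD (k := k) (m + Δ.natDegree)).image (fun P => ι (AdjoinRoot.mk Φ P))
  refine Set.Finite.of_finite_image (f := fun u => Δ • u) (h1.subset ?_)
    ((smul_right_injective O hΔ).injOn)
  rintro _ ⟨u, ⟨P, hP, hu⟩, rfl⟩
  exact ⟨P, hP, hu.symm⟩

theorem orderFil_mono (ι : AdjoinRoot Φ →ₐ[k[X]] O) (Δ : k[X]) {m n : ℕ} (h : m ≤ n) :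
    orderFil ι Δ m ≤ orderFil ι Δ n := by
  rintro u ⟨P, hP, hu⟩
  exact ⟨P, hP.mono (by omega), hu⟩

variable (hΦ : Φ.Monic) (hd : Φ.natDegree = d)
  {ι : AdjoinRoot Φ →ₐ[k[X]] O} (hι : Function.Injective ι)
  {Δ : k[X]} (hΔ : Δ ≠ 0) (hO : ∀ u : O, ∃ P : k[X][X], Δ • u = ι (AdjoinRoot.mk Φ P))

include hΦ hd hι hΔ hO

theorem exists_orderFil_sub_mem (hd0 : 0 < d) (hW : WD 1 Φ d) {I : Ideal O} (hI : I ≠ ⊥) {M : ℕ}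
    (hM : idealDeg k I + 2 * d ^ 2 ≤ d * M) (u : O) :
    ∃ v ∈ orderFil ι Δ (M - 2), u - v ∈ I := by
  have hdeg : Φ.degree = d := by rw [degree_eq_natDegree hΦ.ne_zero, hd]
  have hW1 : WD 1 Φ (1 * Φ.natDegree) := by rwa [hd, one_mul]
  set n := idealDeg k I with hn
  obtain ⟨P0, hP0, hP0d, hP0c, hP0I⟩ := exists_mem_ideal_of_idealDeg_lt (d := d)
    (ι.comp (AdjoinRoot.mkₐ Φ)) hI (r := n / d + 1) (Nat.lt_mul_div_succ n hd0)
  have hP0w : WD 1 P0 (n / d + (d - 1)) := by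
    intro j hj
    have h1 : j < d := by
      by_contra h
      exact hj (degree_lt_iff_coeff_zero _ _ |>.1 hP0d j (by omega))
    have h2 := (natDegree_lt_iff_degree_lt hj).2 (hP0c j)
    omega
  have hmk0 : AdjoinRoot.mk Φ P0 ≠ 0 := AdjoinRoot.mk_ne_zero_of_degree_lt hΦ hP0 (by rwa [hdeg])
  set w0 := ι (AdjoinRoot.mk Φ P0) with hw0
  have hw00 : w0 ≠ 0 := by rwa [hw0, Ne, map_eq_zero_iff ι hι]
  have hw0I : w0 ∈ I := hP0I
  have hcomap := Ideal.comap_ne_bot_of_integral_mem (R := k[X]) (I := Ideal.span {w0}) hw00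
    (Ideal.mem_span_singleton_self w0) (Algebra.IsIntegral.isIntegral w0)
  obtain ⟨s, hs, hs0⟩ := Submodule.exists_mem_ne_zero_of_ne_bot hcomap
  obtain ⟨w', hw'⟩ := Ideal.mem_span_singleton.1 (Ideal.mem_comap.1 hs)
  obtain ⟨P', hP'⟩ := hO (u * w')
  have hreduce : ∀ P : k[X][X], AdjoinRoot.mk Φ (P %ₘ Φ) = AdjoinRoot.mk Φ P := by
    intro P
    rw [AdjoinRoot.mk_eq_mk, modByMonic_eq_sub_mul_div P Φ, sub_sub_cancel_left]
    exact (dvd_mul_right _ _).neg_right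
  set P := P' %ₘ Φ with hPdef
  have hPd : P.natDegree < d := by
    rw [← hd]; exact natDegree_modByMonic_lt _ hΦ (by rintro rfl; simp at hd; omega)
  set s1 := Δ * s with hs1
  have hs10 : s1 ≠ 0 := mul_ne_zero hΔ hs0
  set Q : k[X][X] := ∑ j ∈ Finset.range d, monomial j (P.coeff j / s1) with hQ
  set R : k[X][X] := ∑ j ∈ Finset.range d, monomial j (P.coeff j % s1) with hR
  have hPQR : P = C s1 * Q + R := by
    rw [P.as_sum_range' d hPd, hQ, hR, Finset.mul_sum, ← Finset.sum_add_distrib]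
    refine Finset.sum_congr rfl fun j _ => ?_
    rw [C_mul_monomial, ← map_add]
    congr 1
    exact (EuclideanDomain.div_add_mod _ _).symm
  have hRw : WD 1 R (s1.natDegree + (d - 1)) := by
    refine WD.sum _ _ fun j hj => WD.monomial ?_
    have h1 : (P.coeff j % s1).natDegree ≤ s1.natDegree :=
      natDegree_le_natDegree (EuclideanDomain.mod_lt (P.coeff j) hs10).le
    have := Finset.mem_range.1 hj
    omega
  have hcomm : ∀ a : k[X], ι (AdjoinRoot.mk Φ (C a)) = algebraMap k[X] O a := fun a => ι.commutes a
  set v := u - w0 * ι (AdjoinRoot.mk Φ Q) with hv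
  obtain ⟨P1', hP1'⟩ := hO v
  have hsv : s • Δ • v = ι (AdjoinRoot.mk Φ (P0 * R)) := by
    have h1 : s • Δ • u = w0 * ι (AdjoinRoot.mk Φ P) := by
      rw [hreduce, ← hP', Algebra.smul_def, hw', Algebra.smul_def, Algebra.smul_def]; ring
    rw [hv, smul_sub, smul_sub, h1, hPQR]
    simp only [map_add, map_mul, hcomm, hs1, Algebra.smul_def, hw0]
    ring
  refine ⟨v, orderFil_mono ι Δ (m := n / d + (d - 1) + d - 1) ?_ ⟨P1' %ₘ Φ, ?_, ?_⟩, ?_⟩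
  · have h1 : n / d + 2 * d ≤ M := by
      have : (n / d + 2 * d) * d ≤ M * d := by
        have := Nat.div_mul_le_self n d
        nlinarith
      exact Nat.le_of_mul_le_mul_right this hd0
    omega
  · have h1 : C s * (P1' %ₘ Φ) = (P0 * R) %ₘ Φ := by
      have h2 : AdjoinRoot.mk Φ (C s * (P1' %ₘ Φ)) = AdjoinRoot.mk Φ (P0 * R) := by
        apply hι
        rw [map_mul, hreduce, map_mul, hcomm, ← hP1', ← hsv, Algebra.smul_def s]
      have h3 : (C s * (P1' %ₘ Φ)).degree < Φ.degree := by
        rw [degree_C_mul hs0]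
        exact degree_modByMonic_lt _ hΦ
      rw [← (modByMonic_eq_self_iff hΦ).2 h3]
      exact modByMonic_eq_of_dvd_sub hΦ (AdjoinRoot.mk_eq_mk.1 h2)
    have h2 := WD.modByMonic hΦ hW1 (hP0w.mul hRw)
    rw [← h1] at h2
    intro j hj
    have h3 := h2 j (by rw [coeff_C_mul]; exact mul_ne_zero hs0 hj)
    rw [coeff_C_mul, natDegree_mul hs0 hj, hs1, natDegree_mul hΔ hs0] at h3
    omega
  · rw [hreduce, hP1']
  · rw [hv, sub_sub_cancel]
    exact I.mul_mem_right _ hw0I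
end Order

end

section
open Polynomial

section Order
variable {k : Type*} [Field k] [Finite k] {O : Type*} [CommRing O] [Algebra k O] [IsDedekindDomain O]
  [Algebra k[X] O] [IsScalarTower k k[X] O] [Module.Finite k[X] O] [Module.Free k[X] O]
  {Φ : k[X][X]} {d : ℕ} (hΦ : Φ.Monic) (hd : Φ.natDegree = d)
  {ι : AdjoinRoot Φ →ₐ[k[X]] O} (hι : Function.Injective ι)
  {Δ : k[X]} (hΔ : Δ ≠ 0) (hO : ∀ u : O, ∃ P : k[X][X], Δ • u = ι (AdjoinRoot.mk Φ P))

include hΦ hd hι hΔ hO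

open Classical in
theorem card_filter_orderFil_mul (hd0 : 0 < d) (hW : WD 1 Φ d) {I : Ideal O} (hI : I ≠ ⊥) {M : ℕ}
    (hM : idealDeg k I + 2 * d ^ 2 ≤ d * M) (b : O) :
    ((finite_orderFil ι hΔ (M - 2)).toFinset.filter fun v => b + v ∈ I).card *
      Nat.card k ^ idealDeg k I = (finite_orderFil ι hΔ (M - 2)).toFinset.card := by
  have := finite_quotient_ideal k hI
  set V : Submodule k O := orderFil ι Δ (M - 2) with hV
  let f : V →ₗ[k] O ⧸ I := (Ideal.Quotient.mkₐ k I).toLinearMap ∘ₗ V.subtype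
  have hf : Function.Surjective f := by
    intro x
    obtain ⟨u, rfl⟩ := Ideal.Quotient.mk_surjective x
    obtain ⟨v, hv, hvI⟩ := exists_orderFil_sub_mem hΦ hd hι hΔ hO hd0 hW hI hM u
    exact ⟨⟨v, hv⟩, ((Ideal.Quotient.mk_eq_mk_iff_sub_mem _ _).2 hvI).symm⟩
  obtain ⟨v0, hv0⟩ := hf (Ideal.Quotient.mk I (-b))
  have hv0' : (v0 : O) + b ∈ I := by
    have := (Ideal.Quotient.mk_eq_mk_iff_sub_mem _ _).1 hv0
    rwa [sub_neg_eq_add] at this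
  have hcard : Nat.card V = Nat.card (LinearMap.ker f) * Nat.card k ^ idealDeg k I := by
    rw [Submodule.card_eq_card_quotient_mul_card (LinearMap.ker f),
      Nat.card_congr (f.quotKerEquivOfSurjective hf).toEquiv, Module.natCard_eq_pow_finrank (K := k) (V := O ⧸ I),
      idealDeg]
  have h1 : (finite_orderFil ι hΔ (M - 2)).toFinset.card = Nat.card V := by
    rw [← Nat.card_eq_finsetCard]
    exact Nat.card_congr (Equiv.subtypeEquivRight fun z => (finite_orderFil ι hΔ (M - 2)).mem_toFinset)
  have hmem : ∀ z : V, z ∈ LinearMap.ker f ↔ (z : O) ∈ I := fun z =>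
    Ideal.Quotient.eq_zero_iff_mem
  have h2 : ((finite_orderFil ι hΔ (M - 2)).toFinset.filter fun v => b + v ∈ I).card =
      Nat.card (LinearMap.ker f) := by
    rw [← Nat.card_eq_finsetCard]
    refine Nat.card_congr
      { toFun := fun z => ⟨⟨z.1, (finite_orderFil ι hΔ (M - 2)).mem_toFinset.1
          (Finset.mem_filter.1 z.2).1⟩ - v0, (hmem _).2 ?_⟩
        invFun := fun z => ⟨(z.1 + v0 : V), Finset.mem_filter.2
          ⟨(finite_orderFil ι hΔ (M - 2)).mem_toFinset.2 (z.1 + v0).2, ?_⟩⟩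
        left_inv := fun z => by simp
        right_inv := fun z => by ext; simp }
    · have := I.sub_mem (Finset.mem_filter.1 z.2).2 hv0'
      have h3 : b + (z : O) - (v0 + b) = z - v0 := by ring
      rw [h3] at this
      simpa using this
    · have := I.add_mem ((hmem _).1 z.2) hv0'
      simpa [add_comm, add_assoc, add_left_comm] using this
  rw [h1, h2, hcard]

open Classical in
/-- The functional equation of the `L`-series, in a form twisted by `t`. -/
theorem idealCoeff_functional (ψ : AddChar k ℂ) (hd0 : 0 < d) (hW : WD 1 Φ d) {M n n' : ℕ}
    (hn : n + 2 * d ^ 2 ≤ d * M) (hn' : n' + 2 * d ^ 2 ≤ d * M) (hnn' : n + n' = d * M) (t : k) :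
    idealCoeff ψ (algebraMap k[X] O X) n * (Nat.card k : ℂ) ^ n' =
      ψ (-(d * t)) * (starRingEnd ℂ) (idealCoeff ψ (algebraMap k[X] O X) n') *
        (Nat.card k : ℂ) ^ n := by
  have hM : 2 ≤ M := by
    have h1 : 4 * d * d ≤ M * d := by nlinarith
    have := Nat.le_of_mul_le_mul_right h1 hd0
    omega
  set x : O := algebraMap k[X] O X with hx
  set VF := (finite_orderFil ι hΔ (M - 2)).toFinset with hVF
  set q : ℂ := (Nat.card k : ℂ) with hq
  have hq0 : q ≠ 0 := by rw [hq]; exact_mod_cast Nat.card_pos.ne'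
  set b : O := algebraMap k[X] O (X ^ M + C t * X ^ (M - 1)) with hb
  set D : ℕ → Finset (Ideal O) := fun n => (idealsDegLE k O n).filter fun I => idealDeg k I = n with hD
  have hmemD : ∀ n I, I ∈ D n ↔ I ≠ ⊥ ∧ idealDeg k I = n := by
    intro n I
    simp only [hD, Finset.mem_filter, mem_idealsDegLE]
    exact ⟨fun h => ⟨h.1.1, h.2⟩, fun h => ⟨⟨h.1, h.2.le⟩, h.2⟩⟩
  have hVFpos : (VF.card : ℂ) ≠ 0 := by
    have : (0 : O) ∈ VF := (finite_orderFil ι hΔ (M - 2)).mem_toFinset.2 (Submodule.zero_mem _)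
    exact_mod_cast (Finset.card_pos.2 ⟨0, this⟩).ne'
  -- the count over ideals
  have side : ∀ (g : Ideal O → ℂ) (n : ℕ), n + 2 * d ^ 2 ≤ d * M →
      (∑ v ∈ VF, ∑ I ∈ (D n).filter (fun I => b + v ∈ I), g I) * q ^ n =
        (∑ I ∈ D n, g I) * VF.card := by
    intro g n hn
    simp_rw [Finset.sum_filter]
    rw [Finset.sum_comm, Finset.sum_mul, Finset.sum_mul]
    refine Finset.sum_congr rfl fun I hI => ?_
    obtain ⟨hI0, hIn⟩ := (hmemD n I).1 hI
    have h1 := card_filter_orderFil_mul hΦ hd hι hΔ hO hd0 hW hI0 (M := M) (by omega) b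
    rw [← Finset.sum_filter, Finset.sum_const, nsmul_eq_mul, ← hVF] at *
    rw [← h1, hIn]
    push_cast
    ring
  -- the complementary ideal
  have inner : ∀ v ∈ VF, ∑ I ∈ (D n).filter (fun I => b + v ∈ I), idealChar ψ x I =
      ψ (-(d * t)) * ∑ J ∈ (D n').filter (fun I => b + v ∈ I), (starRingEnd ℂ) (idealChar ψ x J) := by
    intro v hv
    obtain ⟨P, hP, hPv⟩ := (finite_orderFil ι hΔ (M - 2)).mem_toFinset.1 hv
    obtain ⟨hN1, hN2, hN3⟩ := norm_monic_and_nextCoeff hΦ hd hι hΔ hO hd0 hW hM t hP hPv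
    have hb0 : b + v ≠ 0 := by
      intro h0
      rw [← hb, h0] at hN1
      have : Algebra.norm k[X] (0 : O) = 0 := Algebra.norm_zero
      rw [this] at hN1
      exact not_monic_zero hN1
    set B : Ideal O := Ideal.span {b + v} with hB
    have hB0 : B ≠ ⊥ := by rwa [hB, Ne, Ideal.span_singleton_eq_bot]
    have hBdeg : idealDeg k B = d * M := by
      rw [← hN2, idealDeg]
      exact finrank_quotient_span_eq_natDegree_norm (Module.Free.chooseBasis k[X] O) hb0
    have hBchar : idealChar ψ x B = ψ (-(d * t)) := by
      rw [idealChar, hB, hx, trace_quotient_span_eq_neg_nextCoeff_norm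
        (Module.Free.chooseBasis k[X] O) hb0 hN1, hN3]
    have hquot : ∀ m m', m + m' = d * M → ∀ I ∈ (D m).filter (fun I => b + v ∈ I),
        ∃ J ∈ (D m').filter (fun I => b + v ∈ I), I * J = B := by
      intro m m' hm I hI
      obtain ⟨hI1, hI2⟩ := Finset.mem_filter.1 hI
      obtain ⟨hI0, hIn⟩ := (hmemD m I).1 hI1
      obtain ⟨J, hJ⟩ := Ideal.dvd_iff_le.2 ((Ideal.span_singleton_le_iff_mem I).2 hI2)
      have hJ0 : J ≠ ⊥ := by
        rintro rfl
        apply hB0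
        rw [hB, hJ, Ideal.mul_bot]
      refine ⟨J, Finset.mem_filter.2 ⟨(hmemD m' J).2 ⟨hJ0, ?_⟩, ?_⟩, hJ.symm⟩
      · have h1 := idealDeg_mul (k := k) hI0 hJ0
        rw [← hJ, ← hB, hBdeg] at h1
        omega
      · exact (Ideal.span_singleton_le_iff_mem J).1 (Ideal.dvd_iff_le.1 ⟨I, by rw [hJ, mul_comm]⟩)
    rw [Finset.mul_sum]
    choose! g hg1 hg2 using hquot n n' hnn'
    refine Finset.sum_bij (fun I _ => g I) (fun I hI => hg1 I hI) ?_ ?_ ?_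
    · intro I hI J hJ hIJ
      have h1 := hg2 I hI
      rw [hIJ, ← hg2 J hJ] at h1
      exact mul_right_cancel₀ ((hmemD _ _).1 (Finset.mem_filter.1 (hg1 J hJ)).1).1 h1
    · intro J hJ
      obtain ⟨I, hI, hIJ⟩ := hquot n' n (by omega) J hJ
      refine ⟨I, hI, ?_⟩
      have h1 := hg2 I hI
      rw [← hIJ, mul_comm J I] at h1
      exact mul_left_cancel₀ ((hmemD _ _).1 (Finset.mem_filter.1 hI).1).1 h1
    · intro I hI
      have hI0 := ((hmemD _ _).1 (Finset.mem_filter.1 hI).1).1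
      have hJ0 := ((hmemD _ _).1 (Finset.mem_filter.1 (hg1 I hI)).1).1
      have h1 := idealChar_mul ψ x hI0 hJ0
      rw [hg2 I hI, hBchar] at h1
      rw [h1, mul_assoc]
      have h2 : idealChar ψ x (g I) * (starRingEnd ℂ) (idealChar ψ x (g I)) = 1 := by
        rw [idealChar, ← AddChar.map_neg_eq_conj, ← AddChar.map_add_eq_mul, add_neg_cancel,
          AddChar.map_zero_eq_one]
      rw [h2, mul_one]
  have h1 := side (idealChar ψ x) n hn
  have h2 := side (fun J => (starRingEnd ℂ) (idealChar ψ x J)) n' hn'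
  rw [Finset.sum_congr rfl inner, ← Finset.mul_sum] at h1
  have h3 : ∀ n, idealCoeff ψ x n = ∑ I ∈ D n, idealChar ψ x I := fun n => rfl
  rw [h3, h3, map_sum]
  apply mul_right_cancel₀ hVFpos
  linear_combination (-q ^ n') * h1 + ψ (-(d * t)) * q ^ n * h2

/-- The `L`-series of a nontrivial character is a polynomial. -/
theorem idealCoeff_eq_zero {ψ : AddChar k ℂ} (hψ : ψ ≠ 1) (hdk : (d : k) ≠ 0) (hW : WD 1 Φ d)
    {n : ℕ} (hn : 2 * d ^ 2 ≤ n) : idealCoeff ψ (algebraMap k[X] O X) n = 0 := by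
  have hd0 : 0 < d := Nat.pos_of_ne_zero (by rintro rfl; simp at hdk)
  have hle : n ≤ d * (n + 2 * d) := by nlinarith
  obtain ⟨n', hn'⟩ := Nat.exists_eq_add_of_le hle
  have h2 : 2 * d ^ 2 ≤ n' := by nlinarith
  obtain ⟨a, ha⟩ := AddChar.ne_one_iff.1 hψ
  have e0 := idealCoeff_functional hΦ hd hι hΔ hO ψ hd0 hW (M := n + 2 * d) (n := n) (n' := n')
    (by omega) (by omega) hn'.symm 0
  have e1 := idealCoeff_functional hΦ hd hι hΔ hO ψ hd0 hW (M := n + 2 * d) (n := n) (n' := n')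
    (by omega) (by omega) hn'.symm (-(a / d))
  have hq0 : (Nat.card k : ℂ) ≠ 0 := by exact_mod_cast Nat.card_pos.ne'
  have h3 : -((d : k) * (-(a / d))) = a := by field_simp
  rw [h3] at e1
  rw [mul_zero, neg_zero, AddChar.map_zero_eq_one, one_mul] at e0
  rw [e0, mul_assoc] at e1
  have h4 : (1 - ψ a) * ((starRingEnd ℂ) (idealCoeff ψ (algebraMap k[X] O X) n') *
      (Nat.card k : ℂ) ^ n) = 0 := by linear_combination e1
  rcases mul_eq_zero.1 h4 with h5 | h5
  · exact absurd (sub_eq_zero.1 h5).symm ha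
  · rw [h5] at e0
    exact (mul_eq_zero.1 e0).resolve_right (pow_ne_zero _ hq0)

theorem idealCoeff_one_add (hd0 : 0 < d) (hW : WD 1 Φ d)
    {n : ℕ} (hn : 2 * d ^ 2 ≤ n) : idealCoeff (1 : AddChar k ℂ) (algebraMap k[X] O X) (n + d) =
      idealCoeff (1 : AddChar k ℂ) (algebraMap k[X] O X) n * (Nat.card k : ℂ) ^ d := by
  have hle : n ≤ d * (n + 2 * d) := by nlinarith
  obtain ⟨n', hn'⟩ := Nat.exists_eq_add_of_le hle
  have h2 : 2 * d ^ 2 ≤ n' := by nlinarith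
  have e0 := idealCoeff_functional hΦ hd hι hΔ hO (1 : AddChar k ℂ) hd0 hW (M := n + 2 * d)
    (n := n) (n' := n') (by omega) (by omega) hn'.symm 0
  have e1 := idealCoeff_functional hΦ hd hι hΔ hO (1 : AddChar k ℂ) hd0 hW (M := n + 2 * d + 1)
    (n := n + d) (n' := n') (by rw [mul_add]; omega) (by rw [mul_add]; omega)
    (by rw [mul_add]; omega) 0
  have hq0 : (Nat.card k : ℂ) ^ n' ≠ 0 := pow_ne_zero _ (by exact_mod_cast Nat.card_pos.ne')
  apply mul_right_cancel₀ hq0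
  linear_combination e1 - (Nat.card k : ℂ) ^ d * e0
end Order

end

section
open Polynomial

section Bounds
variable {k : Type*} [Field k] [Finite k] {O : Type*} [CommRing O] [Algebra k O] [IsDedekindDomain O]
  [Algebra k[X] O] [IsScalarTower k k[X] O] [Module.Finite k[X] O] [Module.Free k[X] O]

theorem derivative_mk_idealCoeff (ψ : AddChar k ℂ) (x : O) :
    PowerSeries.derivative ℂ (PowerSeries.mk (idealCoeff ψ x)) =
      PowerSeries.mk (idealCoeff ψ x) * PowerSeries.mk fun n => idealPowerSum ψ x (n + 1) := by
  ext n
  rw [PowerSeries.coeff_derivative, PowerSeries.coeff_mul, PowerSeries.coeff_mk]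
  have h := mul_idealCoeff_eq_sum ψ x (n + 1)
  push_cast at h
  rw [mul_comm, h]
  refine Finset.sum_nbij' (fun m => (n + 1 - m, m - 1)) (fun z => z.2 + 1) ?_ ?_ ?_ ?_ ?_
  · intro m hm
    rw [Finset.mem_Icc] at hm
    rw [Finset.HasAntidiagonal.mem_antidiagonal]; dsimp only; omega
  · intro z hz
    rw [Finset.HasAntidiagonal.mem_antidiagonal] at hz
    rw [Finset.mem_Icc]; omega
  · intro m hm
    rw [Finset.mem_Icc] at hm
    dsimp only; omega
  · intro z hz
    rw [Finset.HasAntidiagonal.mem_antidiagonal] at hz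
    refine Prod.ext ?_ ?_ <;> dsimp only <;> omega
  · intro m hm
    rw [Finset.mem_Icc] at hm
    rw [PowerSeries.coeff_mk, PowerSeries.coeff_mk, mul_comm]
    dsimp only
    rw [Nat.sub_add_cancel hm.1]

variable {Φ : k[X][X]} {d : ℕ} (hΦ : Φ.Monic) (hd : Φ.natDegree = d)
  {ι : AdjoinRoot Φ →ₐ[k[X]] O} (hι : Function.Injective ι)
  {Δ : k[X]} (hΔ : Δ ≠ 0) (hO : ∀ u : O, ∃ P : k[X][X], Δ • u = ι (AdjoinRoot.mk Φ P))

include hΦ hd hι hΔ hO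

theorem norm_idealPowerSum_one_le {ψ : AddChar k ℂ} (hψ : ψ ≠ 1) (hdk : (d : k) ≠ 0)
    (hW : WD 1 Φ d) {C : ℝ} (hC : 0 ≤ C) (h : ∀ m, m ≠ 0 →
      ‖idealPowerSum ψ (algebraMap k[X] O X) m‖ ≤ C * √(Nat.card k) ^ m) :
    ‖idealPowerSum ψ (algebraMap k[X] O X) 1‖ ≤ 2 * d ^ 2 * √(Nat.card k) := by
  have hq : 0 < √(Nat.card k : ℝ) := Real.sqrt_pos.2 (by exact_mod_cast Nat.card_pos)
  have := norm_constantCoeff_le_of_coeff_eq_zero (derivative_mk_idealCoeff ψ (algebraMap k[X] O X))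
    (by rw [← PowerSeries.coeff_zero_eq_constantCoeff_apply, PowerSeries.coeff_mk, idealCoeff_zero])
    hq hC (fun n => by rw [PowerSeries.coeff_mk]; exact h _ (by omega)) (D := 2 * d ^ 2)
    (fun n hn => by
      rw [PowerSeries.coeff_mk]; exact idealCoeff_eq_zero hΦ hd hι hΔ hO hψ hdk hW hn.le)
  rw [← PowerSeries.coeff_zero_eq_constantCoeff_apply, PowerSeries.coeff_mk, zero_add] at this
  exact_mod_cast this

theorem norm_idealPowerSum_one_sub_le (hd0 : 0 < d)
    (hW : WD 1 Φ d) {C : ℝ} (hC : 0 ≤ C) (h : ∀ m, m ≠ 0 →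
      ‖idealPowerSum (1 : AddChar k ℂ) (algebraMap k[X] O X) m - (Nat.card k : ℂ) ^ m‖ ≤
        C * √(Nat.card k) ^ m) :
    ‖idealPowerSum (1 : AddChar k ℂ) (algebraMap k[X] O X) 1 - Nat.card k‖ ≤
      2 * d ^ 2 * √(Nat.card k) := by
  have hq1 : (1 : ℝ) < Nat.card k := by exact_mod_cast Finite.one_lt_card
  have hq : 0 < √(Nat.card k : ℝ) := Real.sqrt_pos.2 (by linarith)
  have hlt : √(Nat.card k : ℝ) < Nat.card k := by
    rw [Real.sqrt_lt' (by linarith)]; nlinarith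
  have := norm_constantCoeff_sub_le_of_periodic
    (derivative_mk_idealCoeff (1 : AddChar k ℂ) (algebraMap k[X] O X))
    (by rw [← PowerSeries.coeff_zero_eq_constantCoeff_apply, PowerSeries.coeff_mk, idealCoeff_zero])
    hq hlt hC (fun n => by rw [PowerSeries.coeff_mk]; exact_mod_cast h _ (by omega)) hd0
    (D := 2 * d ^ 2)
    (fun n hn => by
      rw [PowerSeries.coeff_mk, PowerSeries.coeff_mk]
      exact_mod_cast idealCoeff_one_add hΦ hd hι hΔ hO hd0 hW hn)
  rw [← PowerSeries.coeff_zero_eq_constantCoeff_apply, PowerSeries.coeff_mk, zero_add] at this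
  exact_mod_cast this
end Bounds

section Homs
variable {k : Type*} [Field k] [Finite k] {O : Type*} [CommRing O] [Algebra k O] [IsDedekindDomain O]
  [Algebra k[X] O] [IsScalarTower k k[X] O] [Module.Finite k[X] O] [Module.Free k[X] O]
  {F : Type*} [Field F] [Algebra k F]

theorem sum_pow_pow_range_mul {R : Type*} [CommSemiring R] {y : R} {q e : ℕ} (hy : y ^ q ^ e = y)
    (r : ℕ) : ∑ i ∈ Finset.range (r * e), y ^ q ^ i = r • ∑ i ∈ Finset.range e, y ^ q ^ i := by
  induction r with
  | zero => simp
  | succ r ih =>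
    rw [succ_nsmul', ← ih, add_mul, one_mul, add_comm (r * e), Finset.sum_range_add]
    congr 1
    exact Finset.sum_congr rfl fun i _ => by rw [pow_add, pow_mul, hy]

theorem exists_finset_algHom_ker_eq [IsAlgClosed F] {P : Ideal O} (hP : P ≠ ⊥) (hP' : P.IsPrime) :
    ∃ Z : Finset (O →ₐ[k] F), (∀ φ, φ ∈ Z ↔ RingHom.ker φ = P) ∧ Z.card = idealDeg k P := by
  classical
  have := finite_quotient_ideal k hP
  have := hP'.isMaximal hP
  let : Field (O ⧸ P) := Ideal.Quotient.field P
  refine ⟨Finset.univ.image fun f : (O ⧸ P) →ₐ[k] F => f.comp (Ideal.Quotient.mkₐ k P), ?_, ?_⟩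
  · intro φ
    simp only [Finset.mem_image, Finset.mem_univ, true_and]
    constructor
    · rintro ⟨f, rfl⟩
      ext u
      rw [RingHom.mem_ker]
      change f (Ideal.Quotient.mk P u) = 0 ↔ _
      rw [map_eq_zero_iff f f.toRingHom.injective, Ideal.Quotient.eq_zero_iff_mem]
    · intro h
      refine ⟨Ideal.Quotient.liftₐ P φ fun a ha => ?_, ?_⟩
      · rwa [← h] at ha
      · ext u; rfl
  · rw [Finset.card_image_of_injective]
    · rw [Finset.card_univ, AlgHom.card]; rfl
    · intro f g hfg
      apply AlgHom.ext
      intro x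
      obtain ⟨u, rfl⟩ := Ideal.Quotient.mk_surjective x
      exact DFunLike.congr_fun hfg u

theorem algebraMap_trace_quotient_eq_sum {P : Ideal O} (hP : P ≠ ⊥) (hP' : P.IsPrime)
    {φ : O →ₐ[k] F} (hφ : RingHom.ker φ = P) (x : O) :
    algebraMap k F (Algebra.trace k (O ⧸ P) (Ideal.Quotient.mk P x)) =
      ∑ i ∈ Finset.range (idealDeg k P), φ x ^ Nat.card k ^ i := by
  have := finite_quotient_ideal k hP
  have := hP'.isMaximal hP
  let : Field (O ⧸ P) := Ideal.Quotient.field P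
  have : Finite (O ⧸ P) := Module.finite_of_finite k
  let f : (O ⧸ P) →ₐ[k] F := Ideal.Quotient.liftₐ P φ fun a ha => by rwa [← hφ] at ha
  have hf : ∀ u, f (Ideal.Quotient.mk P u) = φ u := fun u => rfl
  have h := congrArg f (FiniteField.algebraMap_trace_eq_sum_pow k (O ⧸ P) (Ideal.Quotient.mk P x))
  rw [AlgHom.commutes, map_sum] at h
  rw [h]
  exact Finset.sum_congr rfl fun i _ => by rw [map_pow, hf]

theorem apply_pow_card_pow_eq_iff {P : Ideal O} (hP : P ≠ ⊥) (hP' : P.IsPrime)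
    {φ : O →ₐ[k] F} (hφ : RingHom.ker φ = P) {m : ℕ} :
    (∀ u, φ u ^ Nat.card k ^ m = φ u) ↔ idealDeg k P ∣ m := by
  have := finite_quotient_ideal k hP
  have := hP'.isMaximal hP
  let : Field (O ⧸ P) := Ideal.Quotient.field P
  have : Finite (O ⧸ P) := Module.finite_of_finite k
  have := Fintype.ofFinite k
  let f : (O ⧸ P) →ₐ[k] F := Ideal.Quotient.liftₐ P φ fun a ha => by rwa [← hφ] at ha
  have hf : ∀ u, f (Ideal.Quotient.mk P u) = φ u := fun u => rfl
  have h1 := FiniteField.orderOf_frobeniusAlgHom k (O ⧸ P)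
  change _ = idealDeg k P at h1
  rw [← h1, orderOf_dvd_iff_pow_eq_one, DFunLike.ext_iff]
  have h2 : ∀ u : O, (FiniteField.frobeniusAlgHom k (O ⧸ P) ^ m) (Ideal.Quotient.mk P u) =
      Ideal.Quotient.mk P u ^ Nat.card k ^ m := by
    intro u
    rw [AlgHom.coe_pow, FiniteField.coe_frobeniusAlgHom, pow_iterate, Nat.card_eq_fintype_card]
  constructor
  · intro h x
    obtain ⟨u, rfl⟩ := Ideal.Quotient.mk_surjective x
    rw [h2]
    apply f.toRingHom.injective
    change f _ = f _
    rw [map_pow, hf, h u]; rfl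
  · intro h u
    have := h (Ideal.Quotient.mk P u)
    rw [h2] at this
    rw [← hf, ← map_pow, this]; rfl

open Classical in
/-- The power sums of the `L`-series as sums over homomorphisms. -/
theorem exists_finset_idealPowerSum_eq [IsAlgClosed F] {m : ℕ} (hm : m ≠ 0) :
    ∃ H : Finset (O →ₐ[k] F), (∀ φ : O →ₐ[k] F, φ ∈ H ↔ ∀ u, φ u ^ Nat.card k ^ m = φ u) ∧
      (∀ f : O, f ≠ 0 → (H.filter fun φ => φ f = 0).card ≤ idealDeg k (Ideal.span {f})) ∧
      ∀ (ψ : AddChar k ℂ) (x : O) (t : (O →ₐ[k] F) → k), (∀ φ ∈ H,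
        algebraMap k F (t φ) = ∑ i ∈ Finset.range m, φ x ^ Nat.card k ^ i) →
        idealPowerSum ψ x m = ∑ φ ∈ H, ψ (t φ) := by
  set D := (idealsDegLE k O m).filter fun P => P.IsPrime ∧ idealDeg k P ∣ m with hD
  have hmemD : ∀ P : Ideal O, P ∈ D ↔ P ≠ ⊥ ∧ P.IsPrime ∧ idealDeg k P ∣ m := by
    intro P
    rw [hD, Finset.mem_filter, mem_idealsDegLE]
    exact ⟨fun h => ⟨h.1.1, h.2⟩, fun h => ⟨⟨h.1, Nat.le_of_dvd (Nat.pos_of_ne_zero hm) h.2.2⟩, h.2⟩⟩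
  have hZ : ∀ P : Ideal O, ∃ Z : Finset (O →ₐ[k] F), P ∈ D →
      (∀ φ, φ ∈ Z ↔ RingHom.ker φ = P) ∧ Z.card = idealDeg k P := by
    intro P
    by_cases hP : P ∈ D
    · obtain ⟨Z, h⟩ := exists_finset_algHom_ker_eq (k := k) (F := F) ((hmemD P).1 hP).1 ((hmemD P).1 hP).2.1
      exact ⟨Z, fun _ => h⟩
    · exact ⟨∅, fun h => absurd h hP⟩
  choose Z hZ using hZ
  have hdisj : Set.PairwiseDisjoint (D : Set (Ideal O)) Z := by
    intro P hP Q hQ hPQ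
    rw [Function.onFun, Finset.disjoint_left]
    intro φ h1 h2
    exact hPQ ((((hZ P hP).1 φ).1 h1).symm.trans (((hZ Q hQ).1 φ).1 h2))
  refine ⟨D.biUnion Z, ?_, ?_, ?_⟩
  · intro φ
    rw [Finset.mem_biUnion]
    constructor
    · rintro ⟨P, hP, hφ⟩
      obtain ⟨h1, h2, h3⟩ := (hmemD P).1 hP
      exact (apply_pow_card_pow_eq_iff h1 h2 (((hZ P hP).1 φ).1 hφ)).2 h3
    · intro h
      have hprime : (RingHom.ker φ).IsPrime := RingHom.ker_isPrime φ.toRingHom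
      have hbot : RingHom.ker φ ≠ ⊥ := by
        intro h0
        have h1 : (X ^ Nat.card k ^ m - X : k[X]) = 0 := by
          have h2 : algebraMap k[X] O (X ^ Nat.card k ^ m - X) ∈ RingHom.ker φ := by
            rw [RingHom.mem_ker, map_sub, map_sub, map_pow, map_pow, h, sub_self]
          rw [h0, Ideal.mem_bot] at h2
          exact (map_eq_zero_iff _ (FaithfulSMul.algebraMap_injective k[X] O)).1 h2
        exact FiniteField.X_pow_card_sub_X_ne_zero k (Nat.one_lt_pow hm Finite.one_lt_card) h1
      have hD' := (hmemD _).2 ⟨hbot, hprime, (apply_pow_card_pow_eq_iff hbot hprime rfl).1 h⟩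
      exact ⟨_, hD', ((hZ _ hD').1 φ).2 rfl⟩
  · intro f hf
    have hspan : Ideal.span {f} ≠ ⊥ := by rwa [Ne, Ideal.span_singleton_eq_bot]
    set D' := D.filter fun P => f ∈ P with hD'
    have h1 : (D.biUnion Z).filter (fun φ => φ f = 0) ⊆ D'.biUnion Z := by
      intro φ hφ
      obtain ⟨h2, h3⟩ := Finset.mem_filter.1 hφ
      obtain ⟨P, hP, h4⟩ := Finset.mem_biUnion.1 h2
      refine Finset.mem_biUnion.2 ⟨P, Finset.mem_filter.2 ⟨hP, ?_⟩, h4⟩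
      rw [← ((hZ P hP).1 φ).1 h4]; exact h3
    refine (Finset.card_le_card h1).trans (Finset.card_biUnion_le.trans ?_)
    rw [Finset.sum_congr rfl fun P hP => (hZ P (Finset.mem_filter.1 hP).1).2]
    have h2 : ∏ P ∈ D', P ∣ Ideal.span {f} := by
      refine Finset.prod_primes_dvd _ (fun P hP => ?_) fun P hP => ?_
      · obtain ⟨h3, h4, -⟩ := (hmemD P).1 (Finset.mem_filter.1 hP).1
        exact Ideal.prime_of_isPrime h3 h4
      · exact Ideal.dvd_iff_le.2 ((Ideal.span_singleton_le_iff_mem P).2 (Finset.mem_filter.1 hP).2)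
    have h3 : ∀ S ⊆ D', (∏ P ∈ S, P) ≠ ⊥ ∧ idealDeg k (∏ P ∈ S, P) = ∑ P ∈ S, idealDeg k P := by
      intro S
      induction S using Finset.induction_on with
      | empty =>
        intro _
        rw [Finset.prod_empty, Finset.sum_empty, Ideal.one_eq_top]
        exact ⟨top_ne_bot, idealDeg_top⟩
      | insert P S hPS ih =>
        intro hS
        obtain ⟨h3, h4⟩ := ih ((Finset.subset_insert _ _).trans hS)
        have h5 := ((hmemD P).1 (Finset.mem_filter.1 (hS (Finset.mem_insert_self _ _))).1).1
        rw [Finset.prod_insert hPS, Finset.sum_insert hPS, idealDeg_mul h5 h3, h4]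
        exact ⟨mul_ne_zero h5 h3, rfl⟩
    obtain ⟨J, hJ⟩ := h2
    have hJ0 : J ≠ ⊥ := by
      rintro rfl
      rw [Ideal.mul_bot] at hJ
      exact hspan hJ
    rw [hJ, idealDeg_mul (h3 D' subset_rfl).1 hJ0, (h3 D' subset_rfl).2]
    exact Nat.le_add_right _ _
  · intro ψ x t ht
    rw [Finset.sum_biUnion hdisj, idealPowerSum, hD, ← Finset.filter_filter]
    rw [Finset.sum_filter (p := fun P => idealDeg k P ∣ m)]
    refine Finset.sum_congr rfl fun P hP => ?_
    obtain ⟨hP1, hP'⟩ := Finset.mem_filter.1 hP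
    have hP0 : P ≠ ⊥ := (mem_idealsDegLE.1 hP1).1
    split_ifs with hdvd
    · have hPD : P ∈ D := (hmemD P).2 ⟨hP0, hP', hdvd⟩
      obtain ⟨r, hr⟩ := hdvd
      have hr0 : r ≠ 0 := by rintro rfl; exact hm (by simpa using hr)
      have he : 0 < idealDeg k P := idealDeg_pos hP0 hP'
      rw [Finset.sum_eq_single_of_mem r (Finset.mem_Icc.2 ⟨by omega, by rw [hr]; nlinarith⟩)
        fun r' _ hr' => if_neg fun h => hr' (Nat.eq_of_mul_eq_mul_right he (by rw [h, hr, mul_comm])),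
        if_pos (by rw [hr, mul_comm])]
      have hval : ∀ φ ∈ Z P, ψ (t φ) = idealChar ψ x P ^ r := by
        intro φ hφ
        have hker := ((hZ P hPD).1 φ).1 hφ
        have h1 := ht φ (Finset.mem_biUnion.2 ⟨P, hPD, hφ⟩)
        have h2 : t φ = r • Algebra.trace k (O ⧸ P) (Ideal.Quotient.mk P x) := by
          apply (algebraMap k F).injective
          rw [h1, map_nsmul, algebraMap_trace_quotient_eq_sum hP0 hP' hker x, hr, mul_comm]
          have hfix := (apply_pow_card_pow_eq_iff hP0 hP' hker).2 dvd_rfl x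
          exact sum_pow_pow_range_mul hfix r
        rw [h2, AddChar.map_nsmul_eq_pow]
        rfl
      rw [Finset.sum_congr rfl hval, Finset.sum_const, (hZ P hPD).2, nsmul_eq_mul]
    · refine Finset.sum_eq_zero fun r _ => if_neg fun h => hdvd ⟨r, by rw [← h, mul_comm]⟩
end Homs

end

section
open Polynomial

section EvalHom
variable {k : Type*} [Field k] {F : Type*} [Field F] [Algebra k F]

/-- The base change of a bivariate polynomial. -/
noncomputable def biMap (k F : Type*) [Field k] [Field F] [Algebra k F] : k[X][X] →+* F[X][X] :=
  mapRingHom (mapRingHom (algebraMap k F))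

/-- Evaluation of a bivariate polynomial at a point with coordinates in an extension field. -/
noncomputable def evalHom (k : Type*) {F : Type*} [Field k] [Field F] [Algebra k F] (x y : F) :
    k[X][X] →+* F :=
  (evalEvalRingHom x y).comp (biMap k F)

theorem evalHom_apply (x y : F) (P : k[X][X]) :
    evalHom k x y P = (biMap k F P).evalEval x y := rfl

theorem evalHom_C (x y : F) (P : k[X]) : evalHom k x y (C P) = aeval x P := by
  simp [evalHom, biMap, aeval_def, eval_map]

theorem evalHom_X (x y : F) : evalHom k x y X = y := by
  simp [evalHom, biMap]

theorem eq_evalHom {g : k[X][X] →+* F} {x y : F} (h0 : ∀ a, g (C (C a)) = algebraMap k F a)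
    (h1 : g (C X) = x) (h2 : g X = y) : g = evalHom k x y := by
  refine Polynomial.ringHom_ext' (Polynomial.ringHom_ext' ?_ ?_) ?_
  · ext a
    change g (C (C a)) = evalHom k x y (C (C a))
    rw [h0, evalHom_C, aeval_C]
  · change g (C X) = evalHom k x y (C X)
    rw [h1, evalHom_C, aeval_X]
  · rw [h2, evalHom_X]

theorem evalHom_pow_pow {p : ℕ} [Fact p.Prime] [Algebra (ZMod p) F] (x y : F) (m : ℕ)
    (P : (ZMod p)[X][X]) :
    evalHom (ZMod p) (x ^ p ^ m) (y ^ p ^ m) P = evalHom (ZMod p) x y P ^ p ^ m := by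
  have : CharP F p := charP_of_injective_algebraMap (algebraMap (ZMod p) F).injective p
  have h : (iterateFrobenius F p m).comp (evalHom (ZMod p) x y) =
      evalHom (ZMod p) (x ^ p ^ m) (y ^ p ^ m) := by
    refine eq_evalHom (fun a => ?_) ?_ ?_
    · rw [RingHom.comp_apply, evalHom_C, aeval_C, iterateFrobenius_def, ← map_pow,
        ZMod.pow_card_pow]
    · rw [RingHom.comp_apply, evalHom_C, aeval_X, iterateFrobenius_def]
    · rw [RingHom.comp_apply, evalHom_X, iterateFrobenius_def]
  rw [← h, RingHom.comp_apply, iterateFrobenius_def]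

theorem biMap_monic {Φ : k[X][X]} (hΦ : Φ.Monic) : (biMap k F Φ).Monic := hΦ.map _

theorem natDegree_biMap {Φ : k[X][X]} (hΦ : Φ.Monic) : (biMap k F Φ).natDegree = Φ.natDegree :=
  hΦ.natDegree_map _

theorem WD.biMap {w m : ℕ} {P : k[X][X]} (h : WD w P m) : WD w (biMap k F P) m := by
  intro i hi
  have hc : (_root_.biMap k F P).coeff i = (P.coeff i).map (algebraMap k F) := by
    simp [_root_.biMap]
  rw [hc] at hi ⊢
  rw [natDegree_map]
  refine h i fun h0 => hi ?_
  rw [h0, Polynomial.map_zero]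
end EvalHom

section Points
variable {k : Type*} [Field k] {O : Type*} [CommRing O] [Algebra k O]
  [Algebra k[X] O] [IsScalarTower k k[X] O] 
  {F : Type*} [Field F] [Algebra k F] {Φ : k[X][X]} (ι : AdjoinRoot Φ →ₐ[k[X]] O)

/-- The point of the curve attached to a homomorphism from an order in its function field. -/
noncomputable def homPoint (φ : O →ₐ[k] F) : F × F :=
  (φ (algebraMap k[X] O X), φ (ι (AdjoinRoot.root Φ)))

theorem apply_algebraMap_eq_aeval (φ : O →ₐ[k] F) (P : k[X]) :
    φ (algebraMap k[X] O P) = aeval (homPoint ι φ).1 P := by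
  have : φ.comp (IsScalarTower.toAlgHom k k[X] O) = aeval (homPoint ι φ).1 :=
    Polynomial.algHom_ext (by simp [homPoint])
  exact DFunLike.congr_fun this P

theorem apply_mk_eq_evalHom (φ : O →ₐ[k] F) (P : k[X][X]) :
    φ (ι (AdjoinRoot.mk Φ P)) = evalHom k (homPoint ι φ).1 (homPoint ι φ).2 P := by
  have : (φ.toRingHom.comp ι.toRingHom).comp (AdjoinRoot.mk Φ) =
      evalHom k (homPoint ι φ).1 (homPoint ι φ).2 := by
    have hC : ∀ a : k[X], φ (ι (AdjoinRoot.mk Φ (C a))) = aeval (homPoint ι φ).1 a := fun a => by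
      rw [AdjoinRoot.mk_C, ← AdjoinRoot.algebraMap_eq, AlgHom.commutes, apply_algebraMap_eq_aeval ι]
    refine eq_evalHom (fun a => ?_) ?_ ?_
    · exact (hC (C a)).trans (aeval_C _ _)
    · exact (hC X).trans (aeval_X _)
    · change φ (ι (AdjoinRoot.mk Φ X)) = _
      rw [AdjoinRoot.mk_X]; rfl
  exact DFunLike.congr_fun this P

theorem homPoint_mem {φ : O →ₐ[k] F} : evalHom k (homPoint ι φ).1 (homPoint ι φ).2 Φ = 0 := by
  rw [← apply_mk_eq_evalHom, AdjoinRoot.mk_self, map_zero, map_zero]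

variable {ι} {Δ : k[X]} (hO : ∀ u : O, ∃ P : k[X][X], Δ • u = ι (AdjoinRoot.mk Φ P))

include hO

theorem homPoint_injOn {φ₁ φ₂ : O →ₐ[k] F} (h : homPoint ι φ₁ = homPoint ι φ₂)
    (hφ : aeval (homPoint ι φ₁).1 Δ ≠ 0) : φ₁ = φ₂ := by
  ext u
  obtain ⟨P, hP⟩ := hO u
  rw [Algebra.smul_def] at hP
  have h1 := congrArg φ₁ hP
  have h2 := congrArg φ₂ hP
  rw [map_mul, apply_algebraMap_eq_aeval ι, apply_mk_eq_evalHom] at h1 h2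
  rw [← h, ← h1] at h2
  exact (mul_left_cancel₀ hφ h2).symm

theorem exists_homPoint_eq (hι : Function.Injective ι) {x y : F} (hxy : evalHom k x y Φ = 0)
    (hΔ : aeval x Δ ≠ 0) : ∃ φ : O →ₐ[k] F, homPoint ι φ = (x, y) ∧
      ∀ u, ∃ P : k[X][X], φ u = evalHom k x y P / aeval x Δ := by
  choose P hP using hO
  have hker : ∀ A B : k[X][X], ι (AdjoinRoot.mk Φ A) = ι (AdjoinRoot.mk Φ B) →
      evalHom k x y A = evalHom k x y B := by
    intro A B h
    obtain ⟨Q, hQ⟩ := AdjoinRoot.mk_eq_mk.1 (hι h)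
    rw [← sub_eq_zero, ← map_sub, hQ, map_mul, hxy, zero_mul]
  have hC : ∀ A B : k[X][X], ∀ u, ι (AdjoinRoot.mk Φ A) = ι (AdjoinRoot.mk Φ B) * u →
      evalHom k x y A * aeval x Δ = evalHom k x y B * evalHom k x y (P u) := by
    intro A B u h
    rw [← evalHom_C x y Δ, ← map_mul, ← map_mul]
    refine hker _ _ ?_
    rw [map_mul, map_mul, h, map_mul, map_mul, ← hP, AdjoinRoot.mk_C, ← AdjoinRoot.algebraMap_eq,
      AlgHom.commutes, Algebra.smul_def]
    ring
  have hΔι : ι (AdjoinRoot.mk Φ (C Δ)) = algebraMap k[X] O Δ := by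
    rw [AdjoinRoot.mk_C, ← AdjoinRoot.algebraMap_eq, AlgHom.commutes]
  have hval : ∀ A u, ι (AdjoinRoot.mk Φ A) = u → evalHom k x y (P u) / aeval x Δ = evalHom k x y A := by
    intro A u h
    rw [div_eq_iff hΔ]
    have := hC A 1 u (by rw [map_one, map_one, one_mul, h])
    rw [this, map_one, one_mul]
  let φ : O →ₐ[k] F :=
    { toFun := fun u => evalHom k x y (P u) / aeval x Δ
      map_one' := by
        rw [hval 1 1 (by rw [map_one, map_one]), map_one]
      map_zero' := by
        rw [hval 0 0 (by rw [map_zero, map_zero]), map_zero]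
      map_add' := fun u v => by
        rw [← add_div, ← map_add, hker _ (P u + P v)]
        rw [map_add, map_add, ← hP, ← hP, ← hP, smul_add]
      map_mul' := fun u v => by
        rw [div_mul_div_comm, div_eq_div_iff hΔ (mul_ne_zero hΔ hΔ), ← evalHom_C x y Δ]
        simp only [← map_mul (evalHom k x y)]
        refine hker _ _ ?_
        simp only [map_mul, ← hP, hΔι, Algebra.smul_def]
        ring
      commutes' := fun a => by
        rw [hval (C (C a)), evalHom_C, aeval_C]
        rw [AdjoinRoot.mk_C, ← AdjoinRoot.algebraMap_eq, AlgHom.commutes,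
          IsScalarTower.algebraMap_apply k k[X] O]; rfl }
  have hφ : ∀ A, φ (ι (AdjoinRoot.mk Φ A)) = evalHom k x y A := fun A => hval A _ rfl
  refine ⟨φ, Prod.ext ?_ ?_, fun u => ⟨P u, rfl⟩⟩
  · have := hφ (C X)
    rw [evalHom_C, aeval_X, AdjoinRoot.mk_C, ← AdjoinRoot.algebraMap_eq, AlgHom.commutes] at this
    exact this
  · have := hφ X
    rw [evalHom_X, AdjoinRoot.mk_X] at this
    exact this
end Points

theorem norm_sum_addChar_le_card {G T : Type*} [AddCommGroup G] [Finite G] (ψ : AddChar G ℂ)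
    (S : Finset T) (g : T → G) : ‖∑ z ∈ S, ψ (g z)‖ ≤ S.card := by
  refine (norm_sum_le _ _).trans ?_
  rw [Finset.sum_congr rfl fun z _ => AddChar.norm_apply ψ (g z)]
  simp

section Compare
variable {p : ℕ} [Fact p.Prime] {O : Type*} [CommRing O] [Algebra (ZMod p) O] [IsDedekindDomain O]
  [Algebra (ZMod p)[X] O] [IsScalarTower (ZMod p) (ZMod p)[X] O] [Module.Finite (ZMod p)[X] O]
  [Module.Free (ZMod p)[X] O] {F : Type*} [Field F] [Algebra (ZMod p) F] [IsAlgClosed F]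
  {Φ : (ZMod p)[X][X]} {d : ℕ} (hΦ : Φ.Monic) (hd : Φ.natDegree = d)
  {ι : AdjoinRoot Φ →ₐ[(ZMod p)[X]] O} (hι : Function.Injective ι)
  {Δ : (ZMod p)[X]} (hΔ : Δ ≠ 0) (hO : ∀ u : O, ∃ P : (ZMod p)[X][X], Δ • u = ι (AdjoinRoot.mk Φ P))

include hΦ hd hι hΔ hO

theorem norm_idealPowerSum_sub_sum_affinePts_le (hd0 : 0 < d) (hW : WD 1 Φ d)
    (hirr : Irreducible (biMap (ZMod p) F Φ)) {m : ℕ} (hm : m ≠ 0)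
    (t : F × F → ZMod p) (ht : ∀ z ∈ affinePts (biMap (ZMod p) F Φ) (p ^ m),
      ((t z).cast : F) = ∑ i ∈ Finset.range m, z.1 ^ p ^ i) (ψ : AddChar (ZMod p) ℂ) :
    ‖idealPowerSum ψ (algebraMap (ZMod p)[X] O X) m -
      ∑ z ∈ affinePts (biMap (ZMod p) F Φ) (p ^ m), ψ (t z)‖ ≤ 2 * d * Δ.natDegree := by
  classical
  have hcast : ∀ a : ZMod p, (a.cast : F) = algebraMap (ZMod p) F a := by
    intro a
    have : CharP F p := charP_of_injective_algebraMap (algebraMap (ZMod p) F).injective p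
    exact DFunLike.congr_fun (Subsingleton.elim (ZMod.castHom (dvd_refl p) F)
      (algebraMap (ZMod p) F)) a
  have hq : 1 < p ^ m := Nat.one_lt_pow hm (Fact.out : p.Prime).one_lt
  obtain ⟨H, hH, hbad, hsum⟩ := exists_finset_idealPowerSum_eq (k := ZMod p) (O := O) (F := F) hm
  rw [Nat.card_zmod] at hH
  set A := affinePts (biMap (ZMod p) F Φ) (p ^ m) with hA
  have hmem : ∀ φ ∈ H, homPoint ι φ ∈ A := by
    intro φ hφ
    rw [hA, mem_affinePts hq]
    exact ⟨(hH φ).1 hφ _, (hH φ).1 hφ _, homPoint_mem ι⟩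
  rw [hsum ψ _ (fun φ => t (homPoint ι φ)) fun φ hφ => by
    rw [← hcast, ht _ (hmem φ hφ), Nat.card_zmod]; rfl]
  have hA' : ∀ z, z ∈ A → aeval z.1 Δ ≠ 0 → ∃ φ ∈ H, homPoint ι φ = z := by
    intro z hz hzΔ
    rw [hA, mem_affinePts hq] at hz
    obtain ⟨φ, h1, h2⟩ := exists_homPoint_eq hO hι (x := z.1) (y := z.2) hz.2.2 hzΔ
    refine ⟨φ, (hH φ).2 fun u => ?_, h1⟩
    obtain ⟨P, hP⟩ := h2 u
    rw [hP, div_pow, ← evalHom_C z.1 z.2, ← evalHom_pow_pow, ← evalHom_pow_pow, hz.1, hz.2.1]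
  have hgood : ∑ φ ∈ H with ¬ φ (algebraMap _ O Δ) = 0, ψ (t (homPoint ι φ)) =
      ∑ z ∈ A with ¬ aeval z.1 Δ = 0, ψ (t z) := by
    refine Finset.sum_bij (fun φ _ => homPoint ι φ) ?_ ?_ ?_ fun _ _ => rfl
    · intro φ hφ
      obtain ⟨h1, h2⟩ := Finset.mem_filter.1 hφ
      rw [apply_algebraMap_eq_aeval ι] at h2
      exact Finset.mem_filter.2 ⟨hmem φ h1, h2⟩
    · intro φ₁ h₁ φ₂ h₂ h
      obtain ⟨h1, h2⟩ := Finset.mem_filter.1 h₁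
      rw [apply_algebraMap_eq_aeval ι] at h2
      exact homPoint_injOn hO h h2
    · intro z hz
      obtain ⟨h1, h2⟩ := Finset.mem_filter.1 hz
      obtain ⟨φ, h3, h4⟩ := hA' z h1 h2
      refine ⟨φ, Finset.mem_filter.2 ⟨h3, ?_⟩, h4⟩
      rw [apply_algebraMap_eq_aeval ι, h4]; exact h2
  have hcard1 : (H.filter fun φ => φ (algebraMap _ O Δ) = 0).card ≤ d * Δ.natDegree := by
    have hΔ' : algebraMap (ZMod p)[X] O Δ ≠ 0 := by
      rwa [Ne, map_eq_zero_iff _ (FaithfulSMul.algebraMap_injective (ZMod p)[X] O)]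
    refine (hbad _ hΔ').trans ?_
    rw [idealDeg, finrank_quotient_span_eq_natDegree_norm
      (Module.Free.chooseBasis (ZMod p)[X] O) hΔ', Algebra.norm_algebraMap,
      finrank_eq_of_order hΦ hd hι hΔ hO, natDegree_pow]
  have hcard2 : (A.filter fun z => aeval z.1 Δ = 0).card ≤ d * Δ.natDegree := by
    have hd' : (biMap (ZMod p) F Φ).natDegree = d := (natDegree_biMap hΦ).trans hd
    have h0 : AdjoinRoot.mk (biMap (ZMod p) F Φ) (C (Δ.map (algebraMap (ZMod p) F))) ≠ 0 := by
      rw [Ne, AdjoinRoot.mk_eq_zero]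
      intro hdvd
      have := Polynomial.eq_zero_of_dvd_of_natDegree_lt hdvd (by rw [natDegree_C, hd']; exact hd0)
      rw [C_eq_zero, Polynomial.map_eq_zero] at this
      exact hΔ this
    refine (card_points_le_natDegree_norm (biMap_monic hΦ) hirr h0 _ (fun z hz => ?_)
      fun z hz => ?_).trans (natDegree_norm_mk_le (w := 1) (biMap_monic hΦ) hd'
        (by rw [one_mul]; exact hW.biMap) (WD.C (natDegree_map _).le))
    · have := (Finset.mem_filter.1 hz).1
      rw [hA, mem_affinePts hq] at this
      exact this.2.2
    · have := (Finset.mem_filter.1 hz).2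
      rw [evalEval_C, eval_map, ← aeval_def, this]
  rw [← Finset.sum_filter_add_sum_filter_not H (fun φ => φ (algebraMap _ O Δ) = 0),
    ← Finset.sum_filter_add_sum_filter_not A (fun z => aeval z.1 Δ = 0), hgood,
    add_sub_add_right_eq_sub]
  refine (norm_sub_le _ _).trans ?_
  have e1 := norm_sum_addChar_le_card ψ (H.filter fun φ => φ (algebraMap _ O Δ) = 0)
    fun φ => t (homPoint ι φ)
  have e2 := norm_sum_addChar_le_card ψ (A.filter fun z => aeval z.1 Δ = 0) t
  have e3 : ((H.filter fun φ => φ (algebraMap _ O Δ) = 0).card : ℝ) ≤ d * Δ.natDegree := by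
    exact_mod_cast hcard1
  have e4 : ((A.filter fun z => aeval z.1 Δ = 0).card : ℝ) ≤ d * Δ.natDegree := by
    exact_mod_cast hcard2
  linarith
end Compare

end

section
open Polynomial

section Rational
variable {p : ℕ} [Fact p.Prime] {F : Type*} [Field F] [Algebra (ZMod p) F] [IsAlgClosed F]

theorem zmod_cast_eq_algebraMap (a : ZMod p) : (a.cast : F) = algebraMap (ZMod p) F a := by
  have : CharP F p := charP_of_injective_algebraMap (algebraMap (ZMod p) F).injective p
  exact DFunLike.congr_fun (Subsingleton.elim (ZMod.castHom (dvd_refl p) F)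
    (algebraMap (ZMod p) F)) a

theorem exists_algebraMap_eq_of_pow_eq {x : F} (hx : x ^ p = x) :
    ∃ a : ZMod p, algebraMap (ZMod p) F a = x := by
  classical
  have : CharP F p := charP_of_injective_algebraMap (algebraMap (ZMod p) F).injective p
  have hp := (Fact.out : p.Prime).one_lt
  have h1 : Finset.univ.image (algebraMap (ZMod p) F) ⊆ fixedPts F (p ^ 1) := by
    intro y hy
    obtain ⟨a, -, rfl⟩ := Finset.mem_image.1 hy
    rw [mem_fixedPts (by rwa [pow_one]), pow_one, ← map_pow, ZMod.pow_card]
  have h2 := Finset.eq_of_subset_of_card_le h1 (by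
    rw [card_fixedPts p one_ne_zero, Finset.card_image_of_injective _ (algebraMap (ZMod p) F).injective,
      Finset.card_univ, ZMod.card, pow_one])
  have h3 : x ∈ fixedPts F (p ^ 1) := by rwa [pow_one, mem_fixedPts hp]
  rw [← h2] at h3
  obtain ⟨a, -, h⟩ := Finset.mem_image.1 h3
  exact ⟨a, h⟩

theorem exists_cast_eq_sum_pow {x : F} {m : ℕ} (hx : x ^ p ^ m = x) :
    ∃ a : ZMod p, (a.cast : F) = ∑ i ∈ Finset.range m, x ^ p ^ i := by
  have : CharP F p := charP_of_injective_algebraMap (algebraMap (ZMod p) F).injective p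
  obtain ⟨a, ha⟩ := exists_algebraMap_eq_of_pow_eq (p := p) (x := ∑ i ∈ Finset.range m, x ^ p ^ i) (by
    rw [sum_pow_char]
    have h := (Finset.sum_range_succ (fun i => x ^ p ^ i) m).symm.trans
      (Finset.sum_range_succ' (fun i => x ^ p ^ i) m)
    rw [pow_zero, pow_one, hx] at h
    rw [add_right_cancel h]
    exact Finset.sum_congr rfl fun i _ => by rw [pow_succ, pow_mul])
  exact ⟨a, by rw [zmod_cast_eq_algebraMap, ha]⟩

theorem sum_affinePts_one (Φ : (ZMod p)[X][X]) {t : F × F → ZMod p}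
    (ht : ∀ z ∈ affinePts (biMap (ZMod p) F Φ) (p ^ 1), ((t z).cast : F) =
      ∑ i ∈ Finset.range 1, z.1 ^ p ^ i) {M : Type*} [AddCommMonoid M] (f : ZMod p → M) :
    ∑ z ∈ affinePts (biMap (ZMod p) F Φ) (p ^ 1), f (t z) =
      ∑ z : ZMod p × ZMod p with Φ.evalEval z.1 z.2 = 0, f z.1 := by
  have hp := (Fact.out : p.Prime).one_lt
  have hev : ∀ z : ZMod p × ZMod p, (biMap (ZMod p) F Φ).evalEval (algebraMap _ F z.1)
      (algebraMap _ F z.2) = algebraMap _ F (Φ.evalEval z.1 z.2) := fun z =>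
    map_mapRingHom_evalEval (algebraMap (ZMod p) F) Φ z.1 z.2
  have hmem : ∀ z : ZMod p × ZMod p, Φ.evalEval z.1 z.2 = 0 →
      (algebraMap (ZMod p) F z.1, algebraMap (ZMod p) F z.2) ∈
        affinePts (biMap (ZMod p) F Φ) (p ^ 1) := by
    intro z hz
    rw [mem_affinePts (by rwa [pow_one])]
    refine ⟨?_, ?_, ?_⟩
    · rw [pow_one, ← map_pow, ZMod.pow_card]
    · rw [pow_one, ← map_pow, ZMod.pow_card]
    · rw [hev, hz, map_zero]
  symm
  refine Finset.sum_bij (fun z _ => (algebraMap (ZMod p) F z.1, algebraMap (ZMod p) F z.2))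
    (fun z hz => hmem z (Finset.mem_filter.1 hz).2) ?_ ?_ ?_
  · intro z _ z' _ h
    exact Prod.ext ((algebraMap _ F).injective (Prod.ext_iff.1 h).1)
      ((algebraMap _ F).injective (Prod.ext_iff.1 h).2)
  · intro z hz
    rw [mem_affinePts (by rwa [pow_one]), pow_one] at hz
    obtain ⟨a, ha⟩ := exists_algebraMap_eq_of_pow_eq hz.1
    obtain ⟨b, hb⟩ := exists_algebraMap_eq_of_pow_eq hz.2.1
    refine ⟨(a, b), ?_, Prod.ext ha hb⟩
    rw [Finset.mem_filter]
    refine ⟨Finset.mem_univ _, (algebraMap (ZMod p) F).injective ?_⟩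
    rw [← hev, map_zero, ha, hb]; exact hz.2.2
  · intro z hz
    have := ht _ (hmem z (Finset.mem_filter.1 hz).2)
    rw [Finset.sum_range_one, pow_zero, pow_one, zmod_cast_eq_algebraMap] at this
    rw [(algebraMap (ZMod p) F).injective this]
end Rational

section Weil
variable {p : ℕ} [Fact p.Prime] {O : Type*} [CommRing O] [Algebra (ZMod p) O] [IsDedekindDomain O]
  [Algebra (ZMod p)[X] O] [IsScalarTower (ZMod p) (ZMod p)[X] O] [Module.Finite (ZMod p)[X] O]
  [Module.Free (ZMod p)[X] O] {F : Type} [Field F] [Algebra (ZMod p) F] [IsAlgClosed F]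
  {Φ : (ZMod p)[X][X]} {d : ℕ} (hΦ : Φ.Monic) (hd : Φ.natDegree = d)
  {ι : AdjoinRoot Φ →ₐ[(ZMod p)[X]] O} (hι : Function.Injective ι)
  {Δ : (ZMod p)[X]} (hΔ : Δ ≠ 0) (hO : ∀ u : O, ∃ P : (ZMod p)[X][X], Δ • u = ι (AdjoinRoot.mk Φ P))

include hΦ hd hι hΔ hO

theorem norm_sum_zeros_addChar_le_of_order (hd0 : 0 < d) (hdp : d < p) (hW : WD 1 Φ d)
    (hirr : Irreducible (biMap (ZMod p) F Φ)) (ψ : AddChar (ZMod p) ℂ) :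
    ‖∑ z : ZMod p × ZMod p with Φ.evalEval z.1 z.2 = 0, ψ z.1 - if ψ = 1 then (p : ℂ) else 0‖ ≤
      2 * d ^ 2 * √p + 2 * d * Δ.natDegree := by
  classical
  have : CharP F p := charP_of_injective_algebraMap (algebraMap (ZMod p) F).injective p
  have hp1 : (1 : ℝ) ≤ p := by exact_mod_cast (Fact.out : p.Prime).one_lt.le
  have ht : ∀ m : ℕ, ∃ t : F × F → ZMod p, m ≠ 0 → ∀ z ∈ affinePts (biMap (ZMod p) F Φ) (p ^ m),
      ((t z).cast : F) = ∑ i ∈ Finset.range m, z.1 ^ p ^ i := by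
    intro m
    have : ∀ z : F × F, ∃ a : ZMod p, m ≠ 0 → z ∈ affinePts (biMap (ZMod p) F Φ) (p ^ m) →
        (a.cast : F) = ∑ i ∈ Finset.range m, z.1 ^ p ^ i := by
      intro z
      by_cases h : m ≠ 0 ∧ z ∈ affinePts (biMap (ZMod p) F Φ) (p ^ m)
      · obtain ⟨a, ha⟩ := exists_cast_eq_sum_pow (F := F) ((mem_affinePts
          (Nat.one_lt_pow h.1 (Fact.out : p.Prime).one_lt)).1 h.2).1
        exact ⟨a, fun _ _ => ha⟩
      · exact ⟨0, fun h1 h2 => absurd ⟨h1, h2⟩ h⟩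
    choose t ht using this
    exact ⟨t, fun hm z => ht z hm⟩
  choose t ht using ht
  have hcmp := fun m hm => norm_idealPowerSum_sub_sum_affinePts_le hΦ hd hι hΔ hO hd0 hW hirr hm
    (t m) (ht m hm) ψ
  have hsq : ∀ m : ℕ, √((p : ℝ) ^ m) = √(Nat.card (ZMod p)) ^ m := by
    intro m
    rw [Nat.card_zmod, Real.sqrt_eq_iff_mul_self_eq (by positivity) (by positivity), ← mul_pow,
      Real.mul_self_sqrt (by positivity)]
  have hsq1 : ∀ m : ℕ, 1 ≤ √(Nat.card (ZMod p)) ^ m := by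
    intro m
    rw [← hsq]
    exact Real.one_le_sqrt.2 (one_le_pow₀ hp1)
  have hfrob : ∀ (m : ℕ) (x y : F), x ^ p ^ m = x → (biMap (ZMod p) F Φ).evalEval x y = 0 →
      (biMap (ZMod p) F Φ).evalEval x (y ^ p ^ m) = 0 := by
    intro m x y hx hxy
    have := evalHom_pow_pow x y m Φ
    rw [hx, evalHom_apply, evalHom_apply, hxy, zero_pow (pow_ne_zero m (Fact.out : p.Prime).ne_zero)]
      at this
    exact this
  have hd' : (biMap (ZMod p) F Φ).natDegree = d := (natDegree_biMap hΦ).trans hd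
  have hdk : (d : ZMod p) ≠ 0 := by
    rw [Ne, ZMod.natCast_eq_zero_iff]
    exact fun h => absurd (Nat.le_of_dvd hd0 h) (by omega)
  have h1 := hcmp 1 one_ne_zero
  rw [sum_affinePts_one Φ (ht 1 one_ne_zero) ψ] at h1
  split_ifs with hψ
  · subst hψ
    obtain ⟨C₁, hC₁⟩ := card_affinePts_le p d 1 hd0 hdp
    obtain ⟨C₂, hC₂⟩ := sub_le_card_affinePts p d 1 hd0 hdp
    have h2 := norm_idealPowerSum_one_sub_le hΦ hd hι hΔ hO hd0 hW
      (C := C₁ + C₂ + 2 * d * Δ.natDegree) (by positivity) fun m hm => by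
        have h3 := hcmp m hm
        have h4 := hC₁ (biMap_monic hΦ) hd' hirr (by rw [one_mul]; exact hW.biMap) m hm
        have h5 := hC₂ (biMap_monic hΦ) hd' hirr (by rw [one_mul]; exact hW.biMap) m hm (hfrob m)
        rw [hsq] at h4 h5
        simp only [AddChar.one_apply, Finset.sum_const, nsmul_eq_mul, mul_one] at h3
        have h6 : ‖((affinePts (biMap (ZMod p) F Φ) (p ^ m)).card : ℂ) - (Nat.card (ZMod p) : ℂ) ^ m‖ ≤
            (C₁ + C₂) * √(Nat.card (ZMod p)) ^ m := by
          rw [Nat.card_zmod]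
          rw [Nat.card_zmod] at h4 h5
          have : (((affinePts (biMap (ZMod p) F Φ) (p ^ m)).card : ℂ) - (p : ℂ) ^ m) =
              (((affinePts (biMap (ZMod p) F Φ) (p ^ m)).card - (p : ℝ) ^ m : ℝ) : ℂ) := by
            push_cast; rfl
          rw [this, Complex.norm_real, Real.norm_eq_abs, abs_le]
          have : 0 ≤ √(p : ℝ) ^ m := by positivity
          constructor <;> nlinarith
        have h7 := hsq1 m
        have h8 : (0 : ℝ) ≤ 2 * d * Δ.natDegree := by positivity
        refine (norm_sub_le_norm_sub_add_norm_sub _ _ _).trans ((add_le_add h3 h6).trans ?_)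
        nlinarith
    rw [Nat.card_zmod] at h2
    rw [← norm_neg, neg_sub] at h1
    refine (norm_sub_le_norm_sub_add_norm_sub _ _ _).trans ((add_le_add h1 h2).trans ?_)
    linarith
  · obtain ⟨C, hC⟩ := norm_sum_addChar_affinePts_le p d hd0 hdp
    have h2 := norm_idealPowerSum_one_le hΦ hd hι hΔ hO hψ hdk hW
      (C := C + 2 * d * Δ.natDegree) (by positivity) fun m hm => by
        have h3 := hcmp m hm
        have h4 := hC (biMap_monic hΦ) hd' hirr hW.biMap m hm (hfrob m) (t m) (ht m hm) ψ hψ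
        rw [hsq] at h4
        have h7 := hsq1 m
        have h8 : (0 : ℝ) ≤ 2 * d * Δ.natDegree := by positivity
        have h9 := norm_sub_norm_le (idealPowerSum ψ (algebraMap (ZMod p)[X] O X) m)
          (∑ z ∈ affinePts (biMap (ZMod p) F Φ) (p ^ m), ψ (t m z))
        nlinarith
    rw [Nat.card_zmod] at h2
    rw [sub_zero]
    have h9 := norm_sub_norm_le (∑ z : ZMod p × ZMod p with Φ.evalEval z.1 z.2 = 0, ψ z.1)
      (idealPowerSum ψ (algebraMap (ZMod p)[X] O X) 1)
    rw [← norm_neg, neg_sub] at h1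
    linarith
end Weil

end

section
open Polynomial

theorem dvd_algebraMap_norm {R S : Type*} [CommRing R] [CommRing S] [Algebra R S]
    [Module.Free R S] [Module.Finite R S] [Nontrivial R] (b : S) : b ∣ algebraMap R S (Algebra.norm R b) := by
  have h1 : aeval b (Algebra.lmul R S b).charpoly = 0 := by
    apply Algebra.lmul_injective (R := R)
    rw [map_zero, ← LinearMap.aeval_self_charpoly (Algebra.lmul R S b), aeval_algHom_apply]
  have h2 : b ∣ algebraMap R S ((Algebra.lmul R S b).charpoly.coeff 0) := by
    obtain ⟨g, hg⟩ := X_dvd_sub_C (p := (Algebra.lmul R S b).charpoly)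
    have := congrArg (aeval b) hg
    rw [map_sub, h1, map_mul, aeval_X, aeval_C, zero_sub] at this
    exact ⟨-aeval b g, by rw [mul_neg, ← this, neg_neg]⟩
  rw [Algebra.norm_apply, LinearMap.det_eq_sign_charpoly_coeff, map_mul]
  exact h2.mul_left _

theorem WD.derivative {k : Type*} [Field k] {P : k[X][X]} {m : ℕ} (h : WD 1 P m) :
    WD 1 (Polynomial.derivative P) (m - 1) := by
  intro i hi
  rw [coeff_derivative] at hi ⊢
  have h1 : P.coeff (i + 1) ≠ 0 := left_ne_zero_of_mul hi
  have h2 := h _ h1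
  have h3 : (P.coeff (i + 1) * ((i : k[X]) + 1)).natDegree ≤ (P.coeff (i + 1)).natDegree := by
    refine natDegree_mul_le.trans ?_
    rw [← Nat.cast_succ, natDegree_natCast, add_zero]
  omega

theorem mul_derivative_mem_adjoin {A K L : Type*} [CommRing A] [IsDomain A] [IsIntegrallyClosed A]
    [Field K] [Field L] [Algebra A K] [Algebra K L] [Algebra A L] [IsScalarTower A K L]
    [IsFractionRing A K] [FiniteDimensional K L] [Algebra.IsSeparable K L]
    {x : L} (hx : Algebra.adjoin K {x} = ⊤) (hAx : IsIntegral A x) {u : L} (hu : IsIntegral A u) :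
    aeval x (derivative (minpoly K x)) * u ∈ Algebra.adjoin A {x} := by
  have h0 : aeval x (derivative (minpoly K x)) ≠ 0 :=
    (Algebra.IsSeparable.isSeparable K x).aeval_derivative_ne_zero (minpoly.aeval _ _)
  have h1 : u ∈ (Algebra.traceForm K L).dualSubmodule
      (Subalgebra.toSubmodule (Algebra.adjoin A {x})) := by
    intro y hy
    have hy' : IsIntegral A y := adjoin_le_integralClosure hAx hy
    obtain ⟨a, ha⟩ := IsIntegrallyClosed.isIntegral_iff.1
      (Algebra.isIntegral_trace (L := K) (hu.mul hy'))
    exact Submodule.mem_one.2 ⟨a, ha⟩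
  rw [traceForm_dualSubmodule_adjoin A K hx hAx] at h1
  obtain ⟨a, ha, h2⟩ := (Submodule.mem_smul_pointwise_iff_exists _ _ _).1 h1
  rw [← h2, smul_eq_mul, mul_inv_cancel_left₀ h0]
  exact ha

theorem exists_maximal_order {k : Type} [Field k] {Φ : k[X][X]} {d : ℕ} (hΦ : Φ.Monic)
    (hd : Φ.natDegree = d) (hW : WD 1 Φ d) (hirr : Irreducible Φ) (hder : derivative Φ ≠ 0) :
    ∃ (O : Type) (_ : CommRing O) (_ : Algebra k O) (_ : IsDedekindDomain O) (_ : Algebra k[X] O)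
      (_ : IsScalarTower k k[X] O) (_ : Module.Finite k[X] O) (_ : Module.Free k[X] O)
      (ι : AdjoinRoot Φ →ₐ[k[X]] O) (Δ : k[X]), Function.Injective ι ∧ Δ ≠ 0 ∧
      Δ.natDegree ≤ d * (d - 1) ∧ ∀ u : O, ∃ P : k[X][X], Δ • u = ι (AdjoinRoot.mk Φ P) := by
  let K := FractionRing k[X]
  set ΦK : K[X] := Φ.map (algebraMap k[X] K) with hΦK
  have hirrK : Irreducible ΦK := (Monic.irreducible_iff_irreducible_map_fraction_map hΦ).1 hirr
  have hmonK : ΦK.Monic := hΦ.map _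
  have : Fact (Irreducible ΦK) := ⟨hirrK⟩
  have hinj : Function.Injective (algebraMap k[X] K) := IsFractionRing.injective k[X] K
  have hsepK : ΦK.Separable := by
    rw [separable_iff_derivative_ne_zero hirrK, hΦK, derivative_map, Ne,
      Polynomial.map_eq_zero_iff hinj]
    exact hder
  let L := AdjoinRoot ΦK
  have hmin : minpoly K (AdjoinRoot.root ΦK) = ΦK := by
    rw [AdjoinRoot.minpoly_root hirrK.ne_zero, hmonK.leadingCoeff, inv_one, C_1, mul_one]
  have hfin : FiniteDimensional K L := (AdjoinRoot.powerBasis hirrK.ne_zero).finite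
  have hadj : Algebra.adjoin K {AdjoinRoot.root ΦK} = ⊤ := AdjoinRoot.adjoinRoot_eq_top
  have hsep : Algebra.IsSeparable K L := by
    have h1 : IsSeparable K (AdjoinRoot.root ΦK) := by rw [IsSeparable, hmin]; exact hsepK
    have h2 := (IntermediateField.isSeparable_adjoin_simple_iff_isSeparable K L).2 h1
    rw [IntermediateField.adjoin_root_eq_top] at h2
    exact AlgEquiv.Algebra.isSeparable IntermediateField.topEquiv
  have haev : ∀ P : k[X][X], aeval (AdjoinRoot.root ΦK) P =
      AdjoinRoot.mk ΦK (P.map (algebraMap k[X] K)) := fun P => by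
    rw [← AdjoinRoot.aeval_eq, aeval_map_algebraMap]
  have hrootInt : IsIntegral k[X] (AdjoinRoot.root ΦK) :=
    ⟨Φ, hΦ, (haev Φ).trans AdjoinRoot.mk_self⟩
  have htf : Module.IsTorsionFree k[X] L := by
    rw [Module.isTorsionFree_iff_algebraMap_injective, IsScalarTower.algebraMap_eq k[X] K L]
    exact (algebraMap K L).injective.comp hinj
  let O := integralClosure k[X] L
  have i1 : IsDedekindDomain O := integralClosure.isDedekindDomain k[X] K L
  have i2 : Module.Finite k[X] O := IsIntegralClosure.finite k[X] K L O
  have i3 : Module.Free k[X] O := IsIntegralClosure.module_free k[X] K L O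
  let y : O := ⟨AdjoinRoot.root ΦK, hrootInt⟩
  have hy' : ∀ P : k[X][X], ((aeval y P : O) : L) =
      AdjoinRoot.mk ΦK (P.map (algebraMap k[X] K)) := fun P => by
    rw [← haev, aeval_subalgebra_coe]
  have hy : aeval y Φ = 0 := Subtype.ext ((hy' Φ).trans AdjoinRoot.mk_self)
  let ι : AdjoinRoot Φ →ₐ[k[X]] O := AdjoinRoot.liftAlgHom Φ (Algebra.ofId k[X] O) y hy
  have hder' : derivative ΦK = (derivative Φ).map (algebraMap k[X] K) := by
    rw [hΦK, derivative_map]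
  have hι : ∀ P, ((ι (AdjoinRoot.mk Φ P) : O) : L) = AdjoinRoot.mk ΦK (P.map (algebraMap k[X] K)) := by
    intro P
    rw [← hy']
    rfl
  have hιinj : Function.Injective ι := by
    rw [injective_iff_map_eq_zero]
    intro b hb
    obtain ⟨P, rfl⟩ := AdjoinRoot.mk_surjective b
    have := hι P
    rw [hb, ZeroMemClass.coe_zero, eq_comm, AdjoinRoot.mk_eq_zero, hΦK,
      map_dvd_map _ hinj hΦ] at this
    exact AdjoinRoot.mk_eq_zero.2 this
  have : Module.Finite k[X] (AdjoinRoot Φ) := (AdjoinRoot.powerBasis' hΦ).finite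
  have : Module.Free k[X] (AdjoinRoot Φ) := Module.Free.of_basis (AdjoinRoot.powerBasis' hΦ).basis
  have : IsDomain (AdjoinRoot Φ) := AdjoinRoot.isDomain_of_prime hirr.prime
  obtain ⟨c, hc⟩ := dvd_algebraMap_norm (R := k[X]) (AdjoinRoot.mk Φ (derivative Φ))
  refine ⟨O, inferInstance, inferInstance, i1, inferInstance, inferInstance, i2, i3, ι,
    Algebra.norm k[X] (AdjoinRoot.mk Φ (derivative Φ)), hιinj, ?_, ?_, ?_⟩
  · rw [Ne, Algebra.norm_eq_zero_iff, AdjoinRoot.mk_eq_zero]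
    exact fun h => hder (eq_zero_of_dvd_of_natDegree_lt h (natDegree_derivative_lt fun h0 =>
      hder (by rw [eq_one_of_monic_natDegree_zero hΦ h0, derivative_one])))
  · exact natDegree_norm_mk_le (w := 1) hΦ hd (by rwa [one_mul]) hW.derivative
  · intro u
    have h1 := mul_derivative_mem_adjoin (K := K) hadj hrootInt u.2
    obtain ⟨Q, hQ⟩ := (Algebra.adjoin_singleton_eq_range_aeval k[X] (AdjoinRoot.root ΦK) ▸ h1)
    obtain ⟨R, hR⟩ := AdjoinRoot.mk_surjective c
    refine ⟨R * Q, ?_⟩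
    apply Subtype.ext
    have h2 : aeval (AdjoinRoot.root ΦK) Q = aeval (AdjoinRoot.root ΦK)
      (derivative (minpoly K (AdjoinRoot.root ΦK))) * (u : L) := hQ
    rw [hmin, AdjoinRoot.aeval_eq, hder', haev, ← hι, ← hι] at h2
    rw [Algebra.smul_def, ← ι.commutes, hc, map_mul (AdjoinRoot.mk Φ), hR, map_mul ι, map_mul ι,
      MulMemClass.coe_mul, MulMemClass.coe_mul, MulMemClass.coe_mul, h2]
    ring

end

section
open Polynomial

/-- The Riemann hypothesis bound for absolutely irreducible plane curves with an additive twist. -/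
theorem norm_sum_zeros_addChar_le {p : ℕ} [Fact p.Prime] (F : Type) [Field F] [Algebra (ZMod p) F]
    [IsAlgClosed F] {Φ : (ZMod p)[X][X]} {d : ℕ} (hΦ : Φ.Monic) (hd : Φ.natDegree = d)
    (hd0 : 0 < d) (hdp : d < p) (hW : WD 1 Φ d) (hirr : Irreducible (biMap (ZMod p) F Φ))
    (ψ : AddChar (ZMod p) ℂ) :
    ‖∑ z : ZMod p × ZMod p with Φ.evalEval z.1 z.2 = 0, ψ z.1 - if ψ = 1 then (p : ℂ) else 0‖ ≤
      2 * d ^ 2 * √p + 2 * d ^ 3 := by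
  have hirr' : Irreducible Φ := hΦ.irreducible_of_irreducible_map _ _ hirr
  have : CharP (ZMod p)[X] p := inferInstance
  have hder : derivative Φ ≠ 0 :=
    derivative_ne_zero_of_natDegree_lt (p := p) hΦ (by omega) (by omega)
  obtain ⟨O, _, _, _, _, _, _, _, ι, Δ, hι, hΔ, hdeg, hO⟩ :=
    exists_maximal_order hΦ hd hW hirr' hder
  refine (norm_sum_zeros_addChar_le_of_order hΦ hd hι hΔ hO hd0 hdp hW hirr ψ).trans ?_
  have h1 : Δ.natDegree ≤ d * d := hdeg.trans (Nat.mul_le_mul_left _ (Nat.sub_le _ _))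
  have h2 : (Δ.natDegree : ℝ) ≤ d * d := by exact_mod_cast h1
  have : (0 : ℝ) ≤ d := Nat.cast_nonneg d
  nlinarith

end

section
open Polynomial

section WeightedSubst
variable {k : Type*} [Field k]

/-- The substitution `X ↦ X ^ u`, `Y ↦ Z * X ^ v` from `k[X][Y]` to `k[Z][X]`, whose degree in `X`
is the weighted degree. -/
noncomputable def weightedSubst (k : Type*) [Field k] (u v : ℕ) : k[X][X] →+* k[X][X] :=
  eval₂RingHom ((expand k[X] u : k[X][X] →+* k[X][X]).comp (mapRingHom C)) (C X * X ^ v)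

theorem weightedSubst_X (u v : ℕ) : weightedSubst k u v X = C X * X ^ v := by
  simp [weightedSubst]

theorem weightedSubst_C (u v : ℕ) (P : k[X]) :
    weightedSubst k u v (C P) = expand k[X] u (P.map C) := by
  simp [weightedSubst]

theorem coeff_coeff_weightedSubst (u v : ℕ) (P : k[X][X]) (n j : ℕ) :
    ((weightedSubst k u v P).coeff n).coeff j =
      if v * j ≤ n then (expand k u (P.coeff j)).coeff (n - v * j) else 0 := by
  induction P using Polynomial.induction_on' with
  | add P Q hP hQ =>
    rw [map_add, coeff_add, coeff_add, hP, hQ, coeff_add, map_add, coeff_add]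
    split_ifs <;> simp
  | monomial i a =>
    rw [← C_mul_X_pow_eq_monomial, map_mul, map_pow, weightedSubst_X, weightedSubst_C, mul_pow,
      ← pow_mul, ← C_pow, mul_left_comm, coeff_C_mul, coeff_mul_X_pow', coeff_C_mul_X_pow]
    have hexp : expand k[X] u (a.map C) = (expand k u a).map C := (map_expand).symm
    by_cases hij : j = i
    · subst hij
      rw [if_pos rfl]
      split_ifs
      · rw [hexp, coeff_map, mul_comm, coeff_C_mul_X_pow, if_pos rfl]
      · simp
    · rw [if_neg hij, map_zero, coeff_zero, ite_self]
      split_ifs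
      · rw [hexp, coeff_map, mul_comm, coeff_C_mul_X_pow, if_neg hij]
      · simp

theorem le_natDegree_weightedSubst {u : ℕ} (hu : 0 < u) (v : ℕ) {P : k[X][X]} {j : ℕ}
    (hj : P.coeff j ≠ 0) :
    u * (P.coeff j).natDegree + v * j ≤ (weightedSubst k u v P).natDegree := by
  apply le_natDegree_of_ne_zero
  intro h
  have := coeff_coeff_weightedSubst u v P (u * (P.coeff j).natDegree + v * j) j
  rw [h, coeff_zero, if_pos (Nat.le_add_left _ _), Nat.add_sub_cancel, mul_comm u,
    coeff_expand_mul hu] at this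
  exact hj (leadingCoeff_eq_zero.1 this.symm)

theorem natDegree_weightedSubst_le {u v m : ℕ} {P : k[X][X]}
    (h : ∀ j, P.coeff j ≠ 0 → u * (P.coeff j).natDegree + v * j ≤ m) :
    (weightedSubst k u v P).natDegree ≤ m := by
  rw [natDegree_le_iff_coeff_eq_zero]
  intro n hn
  ext j
  rw [coeff_coeff_weightedSubst, coeff_zero]
  split_ifs with hj
  · by_cases h0 : P.coeff j = 0
    · rw [h0, map_zero, coeff_zero]
    · apply coeff_eq_zero_of_natDegree_lt
      rw [natDegree_expand]
      have := h j h0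
      rw [mul_comm]
      omega
  · rfl

theorem weightedSubst_ne_zero {u : ℕ} (hu : 0 < u) (v : ℕ) {P : k[X][X]} (hP : P ≠ 0) :
    weightedSubst k u v P ≠ 0 := by
  intro h
  apply hP
  ext1 j
  by_contra h0
  rw [coeff_zero] at h0
  have := coeff_coeff_weightedSubst u v P (u * (P.coeff j).natDegree + v * j) j
  rw [h, coeff_zero, coeff_zero, if_pos (Nat.le_add_left _ _), Nat.add_sub_cancel, mul_comm u,
    coeff_expand_mul hu] at this
  exact h0 (leadingCoeff_eq_zero.1 this.symm)

theorem natDegree_weightedSubst_of_mul {u : ℕ} (hu : 0 < u) {v : ℕ} {A B : k[X][X]} (hA : A.Monic)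
    (hB : B.Monic) (h : ∀ j, (A * B).coeff j ≠ 0 →
      u * ((A * B).coeff j).natDegree + v * j ≤ v * (A * B).natDegree) :
    (weightedSubst k u v A).natDegree = v * A.natDegree := by
  have h1 := natDegree_weightedSubst_le h
  rw [map_mul, natDegree_mul (weightedSubst_ne_zero hu v hA.ne_zero)
    (weightedSubst_ne_zero hu v hB.ne_zero), hA.natDegree_mul hB] at h1
  have h2 : ∀ P : k[X][X], P.Monic → v * P.natDegree ≤ (weightedSubst k u v P).natDegree := by
    intro P hP
    have := le_natDegree_weightedSubst hu v (P := P) (j := P.natDegree)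
      (by rw [hP.coeff_natDegree]; exact one_ne_zero)
    omega
  have h3 := h2 A hA
  have h4 := h2 B hB
  rw [mul_add] at h1
  omega

theorem WD.of_mul {A B : k[X][X]} (hA : A.Monic) (hB : B.Monic)
    (h : WD 1 (A * B) (A * B).natDegree) : WD 1 A A.natDegree := by
  intro j hj
  have h1 := le_natDegree_weightedSubst one_pos 1 hj
  rw [natDegree_weightedSubst_of_mul one_pos hA hB fun j hj => by simpa using h j hj] at h1
  simpa using h1

/-- `f(Y) - g(X)` is irreducible when the degrees of `f` and `g` are coprime. -/
theorem natDegree_eq_zero_of_mul_eq_sub {f g : k[X]} (hg : 0 < g.natDegree)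
    (hfg : Nat.Coprime g.natDegree f.natDegree) {A B : k[X][X]} (hA : A.Monic) (hB : B.Monic)
    (h : A * B = f.map C - C g) (hf0 : 0 < f.natDegree) : A.natDegree = 0 ∨ B.natDegree = 0 := by
  set i := g.natDegree
  set j := f.natDegree with hj
  have hdeg : (A * B).natDegree = j := by
    rw [h, natDegree_sub_C, natDegree_map_eq_of_injective C_injective]
  have hw : ∀ l, (A * B).coeff l ≠ 0 →
      j * ((A * B).coeff l).natDegree + i * l ≤ i * (A * B).natDegree := by
    intro l hl
    have hlj := le_natDegree_of_ne_zero hl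
    rw [hdeg] at hlj ⊢
    rw [h, coeff_sub, coeff_map, coeff_C]
    split_ifs with h0
    · subst h0
      have : (C (f.coeff 0) - g).natDegree ≤ i := by
        refine (natDegree_sub_le _ _).trans ?_
        rw [natDegree_C]; omega
      rw [mul_zero, add_zero, mul_comm]
      exact Nat.mul_le_mul_right _ this
    · rw [sub_zero, natDegree_C, mul_zero, zero_add]
      exact Nat.mul_le_mul_left _ hlj
  have hA1 := natDegree_weightedSubst_of_mul hf0 hA hB hw
  rw [mul_comm] at hw
  have hB1 := natDegree_weightedSubst_of_mul hf0 hB hA hw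
  have h0 : A.coeff 0 * B.coeff 0 = C (f.coeff 0) - g := by
    rw [← mul_coeff_zero, h, coeff_sub, coeff_map, coeff_C_zero]
  have h0' : (C (f.coeff 0) - g).natDegree = i := by
    rw [← neg_sub, natDegree_neg, natDegree_sub_C]
  have hne : A.coeff 0 * B.coeff 0 ≠ 0 := by
    intro h1
    rw [← h0, h1, natDegree_zero] at h0'
    omega
  have hsum : (A.coeff 0).natDegree + (B.coeff 0).natDegree = i := by
    rw [← natDegree_mul (left_ne_zero_of_mul hne) (right_ne_zero_of_mul hne), h0, h0']
  have hA2 := le_natDegree_weightedSubst hf0 i (left_ne_zero_of_mul hne)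
  have hB2 := le_natDegree_weightedSubst hf0 i (right_ne_zero_of_mul hne)
  rw [hA1, mul_zero, add_zero] at hA2
  rw [hB1, mul_zero, add_zero] at hB2
  rw [hA.natDegree_mul hB] at hdeg
  have heq : j * (A.coeff 0).natDegree = i * A.natDegree := by
    have : j * ((A.coeff 0).natDegree + (B.coeff 0).natDegree) = i * (A.natDegree + B.natDegree) := by
      rw [hsum, hdeg, mul_comm]
    rw [mul_add, mul_add] at this
    omega
  have hdvd : j ∣ A.natDegree := hfg.symm.dvd_of_dvd_mul_left ⟨_, heq.symm⟩
  rcases Nat.eq_zero_or_pos A.natDegree with h1 | h1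
  · exact Or.inl h1
  · have := Nat.le_of_dvd h1 hdvd
    right; omega

/-- The top homogeneous form, dehomogenised, of a factor divides that of the product. -/
theorem leadingCoeff_weightedSubst_dvd {A B P : k[X][X]} (h : A * B = P) (u v : ℕ) :
    (weightedSubst k u v A).leadingCoeff ∣ (weightedSubst k u v P).leadingCoeff := by
  rw [← h, map_mul, leadingCoeff_mul]
  exact dvd_mul_right _ _
end WeightedSubst

end

section
open Polynomial

section MonicFactorization
variable {k : Type*} [Field k]

theorem exists_multiset_monic_irreducible {R : Type*} [CommRing R] [IsDomain R] (P : R[X])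
    (hP : P.Monic) : ∃ s : Multiset R[X], (∀ g ∈ s, g.Monic ∧ Irreducible g) ∧ s.prod = P := by
  induction hn : P.natDegree using Nat.strong_induction_on generalizing P with
  | _ n ih =>
    by_cases h1 : P = 1
    · exact ⟨0, by simp, by simp [h1]⟩
    by_cases hirr : Irreducible P
    · exact ⟨{P}, by simp [hP, hirr], by simp⟩
    rw [hP.irreducible_iff_natDegree] at hirr
    push Not at hirr
    obtain ⟨f, g, hf, hg, hfg, hf0, hg0⟩ := hirr h1
    have hdeg := hf.natDegree_mul hg
    rw [hfg] at hdeg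
    obtain ⟨s, hs, hs'⟩ := ih f.natDegree (by omega) f hf rfl
    obtain ⟨t, ht, ht'⟩ := ih g.natDegree (by omega) g hg rfl
    refine ⟨s + t, fun x hx => ?_, by rw [Multiset.prod_add, hs', ht', hfg]⟩
    rcases Multiset.mem_add.1 hx with hx | hx
    exacts [hs x hx, ht x hx]

/-- A monic bivariate polynomial is, up to multiplicities, a product of distinct monic irreducibles
which inherit the total degree bound. -/
theorem exists_finset_monic_irreducible {P : k[X][X]} (hP : P.Monic) (hW : WD 1 P P.natDegree) :
    ∃ T : Finset k[X][X], (∀ g ∈ T, g.Monic ∧ Irreducible g ∧ WD 1 g g.natDegree ∧ g ∣ P) ∧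
      ∑ g ∈ T, g.natDegree ≤ P.natDegree ∧
      ∀ x y, P.evalEval x y = 0 → ∃ g ∈ T, g.evalEval x y = 0 := by
  classical
  obtain ⟨s, hs, rfl⟩ := exists_multiset_monic_irreducible P hP
  refine ⟨s.toFinset, fun g hg => ?_, ?_, fun x y h => ?_⟩
  · rw [Multiset.mem_toFinset] at hg
    obtain ⟨t, rfl⟩ := Multiset.exists_cons_of_mem hg
    have ht : t.prod.Monic := by
      have := monic_multiset_prod_of_monic t id (fun x hx => (hs x (Multiset.mem_cons_of_mem hx)).1)
      simpa using this
    rw [Multiset.prod_cons] at hW ⊢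
    exact ⟨(hs g hg).1, (hs g hg).2, WD.of_mul (hs g hg).1 ht hW, dvd_mul_right _ _⟩
  · rw [natDegree_multiset_prod_of_monic _ fun g hg => (hs g hg).1]
    rw [Finset.sum_multiset_map_count]
    refine Finset.sum_le_sum fun g hg => ?_
    rw [smul_eq_mul]
    exact Nat.le_mul_of_pos_left _ (Multiset.count_pos.2 (Multiset.mem_toFinset.1 hg))
  · have h' : (s.map (evalEvalRingHom x y)).prod = 0 := by
      rw [← map_multiset_prod]; exact h
    rw [Multiset.prod_eq_zero_iff, Multiset.mem_map] at h'
    obtain ⟨g, hg, hg0⟩ := h'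
    exact ⟨g, Multiset.mem_toFinset.2 hg, hg0⟩

theorem card_common_zeros_le {g P : k[X][X]} (hg : g.Monic) (hirr : Irreducible g)
    (hW : WD 1 g g.natDegree) {m : ℕ} (hP : WD 1 P m) (hgP : ¬ g ∣ P) (Z : Finset (k × k))
    (hZ : ∀ z ∈ Z, g.evalEval z.1 z.2 = 0) (hZP : ∀ z ∈ Z, P.evalEval z.1 z.2 = 0) :
    Z.card ≤ g.natDegree * m :=
  (card_points_le_natDegree_norm hg hirr (by rwa [Ne, AdjoinRoot.mk_eq_zero]) Z hZ hZP).trans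
    (natDegree_norm_mk_le hg rfl (by rwa [one_mul]) hP)


theorem eq_of_monic_irreducible_dvd {g h : k[X][X]} (hg : g.Monic) (hh : h.Monic)
    (hgi : Irreducible g) (hhi : Irreducible h) (hdvd : g ∣ h) : g = h :=
  eq_of_monic_of_associated hg hh (hgi.associated_of_dvd hhi hdvd)
end MonicFactorization

section RationalZeros
variable {p : ℕ} [Fact p.Prime] {F : Type} [Field F] [Algebra (ZMod p) F]

open Classical in
/-- The zeros with coordinates in the prime field of a bivariate polynomial over an extension. -/
noncomputable def ratZeros (p : ℕ) [Fact p.Prime] {F : Type} [Field F] [Algebra (ZMod p) F]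
    (g : F[X][X]) : Finset (ZMod p × ZMod p) :=
  Finset.univ.filter fun z => g.evalEval (algebraMap (ZMod p) F z.1) (algebraMap (ZMod p) F z.2) = 0

theorem mem_ratZeros {g : F[X][X]} {z : ZMod p × ZMod p} : z ∈ ratZeros p g ↔
    g.evalEval (algebraMap (ZMod p) F z.1) (algebraMap (ZMod p) F z.2) = 0 := by
  simp [ratZeros]

theorem mem_ratZeros_biMap {Φ : (ZMod p)[X][X]} {z : ZMod p × ZMod p} :
    z ∈ ratZeros p (biMap (ZMod p) F Φ) ↔ Φ.evalEval z.1 z.2 = 0 := by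
  rw [mem_ratZeros]
  have := map_mapRingHom_evalEval (algebraMap (ZMod p) F) Φ z.1 z.2
  have h2 : (biMap (ZMod p) F Φ).evalEval (algebraMap (ZMod p) F z.1)
    (algebraMap (ZMod p) F z.2) = algebraMap (ZMod p) F (Φ.evalEval z.1 z.2) := this
  rw [h2, map_eq_zero]

theorem card_ratZeros_inter_le {g P : F[X][X]} (hg : g.Monic) (hirr : Irreducible g)
    (hW : WD 1 g g.natDegree) {m : ℕ} (hP : WD 1 P m) (hgP : ¬ g ∣ P)
    (Z : Finset (ZMod p × ZMod p)) (hZ : Z ⊆ ratZeros p g) (hZP : Z ⊆ ratZeros p P) :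
    Z.card ≤ g.natDegree * m := by
  classical
  let ι : ZMod p × ZMod p ↪ F × F :=
    ⟨Prod.map (algebraMap (ZMod p) F) (algebraMap (ZMod p) F),
      Function.Injective.prodMap (algebraMap (ZMod p) F).injective (algebraMap (ZMod p) F).injective⟩
  rw [← Finset.card_map ι]
  refine card_common_zeros_le hg hirr hW hP hgP _ (fun z hz => ?_) (fun z hz => ?_)
  · obtain ⟨y, hy, rfl⟩ := Finset.mem_map.1 hz
    exact mem_ratZeros.1 (hZ hy)
  · obtain ⟨y, hy, rfl⟩ := Finset.mem_map.1 hz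
    exact mem_ratZeros.1 (hZP hy)

/-- A monic polynomial fixed by Frobenius is defined over the prime field. -/
theorem exists_biMap_eq_of_map_frobenius [IsAlgClosed F] [CharP F p] {g : F[X][X]} (hg : g.Monic)
    (h : g.map (mapRingHom (frobenius F p)) = g) :
    ∃ A : (ZMod p)[X][X], A.Monic ∧ biMap (ZMod p) F A = g := by
  have hc : ∀ i j, ∃ a : ZMod p, algebraMap (ZMod p) F a = (g.coeff i).coeff j := fun i j => by
    apply exists_algebraMap_eq_of_pow_eq
    have := congrArg (fun q : F[X][X] => (q.coeff i).coeff j) h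
    simpa [frobenius_def] using this
  have h1 : ∀ i, ∃ a : (ZMod p)[X], a.map (algebraMap (ZMod p) F) = g.coeff i := fun i => by
    have : g.coeff i ∈ lifts (algebraMap (ZMod p) F) :=
      (lifts_iff_coeff_lifts _).2 fun j => hc i j
    exact (mem_lifts _).1 this
  have h2 : g ∈ lifts (mapRingHom (algebraMap (ZMod p) F)) :=
    (lifts_iff_coeff_lifts _).2 fun i => h1 i
  obtain ⟨A, hA, -, hAm⟩ := lifts_and_natDegree_eq_and_monic h2 hg
  exact ⟨A, hAm, hA⟩

theorem card_ratZeros_le_of_not_rational [IsAlgClosed F] [CharP F p] {g : F[X][X]} (hg : g.Monic)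
    (hirr : Irreducible g) (hW : WD 1 g g.natDegree)
    (hr : ¬ ∃ A : (ZMod p)[X][X], A.Monic ∧ biMap (ZMod p) F A = g) :
    (ratZeros p g).card ≤ g.natDegree * g.natDegree := by
  set g' := g.map (mapRingHom (frobenius F p)) with hg'
  have hg'm : g'.Monic := hg.map _
  have hdeg : g'.natDegree = g.natDegree := hg.natDegree_map _
  refine card_ratZeros_inter_le hg hirr hW (P := g') (fun i hi => ?_) (fun hdvd => ?_) _
    (Finset.Subset.refl _) fun z hz => ?_
  · rw [hg', coeff_map] at hi ⊢
    have : g.coeff i ≠ 0 := fun h0 => hi (by rw [h0, map_zero])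
    exact (Nat.add_le_add_right (natDegree_map_le) _).trans (hW i this)
  · refine hr (exists_biMap_eq_of_map_frobenius hg ?_)
    exact eq_of_monic_of_dvd_of_natDegree_le hg hg'm hdvd hdeg.le
  · rw [mem_ratZeros] at hz ⊢
    have := map_mapRingHom_evalEval (frobenius F p) g (algebraMap (ZMod p) F z.1)
      (algebraMap (ZMod p) F z.2)
    rw [hz, map_zero] at this
    have hfix : ∀ a : ZMod p, frobenius F p (algebraMap (ZMod p) F a) = algebraMap (ZMod p) F a :=
      fun a => by rw [frobenius_def, ← map_pow, ZMod.pow_card]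
    rwa [hfix, hfix] at this
end RationalZeros

end

section
open Polynomial

section TheoremS
variable {p : ℕ} [Fact p.Prime] {F : Type} [Field F] [Algebra (ZMod p) F] [IsAlgClosed F]

theorem WD.of_biMap {w m : ℕ} {P : (ZMod p)[X][X]} (h : WD w (_root_.biMap (ZMod p) F P) m) :
    WD w P m := by
  intro i hi
  have hc : (_root_.biMap (ZMod p) F P).coeff i = (P.coeff i).map (algebraMap (ZMod p) F) := by
    simp [_root_.biMap]
  have := h i (by rw [hc]; exact fun h0 => hi (by rwa [Polynomial.map_eq_zero] at h0))
  rwa [hc, natDegree_map] at this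

open Classical in
theorem norm_sum_ratZeros_le {g : F[X][X]} (hg : g.Monic) (hirr : Irreducible g)
    (hW : WD 1 g g.natDegree) (hsq : g.natDegree ^ 2 ≤ p) (ψ : AddChar (ZMod p) ℂ) :
    ‖∑ z ∈ ratZeros p g, ψ z.1 -
      if ψ = 1 ∧ ∃ A : (ZMod p)[X][X], A.Monic ∧ biMap (ZMod p) F A = g then (p : ℂ) else 0‖ ≤
      5 * g.natDegree ^ 2 * √p := by
  have : CharP F p := charP_of_injective_algebraMap (algebraMap (ZMod p) F).injective p
  have he0 : 0 < g.natDegree := by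
    rw [Nat.pos_iff_ne_zero]
    intro h0
    exact hirr.1 (by rw [eq_one_of_monic_natDegree_zero hg h0]; exact isUnit_one)
  have hp2 : 2 ≤ p := (Fact.out : p.Prime).two_le
  have hep : g.natDegree < p := by nlinarith
  have hes : (g.natDegree : ℝ) ≤ √p := Real.le_sqrt_of_sq_le (by exact_mod_cast hsq)
  have hs1 : (1 : ℝ) ≤ √p := Real.one_le_sqrt.2 (by exact_mod_cast (by omega : 1 ≤ p))
  by_cases hr : ∃ A : (ZMod p)[X][X], A.Monic ∧ biMap (ZMod p) F A = g
  · obtain ⟨A, hA, hAg⟩ := hr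
    have hAd : A.natDegree = g.natDegree := by rw [← hAg, natDegree_biMap hA]
    have hWA : WD 1 A g.natDegree := WD.of_biMap (F := F) (by rw [hAg]; exact hW)
    have h := norm_sum_zeros_addChar_le F hA hAd he0 hep hWA (by rw [hAg]; exact hirr) ψ
    have e1 : ratZeros p g = Finset.univ.filter fun z : ZMod p × ZMod p =>
        A.evalEval z.1 z.2 = 0 := by
      ext z
      rw [← hAg, mem_ratZeros_biMap]
      simp
    have e2 : (ψ = 1 ∧ ∃ A : (ZMod p)[X][X], A.Monic ∧ biMap (ZMod p) F A = g) ↔ ψ = 1 :=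
      and_iff_left ⟨A, hA, hAg⟩
    simp only [e2]
    rw [e1]
    refine (le_trans (le_of_eq ?_) h).trans ?_
    · congr!
    · have : (0 : ℝ) < g.natDegree ^ 2 := by positivity
      nlinarith
  · rw [if_neg fun h => hr h.2, sub_zero]
    refine (norm_sum_addChar_le_card ψ _ fun z : ZMod p × ZMod p => z.1).trans ?_
    have h := card_ratZeros_le_of_not_rational hg hirr hW hr
    have h' : ((ratZeros p g).card : ℝ) ≤ g.natDegree * g.natDegree := by exact_mod_cast h
    have : (0 : ℝ) < g.natDegree ^ 2 := by positivity
    nlinarith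

/-- Character sums over a union of curves, up to the pairwise intersections. -/
theorem norm_sum_biUnion_ratZeros_le [DecidableEq F[X][X]] (T : Finset F[X][X])
    (hT : ∀ g ∈ T, g.Monic ∧ Irreducible g ∧ WD 1 g g.natDegree ∧ g.natDegree ^ 2 ≤ p)
    {ψ : AddChar (ZMod p) ℂ} (hψ : ψ ≠ 1) :
    ‖∑ z ∈ T.biUnion (ratZeros p), ψ z.1‖ ≤
      5 * (∑ g ∈ T, g.natDegree : ℕ) ^ 2 * √p + (∑ g ∈ T, g.natDegree : ℕ) ^ 2 := by
  induction T using Finset.induction_on with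
  | empty => simp
  | insert g T hgT ih =>
    obtain ⟨hg, hirr, hW, hsq⟩ := hT g (Finset.mem_insert_self _ _)
    have ih' := ih fun h hh => hT h (Finset.mem_insert_of_mem hh)
    have hg' := norm_sum_ratZeros_le hg hirr hW hsq ψ
    rw [if_neg fun h => hψ h.1, sub_zero] at hg'
    rw [Finset.biUnion_insert, Finset.sum_insert hgT]
    have hI : (ratZeros p g ∩ T.biUnion (ratZeros p)).card ≤
        g.natDegree * ∑ h ∈ T, h.natDegree := by
      rw [Finset.inter_biUnion, Finset.mul_sum]
      refine Finset.card_biUnion_le.trans (Finset.sum_le_sum fun h hh => ?_)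
      obtain ⟨hm, hi, hWh, -⟩ := hT h (Finset.mem_insert_of_mem hh)
      refine card_ratZeros_inter_le hg hirr hW hWh (fun hdvd => hgT ?_) _
        Finset.inter_subset_left Finset.inter_subset_right
      rwa [eq_of_monic_irreducible_dvd hg hm hirr hi hdvd]
    have hI' := norm_sum_addChar_le_card ψ (ratZeros p g ∩ T.biUnion (ratZeros p))
      fun z : ZMod p × ZMod p => z.1
    have hu := Finset.sum_union_inter (s₁ := ratZeros p g) (s₂ := T.biUnion (ratZeros p))
      (f := fun z : ZMod p × ZMod p => ψ z.1)
    rw [← eq_sub_iff_add_eq] at hu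
    rw [hu]
    set S := ∑ h ∈ T, h.natDegree
    have hIr : ((ratZeros p g ∩ T.biUnion (ratZeros p)).card : ℝ) ≤ g.natDegree * S := by
      exact_mod_cast hI
    refine (norm_sub_le _ _).trans ?_
    have := norm_add_le (∑ z ∈ ratZeros p g, ψ z.1) (∑ z ∈ T.biUnion (ratZeros p), ψ z.1)
    push_cast
    have h1 : 0 ≤ (g.natDegree : ℝ) * S := by positivity
    have h2 : 0 ≤ (g.natDegree : ℝ) * S * √p := by positivity
    nlinarith [sq_nonneg (g.natDegree : ℝ)]

theorem exists_finset_rational_factorization (F : Type) [Field F] [Algebra (ZMod p) F]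
    [DecidableEq F[X][X]] {Φ : (ZMod p)[X][X]} (hΦ : Φ.Monic) (hsq : Φ.natDegree ^ 2 ≤ p)
    (hW : WD 1 Φ Φ.natDegree) :
    ∃ T : Finset F[X][X], (∀ g ∈ T, (g.Monic ∧ Irreducible g ∧ WD 1 g g.natDegree ∧
      g.natDegree ^ 2 ≤ p) ∧ g ∣ biMap (ZMod p) F Φ) ∧ ∑ g ∈ T, g.natDegree ≤ Φ.natDegree ∧
      (Finset.univ.filter fun z : ZMod p × ZMod p => Φ.evalEval z.1 z.2 = 0) =
        T.biUnion (ratZeros p) := by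
  have hdeg := natDegree_biMap (F := F) hΦ
  obtain ⟨T, hT, hsum, hz⟩ := exists_finset_monic_irreducible (biMap_monic (F := F) hΦ)
    (by rw [hdeg]; exact hW.biMap)
  rw [hdeg] at hsum
  refine ⟨T, fun g hg => ?_, hsum, ?_⟩
  · obtain ⟨h1, h2, h3, h4⟩ := hT g hg
    exact ⟨⟨h1, h2, h3, (Nat.pow_le_pow_left ((Finset.single_le_sum (f := fun g : F[X][X] =>
      g.natDegree) (fun _ _ => Nat.zero_le _) hg).trans hsum) 2).trans hsq⟩, h4⟩
  · ext z
    rw [Finset.mem_biUnion, Finset.mem_filter, ← mem_ratZeros_biMap (F := F)]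
    refine ⟨fun h => ?_, fun ⟨g, hg, h⟩ => ⟨Finset.mem_univ _, ?_⟩⟩
    · obtain ⟨g, hg, hg0⟩ := hz _ _ (mem_ratZeros.1 h.2)
      exact ⟨g, hg, mem_ratZeros.2 hg0⟩
    · obtain ⟨q, hq⟩ := (hT g hg).2.2.2
      have := map_mul (evalEvalRingHom (algebraMap (ZMod p) F z.1) (algebraMap (ZMod p) F z.2)) g q
      rw [← hq, coe_evalEvalRingHom, mem_ratZeros.1 h, zero_mul] at this
      exact mem_ratZeros.2 this

theorem norm_sum_zeros_le_of_ne_one {Φ : (ZMod p)[X][X]} {d : ℕ} (hΦ : Φ.Monic)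
    (hd : Φ.natDegree = d) (hsq : d ^ 2 ≤ p) (hW : WD 1 Φ d) {ψ : AddChar (ZMod p) ℂ}
    (hψ : ψ ≠ 1) :
    ‖∑ z : ZMod p × ZMod p with Φ.evalEval z.1 z.2 = 0, ψ z.1‖ ≤ 6 * d ^ 2 * √p := by
  classical
  subst hd
  obtain ⟨T, hT, hsum, hz⟩ := exists_finset_rational_factorization
    (AlgebraicClosure (ZMod p)) hΦ hsq hW
  have h := norm_sum_biUnion_ratZeros_le T (fun g hg => (hT g hg).1) hψ
  rw [← hz] at h
  refine h.trans ?_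
  set S := ∑ g ∈ T, g.natDegree
  have hS : (S : ℝ) ≤ Φ.natDegree := by exact_mod_cast hsum
  have hs1 : (1 : ℝ) ≤ √p := Real.one_le_sqrt.2 (by exact_mod_cast (Fact.out : p.Prime).one_lt.le)
  have hS2 : (S : ℝ) ^ 2 ≤ (Φ.natDegree : ℝ) ^ 2 := by gcongr
  have : 0 ≤ (S : ℝ) ^ 2 := by positivity
  nlinarith

/-- Point count for a possibly reducible curve, all of whose rational factors have degree at least
`δ`. -/
theorem card_zeros_le_of_forall_dvd {Φ : (ZMod p)[X][X]} {d δ : ℕ} (hΦ : Φ.Monic)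
    (hd : Φ.natDegree = d) (hsq : d ^ 2 ≤ p) (hW : WD 1 Φ d) (hδ : 0 < δ)
    (hA : ∀ A : (ZMod p)[X][X], A.Monic → A ∣ Φ → 0 < A.natDegree → δ ≤ A.natDegree) :
    ((Finset.univ.filter fun z : ZMod p × ZMod p => Φ.evalEval z.1 z.2 = 0).card : ℝ) ≤
      d / δ * p + 5 * d ^ 2 * √p := by
  classical
  subst hd
  let F := AlgebraicClosure (ZMod p)
  obtain ⟨T, hT, hsum, hz⟩ := exists_finset_rational_factorization F hΦ hsq hW
  rw [hz]
  let r : F[X][X] → Prop := fun g => ∃ A : (ZMod p)[X][X], A.Monic ∧ biMap (ZMod p) F A = g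
  have h1 : ∀ g ∈ T, ((ratZeros p g).card : ℝ) ≤
      (if r g then (p : ℝ) else 0) + 5 * g.natDegree ^ 2 * √p := fun g hg => by
    obtain ⟨hm, hi, hWg, hsg⟩ := (hT g hg).1
    have h := norm_sum_ratZeros_le hm hi hWg hsg (1 : AddChar (ZMod p) ℂ)
    have e : (∑ z ∈ ratZeros p g, (1 : AddChar (ZMod p) ℂ) z.1 - if (1 : AddChar (ZMod p) ℂ) = 1 ∧
        ∃ A : (ZMod p)[X][X], A.Monic ∧ biMap (ZMod p) F A = g then (p : ℂ) else 0) =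
        (((ratZeros p g).card - if r g then (p : ℝ) else 0 : ℝ) : ℂ) := by
      by_cases hr : r g
      · rw [if_pos ⟨rfl, hr⟩, if_pos hr]; simp
      · rw [if_neg fun h => hr h.2, if_neg hr]; simp
    rw [e, Complex.norm_real, Real.norm_eq_abs] at h
    have := (abs_le.1 h).2
    linarith
  have h2 : (T.filter r).card * δ ≤ Φ.natDegree := by
    refine le_trans ?_ hsum
    rw [← smul_eq_mul]
    refine (Finset.card_nsmul_le_sum (T.filter r) (fun g => g.natDegree) δ fun g hg => ?_).trans
      (Finset.sum_le_sum_of_subset (Finset.filter_subset _ _))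
    obtain ⟨hgT, A, hAm, hAg⟩ := Finset.mem_filter.1 hg
    obtain ⟨⟨hm, hi, -⟩, hdvd⟩ := hT g hgT
    have hdeg : A.natDegree = g.natDegree := by rw [← hAg, natDegree_biMap hAm]
    rw [← hdeg]
    refine hA A hAm ?_ ?_
    · rw [← hAg] at hdvd
      exact (map_dvd_map _ (map_injective _ (algebraMap (ZMod p) F).injective) hAm).1 hdvd
    · rw [hdeg, Nat.pos_iff_ne_zero]
      intro h0
      exact hi.1 (by rw [eq_one_of_monic_natDegree_zero hm h0]; exact isUnit_one)
  have h3 : ((T.filter r).card : ℝ) ≤ Φ.natDegree / δ := by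
    rw [le_div_iff₀ (by exact_mod_cast hδ)]
    exact_mod_cast h2
  have h4 : (∑ g ∈ T, (g.natDegree : ℝ) ^ 2) ≤ (Φ.natDegree : ℝ) ^ 2 := by
    have a1 : (∑ g ∈ T, (g.natDegree : ℝ)) ≤ Φ.natDegree := by exact_mod_cast hsum
    have a2 : (∑ g ∈ T, (g.natDegree : ℝ) ^ 2) ≤ (∑ g ∈ T, (g.natDegree : ℝ)) ^ 2 :=
      Finset.sum_sq_le_sq_sum_of_nonneg fun _ _ => Nat.cast_nonneg _
    have a3 : (0 : ℝ) ≤ ∑ g ∈ T, (g.natDegree : ℝ) := Finset.sum_nonneg fun _ _ => Nat.cast_nonneg _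
    exact a2.trans (by gcongr)
  calc ((T.biUnion (ratZeros p)).card : ℝ) ≤ ∑ g ∈ T, ((ratZeros p g).card : ℝ) := by
        exact_mod_cast Finset.card_biUnion_le
    _ ≤ ∑ g ∈ T, ((if r g then (p : ℝ) else 0) + 5 * g.natDegree ^ 2 * √p) := Finset.sum_le_sum h1
    _ = (T.filter r).card * p + 5 * (∑ g ∈ T, (g.natDegree : ℝ) ^ 2) * √p := by
        rw [Finset.sum_add_distrib, ← Finset.sum_filter, Finset.sum_const, nsmul_eq_mul,
          Finset.mul_sum, Finset.sum_mul]
    _ ≤ _ := by gcongr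
end TheoremS

end

section
open Polynomial

section DividedDifference

/-- The divided difference `(f(u) - f(v)) / (u - v)` of a polynomial. -/
noncomputable def divDiff {k R : Type*} [Field k] [CommRing R] (φ : k →+* R) (f : k[X]) (u v : R) :
    R :=
  ∑ n ∈ Finset.range (f.natDegree + 1), φ (f.coeff n) * ∑ s ∈ Finset.range n, u ^ s * v ^ (n - 1 - s)

variable {k R S : Type*} [Field k] [CommRing R] [CommRing S]

theorem divDiff_mul (φ : k →+* R) (f : k[X]) (u v : R) :
    divDiff φ f u v * (u - v) = f.eval₂ φ u - f.eval₂ φ v := by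
  rw [divDiff, Finset.sum_mul, eval₂_eq_sum_range, eval₂_eq_sum_range, ← Finset.sum_sub_distrib]
  refine Finset.sum_congr rfl fun n _ => ?_
  rw [mul_assoc, geom_sum₂_mul, mul_sub]

theorem map_divDiff (h : R →+* S) (φ : k →+* R) (f : k[X]) (u v : R) :
    h (divDiff φ f u v) = divDiff (h.comp φ) f (h u) (h v) := by
  simp [divDiff, map_sum]

theorem WD.mul_C_C {m : ℕ} {P : k[X][X]} (h : WD 1 P m) (c : k) :
    WD 1 (Polynomial.C (Polynomial.C c) * P) m := by
  have := (WD.C (w := 1) (m := 0) (a := Polynomial.C c) (natDegree_C c).le).mul h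
  rwa [zero_add] at this

theorem WD.divDiff {f : k[X]} {u v : k[X][X]} (hu : WD 1 u 1) (hv : WD 1 v 1) :
    WD 1 (divDiff (Polynomial.C.comp Polynomial.C) f u v) (f.natDegree - 1) := by
  refine WD.sum _ _ fun n hn => ?_
  refine WD.mul_C_C (WD.sum _ _ fun s hs => ?_) _
  rw [Finset.mem_range] at hn hs
  exact ((hu.pow s).mul (hv.pow (n - 1 - s))).mono (by omega)

theorem WD.eval₂_C {f : k[X]} {u : k[X][X]} (hu : WD 1 u 1) :
    WD 1 (f.eval₂ (Polynomial.C.comp Polynomial.C) u) f.natDegree := by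
  rw [eval₂_eq_sum_range]
  refine WD.sum _ _ fun n hn => ?_
  refine WD.mul_C_C ?_ _
  rw [Finset.mem_range] at hn
  exact (hu.pow n).mono (by omega)

theorem WD.natDegree_le {P : k[X][X]} {m : ℕ} (h : WD 1 P m) : P.natDegree ≤ m := by
  by_cases hP : P = 0
  · simp [hP]
  · have := h P.natDegree (by rwa [Ne, coeff_natDegree, leadingCoeff_eq_zero])
    omega

theorem evalEval_eval₂_C (f : k[X]) (u : k[X][X]) (x y : k) :
    (f.eval₂ (C.comp C) u).evalEval x y = f.eval (u.evalEval x y) := by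
  have := hom_eval₂ f (C.comp C) (evalEvalRingHom x y) u
  have e : (evalEvalRingHom x y).comp (C.comp C) = RingHom.id k := by
    ext a; simp
  rwa [e] at this

theorem evalEval_divDiff (f : k[X]) (u v : k[X][X]) (x y : k) :
    (divDiff (C.comp C) f u v).evalEval x y =
      divDiff (RingHom.id k) f (u.evalEval x y) (v.evalEval x y) := by
  have := map_divDiff (evalEvalRingHom x y) (C.comp C) f u v
  have e : (evalEvalRingHom x y).comp (C.comp C) = RingHom.id k := by
    ext a; simp
  rwa [e] at this

/-- The linear form `c * X + t * Y`. -/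
noncomputable def linForm (c t : k) : k[X][X] := C (C c * X) + C (C t) * X

theorem WD.linForm (c t : k) : WD 1 (linForm c t) 1 :=
  (WD.C ((natDegree_C_mul_le _ _).trans natDegree_X_le)).add (WD.X.mul_C_C t)

theorem evalEval_linForm (c t x y : k) : (linForm c t).evalEval x y = c * x + t * y := by
  simp [_root_.linForm, evalEval]

theorem coeff_divDiff_linForm {f : k[X]} (hf : f.Monic) (hf0 : 0 < f.natDegree) (c t : k) :
    (divDiff (C.comp C) f (linForm c t) X).coeff (f.natDegree - 1) =
      C (∑ s ∈ Finset.range f.natDegree, t ^ s) := by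
  have hl : (linForm c t).natDegree ≤ 1 := (WD.linForm c t).natDegree_le
  have hc : (linForm c t).coeff 1 = C t := by simp [linForm]
  rw [divDiff, Finset.sum_range_succ, coeff_add, finsetSum_coeff, Finset.sum_eq_zero, zero_add,
    hf.coeff_natDegree, map_one, one_mul, finsetSum_coeff, map_sum]
  · refine Finset.sum_congr rfl fun s hs => ?_
    rw [Finset.mem_range] at hs
    have e : f.natDegree - 1 = s * 1 + (f.natDegree - 1 - s) := by omega
    have := coeff_pow_of_natDegree_le (m := s) hl
    nth_rewrite 2 [e]
    rw [coeff_mul_X_pow]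
    rw [this, hc, map_pow]
  · intro n hn
    rw [Finset.mem_range] at hn
    rcases Nat.eq_zero_or_pos n with rfl | hn0
    · simp
    apply coeff_eq_zero_of_natDegree_lt
    have h1 : WD 1 ((C.comp C) (f.coeff n) * ∑ s ∈ Finset.range n,
        linForm c t ^ s * X ^ (n - 1 - s)) (n - 1) := by
      refine WD.mul_C_C (WD.sum _ _ fun s hs => ?_) _
      rw [Finset.mem_range] at hs
      exact (((WD.linForm c t).pow s).mul (WD.X.pow (n - 1 - s))).mono (by omega)
    have := h1.natDegree_le
    omega
end DividedDifference

end

section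
open Polynomial

section Shear
variable {p : ℕ} [Fact p.Prime]

theorem sum_zeros_shear {a b : ZMod p} (ha : a ≠ 0) {Φ : (ZMod p)[X][X]}
    {Q : ZMod p × ZMod p → Prop} [DecidablePred Q]
    (hQ : ∀ x y, Q (x, y) ↔ Φ.evalEval (a * x + b * y) y = 0) (ψ : ZMod p → ℂ) :
    ∑ z with Q z, ψ (a * z.1 + b * z.2) =
      ∑ z : ZMod p × ZMod p with Φ.evalEval z.1 z.2 = 0, ψ z.1 := by
  refine Finset.sum_bij' (fun z _ => (a * z.1 + b * z.2, z.2))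
    (fun z _ => (a⁻¹ * (z.1 - b * z.2), z.2)) (fun z hz => ?_) (fun z hz => ?_) (fun z _ => ?_)
    (fun z _ => ?_) fun z _ => rfl
  · rw [Finset.mem_filter] at hz ⊢
    exact ⟨Finset.mem_univ _, (hQ _ _).1 hz.2⟩
  · rw [Finset.mem_filter] at hz ⊢
    refine ⟨Finset.mem_univ _, (hQ _ _).2 ?_⟩
    rw [mul_inv_cancel_left₀ ha, sub_add_cancel]
    exact hz.2
  · ext <;> simp [ha]
  · ext <;> simp [ha]

theorem evalEval_linForm_shear {a b : ZMod p} (ha : a ≠ 0) (x y : ZMod p) :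
    (linForm a⁻¹ (-(b / a))).evalEval (a * x + b * y) y = x := by
  rw [evalEval_linForm]
  field_simp
  ring

/-- The curve `g(Y) = f(c X + t Y)`. -/
theorem monic_map_C_sub {k : Type*} [Field k] {f g : k[X]} (hg : g.Monic)
    (hfg : f.natDegree < g.natDegree) (c t : k) :
    (g.map C - f.eval₂ (C.comp C) (linForm c t)).Monic ∧
    (g.map C - f.eval₂ (C.comp C) (linForm c t)).natDegree = g.natDegree ∧
    WD 1 (g.map C - f.eval₂ (C.comp C) (linForm c t)) g.natDegree := by
  have hW := WD.eval₂_C (f := f) (WD.linForm c t)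
  have hlt := hW.natDegree_le.trans_lt hfg
  have hd : (g.map (C : k →+* k[X])).natDegree = g.natDegree := hg.natDegree_map _
  have hlt' : (f.eval₂ (C.comp C) (linForm c t)).natDegree < (g.map (C : k →+* k[X])).natDegree := by
    rwa [hd]
  refine ⟨(hg.map _).sub_of_left (degree_lt_degree hlt'), ?_, ?_⟩
  · rw [natDegree_sub_eq_left_of_natDegree_lt hlt', hd]
  · refine WD.sub (fun i hi => ?_) (hW.mono hfg.le)
    rw [coeff_map] at hi ⊢
    rw [natDegree_C, zero_add, one_mul]
    exact le_natDegree_of_ne_zero fun h0 => hi (by rw [h0, map_zero])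

theorem norm_sum_eval_eq_eval_le {f g : (ZMod p)[X]} (hg : g.Monic)
    (hfg : f.natDegree < g.natDegree) (hsq : g.natDegree ^ 2 ≤ p) {a : ZMod p} (ha : a ≠ 0)
    (b : ZMod p) {ψ : AddChar (ZMod p) ℂ} (hψ : ψ ≠ 1) :
    ‖∑ z : ZMod p × ZMod p with f.eval z.1 = g.eval z.2, ψ (a * z.1 + b * z.2)‖ ≤
      6 * g.natDegree ^ 2 * √p := by
  obtain ⟨hm, hd, hW⟩ := monic_map_C_sub hg hfg a⁻¹ (-(b / a))
  rw [sum_zeros_shear ha (Φ := g.map C - f.eval₂ (C.comp C) (linForm a⁻¹ (-(b / a)))) _ ψ]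
  · exact norm_sum_zeros_le_of_ne_one hm hd hsq hW hψ
  · intro x y
    rw [← coe_evalEvalRingHom, map_sub, coe_evalEvalRingHom, evalEval_eval₂_C,
      evalEval_linForm_shear ha, evalEval_map_C, sub_eq_zero, eq_comm]

theorem card_eval_eq_eval_le {f g : (ZMod p)[X]} (hg : g.Monic) (hf : 0 < f.natDegree)
    (hfg : f.natDegree < g.natDegree) (hco : Nat.Coprime f.natDegree g.natDegree)
    (hsq : g.natDegree ^ 2 ≤ p) :
    ((Finset.univ.filter fun z : ZMod p × ZMod p => f.eval z.1 = g.eval z.2).card : ℝ) ≤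
      p + 5 * g.natDegree ^ 2 * √p := by
  obtain ⟨hm, hd, hW⟩ := monic_map_C_sub hg hfg 1 0
  have hC : f.eval₂ (C.comp C) (linForm (1 : ZMod p) 0) = C f := by
    have : (linForm (1 : ZMod p) 0) = C X := by simp [linForm]
    rw [this, ← hom_eval₂, eval₂_C_X]
  have e : (Finset.univ.filter fun z : ZMod p × ZMod p => f.eval z.1 = g.eval z.2) =
      Finset.univ.filter fun z : ZMod p × ZMod p =>
        (g.map C - f.eval₂ (C.comp C) (linForm 1 0)).evalEval z.1 z.2 = 0 := by
    ext z
    rw [Finset.mem_filter, Finset.mem_filter, ← coe_evalEvalRingHom, map_sub, coe_evalEvalRingHom,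
      evalEval_eval₂_C, evalEval_map_C, evalEval_linForm, sub_eq_zero, one_mul, zero_mul, add_zero,
      eq_comm (a := f.eval z.1)]
  rw [e]
  refine (card_zeros_le_of_forall_dvd hm hd hsq hW (hf.trans hfg) fun A hA hdvd hA0 => ?_).trans ?_
  · obtain ⟨B, hB⟩ := hdvd
    rw [hC] at hB hm
    have hBm : B.Monic := hA.of_mul_monic_left (by rw [← hB]; exact hm)
    have hdeg := hA.natDegree_mul hBm
    rw [← hB, ← hC, hd] at hdeg
    rcases natDegree_eq_zero_of_mul_eq_sub hf hco hA hBm hB.symm (hf.trans hfg) with h | h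
    · omega
    · omega
  · have : (g.natDegree : ℝ) ≠ 0 := by
      have := hf.trans hfg
      positivity
    rw [div_self this, one_mul]

/-- The normalised curve `(f(cX + tY) - f(Y)) / (cX + tY - Y) = 0`. -/
theorem exists_monic_divDiff {k : Type*} [Field k] {f : k[X]} (hf : f.Monic)
    (hf0 : 0 < f.natDegree) (c : k) {t : k} (ht : ∑ s ∈ Finset.range f.natDegree, t ^ s ≠ 0) :
    ∃ Φ : k[X][X], Φ.Monic ∧ Φ.natDegree = f.natDegree - 1 ∧ WD 1 Φ (f.natDegree - 1) ∧
      Φ = C (C (∑ s ∈ Finset.range f.natDegree, t ^ s)⁻¹) *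
        divDiff (C.comp C) f (linForm c t) X := by
  have hW : WD 1 (divDiff (C.comp C) f (linForm c t) X) (f.natDegree - 1) :=
    WD.divDiff (WD.linForm c t) WD.X
  have hW' := hW.mul_C_C (∑ s ∈ Finset.range f.natDegree, t ^ s)⁻¹
  have hc : (C (C (∑ s ∈ Finset.range f.natDegree, t ^ s)⁻¹) *
        divDiff (C.comp C) f (linForm c t) X).coeff (f.natDegree - 1) = 1 := by
    rw [coeff_C_mul, coeff_divDiff_linForm hf hf0, ← C_mul, inv_mul_cancel₀ ht, C_1]
  refine ⟨_, monic_of_natDegree_le_of_coeff_eq_one _ hW'.natDegree_le hc, ?_, hW', rfl⟩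
  exact le_antisymm hW'.natDegree_le (le_natDegree_of_ne_zero (by rw [hc]; exact one_ne_zero))

theorem geom_sum_ne_zero_of_prime {i : ℕ} (hi : i.Prime) (hip : i < p) (hi1 : ¬ i ∣ p - 1)
    (t : ZMod p) : ∑ s ∈ Finset.range i, t ^ s ≠ 0 := by
  intro h
  have h1 := geom_sum_mul t i
  rw [h, zero_mul, eq_comm, sub_eq_zero] at h1
  have ht1 : t ≠ 1 := by
    rintro rfl
    simp only [one_pow, Finset.sum_const, Finset.card_range, nsmul_eq_mul, mul_one] at h
    rw [ZMod.natCast_eq_zero_iff] at h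
    exact absurd (Nat.le_of_dvd hi.pos h) (by omega)
  have : Fact i.Prime := ⟨hi⟩
  have ho : orderOf t = i := orderOf_eq_prime h1 ht1
  have ht0 : t ≠ 0 := by
    rintro rfl
    rw [zero_pow hi.ne_zero] at h1
    exact zero_ne_one h1
  apply hi1
  rw [← ho]
  exact orderOf_dvd_of_pow_eq_one (ZMod.pow_card_sub_one_eq_one ht0)

theorem norm_sum_divDiff_le {f : (ZMod p)[X]} (hf : f.Monic) (hfi : f.natDegree.Prime)
    (hfp : ¬ f.natDegree ∣ p - 1) (hsq : f.natDegree ^ 2 ≤ p) {a : ZMod p} (ha : a ≠ 0)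
    (b : ZMod p) {ψ : AddChar (ZMod p) ℂ} (hψ : ψ ≠ 1) :
    ‖∑ z : ZMod p × ZMod p with divDiff (RingHom.id _) f z.1 z.2 = 0, ψ (a * z.1 + b * z.2)‖ ≤
      6 * f.natDegree ^ 2 * √p := by
  have hip : f.natDegree < p := by have := hfi.two_le; nlinarith
  have ht := geom_sum_ne_zero_of_prime hfi hip hfp (-(b / a))
  obtain ⟨Φ, hm, hd, hW, hΦ⟩ := exists_monic_divDiff hf hfi.pos a⁻¹ ht
  rw [sum_zeros_shear ha (Φ := Φ) _ ψ]
  · refine (norm_sum_zeros_le_of_ne_one hm hd ((Nat.pow_le_pow_left (Nat.sub_le _ _) 2).trans hsq)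
      hW hψ).trans ?_
    have : ((f.natDegree - 1 : ℕ) : ℝ) ≤ f.natDegree := by exact_mod_cast Nat.sub_le _ _
    gcongr
  · intro x y
    rw [hΦ, ← coe_evalEvalRingHom, map_mul, coe_evalEvalRingHom, evalEval_divDiff,
      evalEval_linForm_shear ha]
    have : (X : (ZMod p)[X][X]).evalEval (a * x + b * y) y = y := by simp [evalEval]
    rw [this, mul_eq_zero, or_iff_right]
    simpa [evalEval] using ht
end Shear

end

section
open Polynomial

section DiagonalCount
variable {p : ℕ} [Fact p.Prime]

theorem weightedSubst_divDiff {k : Type*} [Field k] {f : k[X]} (hf : f.Monic)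
    (hf0 : 0 < f.natDegree) :
    (weightedSubst k 1 1 (divDiff (C.comp C) f (C X) X)).leadingCoeff =
      ∑ s ∈ Finset.range f.natDegree, X ^ s := by
  have e : weightedSubst k 1 1 (divDiff (C.comp C) f (C X) X) =
      ∑ n ∈ Finset.range (f.natDegree + 1),
        C (C (f.coeff n) * ∑ s ∈ Finset.range n, X ^ (n - 1 - s)) * X ^ (n - 1) := by
    rw [map_divDiff, divDiff, weightedSubst_C, weightedSubst_X]
    refine Finset.sum_congr rfl fun n _ => ?_
    rw [C_mul, mul_assoc, map_sum, Finset.sum_mul]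
    congr 1
    · simp [weightedSubst_C]
    · refine Finset.sum_congr rfl fun s hs => ?_
      rw [Finset.mem_range] at hs
      have : n - 1 = s + (n - 1 - s) := by omega
      have h2 : (X : k[X][X]) ^ (n - 1) = X ^ s * X ^ (n - 1 - s) := by rw [← pow_add, ← this]
      rw [map_X, expand_X, pow_one, mul_pow, C_pow, h2]
      ring
  have hs : ∑ s ∈ Finset.range f.natDegree, (X : k[X]) ^ (f.natDegree - 1 - s) =
      ∑ s ∈ Finset.range f.natDegree, X ^ s := Finset.sum_range_reflect (fun s => (X : k[X]) ^ s) _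
  have hne : ∑ s ∈ Finset.range f.natDegree, (X : k[X]) ^ s ≠ 0 := by
    intro h
    have := congrArg (fun q : k[X] => q.coeff 0) h
    simp only [finsetSum_coeff, coeff_X_pow, coeff_zero] at this
    simp [hf0.ne'] at this
  rw [e, Finset.sum_range_succ, hf.coeff_natDegree, C_1, one_mul, hs, leadingCoeff_add_of_degree_lt]
  · rw [leadingCoeff_mul, leadingCoeff_C, leadingCoeff_X_pow, mul_one]
  · rw [degree_C_mul_X_pow _ hne]
    rw [degree_lt_iff_coeff_zero]
    intro m hm
    rw [finsetSum_coeff]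
    refine Finset.sum_eq_zero fun n hn => ?_
    rw [Finset.mem_range] at hn
    rw [coeff_C_mul, coeff_X_pow]
    rcases Nat.eq_zero_or_pos n with rfl | hn0
    · simp
    · rw [if_neg (by omega), mul_zero]

/-- A positive-degree divisor of `1 + X + ... + X^(i-1)` over the prime field forces `i` to divide
`p^m - 1` for some `m` up to its degree. -/
theorem exists_dvd_pow_sub_one {i : ℕ} (hi : i.Prime) (hip : i < p) {q : (ZMod p)[X]}
    (hq : q.Monic) (hq0 : 0 < q.natDegree) (hdvd : q ∣ ∑ s ∈ Finset.range i, X ^ s) :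
    ∃ m, 1 ≤ m ∧ m ≤ q.natDegree ∧ i ∣ p ^ m - 1 := by
  obtain ⟨r, hrm, hr, hrq⟩ := exists_monic_irreducible_factor q
    (fun hu => by rw [hq.isUnit_iff.1 hu] at hq0; simp at hq0)
  refine ⟨r.natDegree, hr.natDegree_pos, natDegree_le_of_dvd hrq hq.ne_zero, ?_⟩
  have : Fact (Irreducible r) := ⟨hr⟩
  have : Module.Finite (ZMod p) (AdjoinRoot r) := hrm.finite_adjoinRoot
  have : Finite (AdjoinRoot r) := Module.finite_of_finite (ZMod p)
  have : Fintype (AdjoinRoot r) := Fintype.ofFinite _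
  have hcard : Fintype.card (AdjoinRoot r) = p ^ r.natDegree := by
    rw [Module.card_eq_pow_finrank (K := ZMod p), ZMod.card,
      (AdjoinRoot.powerBasis' hrm).finrank, AdjoinRoot.powerBasis'_dim]
  set z := AdjoinRoot.root r
  have hz : ∑ s ∈ Finset.range i, z ^ s = 0 := by
    have h := AdjoinRoot.mk_eq_zero.2 (hrq.trans hdvd)
    rw [map_sum] at h
    simpa using h
  have h1 := geom_sum_mul z i
  rw [hz, zero_mul, eq_comm, sub_eq_zero] at h1
  have : CharP (AdjoinRoot r) p :=
    charP_of_injective_algebraMap (algebraMap (ZMod p) (AdjoinRoot r)).injective p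
  have hz1 : z ≠ 1 := by
    intro h
    rw [h] at hz
    simp only [one_pow, Finset.sum_const, Finset.card_range, nsmul_eq_mul, mul_one] at hz
    rw [CharP.cast_eq_zero_iff (AdjoinRoot r) p] at hz
    exact absurd (Nat.le_of_dvd hi.pos hz) (by omega)
  have : Fact i.Prime := ⟨hi⟩
  have ho : orderOf z = i := orderOf_eq_prime h1 hz1
  have hz0 : z ≠ 0 := by
    intro h
    rw [h, zero_pow hi.ne_zero] at h1
    exact zero_ne_one h1
  rw [← ho, ← hcard]
  exact orderOf_dvd_of_pow_eq_one (FiniteField.pow_card_sub_one_eq_one z hz0)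

theorem card_divDiff_le {f : (ZMod p)[X]} (hf : f.Monic) (hfi : f.natDegree.Prime)
    (hsq : f.natDegree ^ 2 ≤ p) {M : ℕ} (hM : 0 < M)
    (hfM : ∀ m, 1 ≤ m → m < M → ¬ f.natDegree ∣ p ^ m - 1) :
    ((Finset.univ.filter fun z : ZMod p × ZMod p => divDiff (RingHom.id _) f z.1 z.2 = 0).card : ℝ)
      ≤ f.natDegree / M * p + 5 * f.natDegree ^ 2 * √p := by
  have hip : f.natDegree < p := by have := hfi.two_le; nlinarith
  have hsum : ∑ s ∈ Finset.range f.natDegree, (0 : ZMod p) ^ s = 1 := by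
    rw [← Nat.sub_add_cancel hfi.one_le, Finset.sum_range_succ']
    simp
  obtain ⟨Φ, hm, hd, hW, hΦ⟩ := exists_monic_divDiff hf hfi.pos 1 (t := (0 : ZMod p))
    (by rw [hsum]; exact one_ne_zero)
  have hlin : linForm (1 : ZMod p) 0 = C X := by simp [linForm]
  rw [hsum, inv_one, C_1, C_1, one_mul, hlin] at hΦ
  have e : (Finset.univ.filter fun z : ZMod p × ZMod p => divDiff (RingHom.id _) f z.1 z.2 = 0) =
      Finset.univ.filter fun z : ZMod p × ZMod p => Φ.evalEval z.1 z.2 = 0 := by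
    ext z
    rw [Finset.mem_filter, Finset.mem_filter, hΦ, evalEval_divDiff]
    simp [evalEval]
  rw [e]
  have hle : ((f.natDegree - 1 : ℕ) : ℝ) ≤ f.natDegree := by exact_mod_cast Nat.sub_le _ _
  refine (card_zeros_le_of_forall_dvd hm hd ((Nat.pow_le_pow_left (Nat.sub_le _ _) 2).trans hsq)
    hW hM fun A hA hdvd hA0 => ?_).trans (by gcongr)
  obtain ⟨B, hB⟩ := hdvd
  have hBm : B.Monic := hA.of_mul_monic_left (by rw [← hB]; exact hm)
  have hWAB : WD 1 (A * B) (A * B).natDegree := by rw [← hB, hd]; exact hW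
  have hAd : (weightedSubst (ZMod p) 1 1 A).natDegree = A.natDegree := by
    rw [natDegree_weightedSubst_of_mul one_pos hA hBm fun j hj => by simpa using hWAB j hj, one_mul]
  set q := (weightedSubst (ZMod p) 1 1 A).leadingCoeff with hq
  have hqc : ∀ j, q.coeff j = if j ≤ A.natDegree then (A.coeff j).coeff (A.natDegree - j) else 0 :=
    fun j => by
      rw [hq, leadingCoeff, hAd, coeff_coeff_weightedSubst, expand_one, one_mul]
  have hq1 : q.coeff A.natDegree = 1 := by
    rw [hqc, if_pos le_rfl, hA.coeff_natDegree, Nat.sub_self, coeff_one_zero]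
  have hqle : q.natDegree ≤ A.natDegree := by
    rw [natDegree_le_iff_coeff_eq_zero]
    intro j hj
    rw [hqc, if_neg (by omega)]
  have hqm : q.Monic := monic_of_natDegree_le_of_coeff_eq_one _ hqle hq1
  have hqd : q.natDegree = A.natDegree :=
    le_antisymm hqle (le_natDegree_of_ne_zero (by rw [hq1]; exact one_ne_zero))
  have hdvd := leadingCoeff_weightedSubst_dvd hB.symm 1 1
  rw [hΦ, weightedSubst_divDiff hf hfi.pos] at hdvd
  obtain ⟨m, hm1, hm2, hm3⟩ := exists_dvd_pow_sub_one hfi hip hqm (by omega) hdvd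
  by_contra! hlt
  exact hfM m hm1 (by omega) hm3
end DiagonalCount

end

section
open Polynomial

section Weight
variable {p : ℕ} [Fact p.Prime]

/-- The normalised convolution square of the indicator function of an interval of length `H`. -/
noncomputable def triWeight (p H : ℕ) (L : ZMod p) (x : ZMod p) : ℝ :=
  (∑ u ∈ Finset.range H, ∑ v ∈ Finset.range H, if x = L + u + v then 1 else 0) / H

variable {H : ℕ} (L : ZMod p)

theorem sum_triWeight : ∑ x, triWeight p H L x = H := by
  simp only [triWeight]
  rw [← Finset.sum_div, Finset.sum_comm]
  simp_rw [Finset.sum_comm (s := Finset.univ) (t := Finset.range H)]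
  simp

theorem triWeight_nonneg (x : ZMod p) : 0 ≤ triWeight p H L x :=
  div_nonneg (Finset.sum_nonneg fun _ _ => Finset.sum_nonneg fun _ _ => by split_ifs <;> simp)
    (Nat.cast_nonneg _)

theorem natCast_injOn_range (hHp : H ≤ p) :
    Set.InjOn (fun n : ℕ => (n : ZMod p)) (Finset.range H) := by
  intro u hu v hv huv
  rw [Finset.coe_range, Set.mem_Iio] at hu hv
  exact Nat.ModEq.eq_of_lt_of_lt ((ZMod.natCast_eq_natCast_iff _ _ _).1 huv) (by omega) (by omega)

theorem triWeight_le_one (hHp : H ≤ p) (x : ZMod p) : triWeight p H L x ≤ 1 := by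
  refine div_le_one_of_le₀ ?_ (Nat.cast_nonneg _)
  calc _ ≤ ∑ u ∈ Finset.range H, (1 : ℝ) := Finset.sum_le_sum fun u _ => ?_
    _ = H := by simp
  rw [Finset.sum_boole]
  norm_cast
  rw [Finset.card_le_one]
  intro a ha b hb
  rw [Finset.mem_filter] at ha hb
  exact natCast_injOn_range hHp (by simpa using ha.1) (by simpa using hb.1)
    (add_left_cancel (ha.2.symm.trans hb.2))

theorem exists_of_triWeight_ne_zero {x : ZMod p} (h : triWeight p H L x ≠ 0) :
    ∃ n < 2 * H, x = L + (n : ℕ) := by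
  rw [triWeight] at h
  have h1 := (div_ne_zero_iff.1 h).1
  obtain ⟨u, hu, hu'⟩ := Finset.exists_ne_zero_of_sum_ne_zero h1
  obtain ⟨v, hv, hv'⟩ := Finset.exists_ne_zero_of_sum_ne_zero hu'
  rw [Finset.mem_range] at hu hv
  refine ⟨u + v, by omega, ?_⟩
  by_contra hne
  exact hv' (if_neg fun h => hne (by rw [h]; push_cast; ring))

theorem sum_sq_triWeight_sub_le (hHp : H ≤ p) :
    ∑ x, (triWeight p H L x - H / p) ^ 2 ≤ H := by
  have hp : (p : ℝ) ≠ 0 := by exact_mod_cast (Fact.out : p.Prime).ne_zero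
  have h1 : ∑ x, (triWeight p H L x - H / p) ^ 2 =
      ∑ x, triWeight p H L x ^ 2 - H ^ 2 / p := by
    simp_rw [sub_sq]
    rw [Finset.sum_add_distrib, Finset.sum_sub_distrib, ← Finset.sum_mul, ← Finset.mul_sum,
      sum_triWeight L]
    simp only [Finset.sum_const, Finset.card_univ, ZMod.card, nsmul_eq_mul]
    field_simp
    ring
  have h2 : ∑ x, triWeight p H L x ^ 2 ≤ H := by
    rw [← sum_triWeight L]
    refine Finset.sum_le_sum fun x _ => ?_
    have := triWeight_nonneg (H := H) L x
    have := triWeight_le_one L hHp x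
    nlinarith
  have : (0 : ℝ) ≤ H ^ 2 / p := by positivity
  linarith

variable {ψ : AddChar (ZMod p) ℂ}

/-- The Fourier coefficients of `triWeight`. -/
noncomputable def triCoeff (ψ : AddChar (ZMod p) ℂ) (H : ℕ) (L a : ZMod p) : ℂ :=
  ψ (-(a * L)) * (∑ u ∈ Finset.range H, ψ (-(a * u))) ^ 2 / H

theorem triWeight_eq_sum (hψ : ψ.IsPrimitive) (x : ZMod p) :
    (triWeight p H L x : ℂ) = (∑ a, triCoeff ψ H L a * ψ (a * x)) / p := by
  have hp : (p : ℂ) ≠ 0 := by exact_mod_cast (Fact.out : p.Prime).ne_zero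
  have key : ∀ u v : ℕ, ((if x = L + u + v then 1 else 0 : ℝ) : ℂ) =
      (∑ a, ψ (a * (x - L - u - v))) / p := fun u v => by
    rw [AddChar.sum_mulShift _ hψ, ZMod.card]
    by_cases h : x = L + u + v
    · rw [if_pos h, if_pos (by rw [h]; ring)]; simp [hp]
    · rw [if_neg h, if_neg fun h0 => h (by linear_combination h0)]; simp
  rw [triWeight]
  push_cast
  simp_rw [key]
  simp_rw [← Finset.sum_div]
  rw [div_right_comm]
  congr 1
  simp_rw [Finset.sum_comm (s := Finset.range H) (t := Finset.univ)]
  rw [Finset.sum_div]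
  refine Finset.sum_congr rfl fun a _ => ?_
  rw [triCoeff, div_mul_eq_mul_div]
  congr 1
  rw [sq, Finset.sum_mul_sum, Finset.mul_sum, Finset.sum_mul]
  refine Finset.sum_congr rfl fun u _ => ?_
  rw [Finset.mul_sum, Finset.sum_mul]
  refine Finset.sum_congr rfl fun v _ => ?_
  rw [← AddChar.map_add_eq_mul, ← AddChar.map_add_eq_mul, ← AddChar.map_add_eq_mul]
  congr 1
  ring

theorem triCoeff_zero (hH : 0 < H) : triCoeff ψ H L 0 = H := by
  have : (H : ℂ) ≠ 0 := by exact_mod_cast hH.ne'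
  simp [triCoeff]
  field_simp

theorem sum_norm_triCoeff (hψ : ψ.IsPrimitive) (hH : 0 < H) (hHp : H ≤ p) :
    ∑ a, ‖triCoeff ψ H L a‖ = p := by
  have hH' : (H : ℂ) ≠ 0 := by exact_mod_cast hH.ne'
  have h1 : ∀ a, ((‖triCoeff ψ H L a‖ : ℝ) : ℂ) =
      (∑ u ∈ Finset.range H, ∑ v ∈ Finset.range H, ψ (a * (v - u))) / H := fun a => by
    rw [triCoeff, norm_div, norm_mul, AddChar.norm_apply, one_mul, norm_pow]
    push_cast
    rw [← Complex.mul_conj', map_sum, Finset.sum_mul_sum]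
    congr 1
    · refine Finset.sum_congr rfl fun u _ => Finset.sum_congr rfl fun v _ => ?_
      rw [← AddChar.map_neg_eq_conj, ← AddChar.map_add_eq_mul]
      congr 1
      ring
    · simp
  have h2 : ((∑ a, ‖triCoeff ψ H L a‖ : ℝ) : ℂ) = (p : ℝ) := by
    push_cast
    simp_rw [h1]
    rw [← Finset.sum_div, Finset.sum_comm]
    simp_rw [Finset.sum_comm (s := Finset.univ) (t := Finset.range H),
      AddChar.sum_mulShift _ hψ, ZMod.card, sub_eq_zero]
    have h3 : ∀ u ∈ Finset.range H, ∑ v ∈ Finset.range H,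
        (((if (v : ZMod p) = u then p else 0 : ℕ)) : ℂ) = p := fun u hu => by
      rw [Finset.sum_eq_single_of_mem u hu fun v hv hne => ?_, if_pos rfl]
      rw [if_neg fun h => hne (natCast_injOn_range hHp hv hu h), Nat.cast_zero]
    rw [div_eq_iff hH', Finset.sum_congr rfl h3]
    simp [mul_comm]
  exact_mod_cast h2

theorem abs_sum_triWeight_mul_le (hψ : ψ.IsPrimitive) (hH : 0 < H) (hHp : H ≤ p)
    (Z : Finset (ZMod p × ZMod p)) {B : ℝ}
    (hB : ∀ a b : ZMod p, a ≠ 0 → b ≠ 0 → ‖∑ z ∈ Z, ψ (a * z.1 + b * z.2)‖ ≤ B) :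
    |∑ z ∈ Z, (triWeight p H L z.1 - H / p) * (triWeight p H L z.2 - H / p)| ≤ B := by
  have hp : (0 : ℝ) < p := by exact_mod_cast (Fact.out : p.Prime).pos
  have hp' : (p : ℂ) ≠ 0 := by exact_mod_cast hp.ne'
  set S : Finset (ZMod p) := Finset.univ.erase 0 with hS
  set c := triCoeff ψ H L
  have hg : ∀ x, ((triWeight p H L x - H / p : ℝ) : ℂ) = (∑ a ∈ S, c a * ψ (a * x)) / p := fun x => by
    push_cast
    rw [triWeight_eq_sum L hψ, ← Finset.add_sum_erase _ _ (Finset.mem_univ 0), triCoeff_zero L hH]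
    simp only [zero_mul, AddChar.map_zero_eq_one, mul_one]
    rw [add_div, add_sub_cancel_left]
  have h0 : (((∑ z ∈ Z, (triWeight p H L z.1 - H / p) * (triWeight p H L z.2 - H / p) : ℝ)) : ℂ) =
      (∑ a ∈ S, ∑ b ∈ S, c a * c b * ∑ z ∈ Z, ψ (a * z.1 + b * z.2)) / p ^ 2 := by
    rw [Complex.ofReal_sum]
    simp_rw [Complex.ofReal_mul, hg, div_mul_div_comm, ← sq, Finset.sum_mul_sum]
    rw [← Finset.sum_div, Finset.sum_comm]
    congr 1
    refine Finset.sum_congr rfl fun a _ => ?_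
    rw [Finset.sum_comm]
    refine Finset.sum_congr rfl fun b _ => ?_
    rw [Finset.mul_sum]
    refine Finset.sum_congr rfl fun z _ => ?_
    rw [AddChar.map_add_eq_mul]
    ring
  have hB0 : 0 ≤ B := (norm_nonneg _).trans (hB 1 1 one_ne_zero one_ne_zero)
  rw [← Real.norm_eq_abs, ← Complex.norm_real, h0, norm_div, norm_pow, Complex.norm_natCast,
    div_le_iff₀ (by positivity)]
  have hsum : ∑ a ∈ S, ‖c a‖ ≤ p := by
    rw [← sum_norm_triCoeff L hψ hH hHp]
    exact Finset.sum_le_sum_of_subset_of_nonneg (Finset.subset_univ _) fun _ _ _ => norm_nonneg _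
  calc ‖∑ a ∈ S, ∑ b ∈ S, c a * c b * ∑ z ∈ Z, ψ (a * z.1 + b * z.2)‖
      ≤ ∑ a ∈ S, ∑ b ∈ S, ‖c a‖ * ‖c b‖ * B := by
        refine norm_sum_le_of_le _ fun a ha => norm_sum_le_of_le _ fun b hb => ?_
        rw [norm_mul, norm_mul]
        gcongr
        exact hB a b (Finset.ne_of_mem_erase ha) (Finset.ne_of_mem_erase hb)
    _ = B * (∑ a ∈ S, ‖c a‖) ^ 2 := by
        rw [sq, Finset.sum_mul_sum, Finset.mul_sum]
        refine Finset.sum_congr rfl fun a _ => ?_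
        rw [Finset.mul_sum]
        exact Finset.sum_congr rfl fun b _ => by ring
    _ ≤ B * p ^ 2 := by gcongr
end Weight

end

section
open Polynomial

section SecondMoment
variable {X Λ ι : Type*} [Fintype X] [Fintype Λ] [DecidableEq Λ]

theorem sum_sq_fiber_sum (J : Finset ι) (F : ι → X → Λ) (g : X → ℝ) :
    ∑ l, (∑ i ∈ J, ∑ x with F i x = l, g x) ^ 2 =
      ∑ i ∈ J, ∑ j ∈ J, ∑ z : X × X with F i z.1 = F j z.2, g z.1 * g z.2 := by
  simp_rw [sq, Finset.sum_mul_sum]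
  rw [Finset.sum_comm]
  refine Finset.sum_congr rfl fun i _ => ?_
  rw [Finset.sum_comm]
  refine Finset.sum_congr rfl fun j _ => ?_
  simp_rw [Finset.sum_filter, Fintype.sum_prod_type]
  simp_rw [Finset.sum_comm (s := (Finset.univ : Finset Λ)) (t := (Finset.univ : Finset X))]
  refine Finset.sum_congr rfl fun x _ => ?_
  rw [Finset.sum_ite_eq, if_pos (Finset.mem_univ _)]
  simp_rw [eq_comm]

/-- Cauchy-Schwarz lower bound for the support of a sum of push-forwards of a weight. -/
theorem sq_sum_le_card_mul (J : Finset ι) (F : ι → X → Λ) (w : X → ℝ) (μ : ℝ) (U : Finset Λ)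
    (hU : ∀ i ∈ J, ∀ x, w x ≠ 0 → F i x ∈ U) :
    (J.card * ∑ x, w x) ^ 2 ≤ U.card *
      (2 * ∑ i ∈ J, ∑ j ∈ J, ∑ z : X × X with F i z.1 = F j z.2, (w z.1 - μ) * (w z.2 - μ) +
        2 * μ ^ 2 * ∑ i ∈ J, ∑ j ∈ J,
          ((Finset.univ.filter fun z : X × X => F i z.1 = F j z.2).card : ℝ)) := by
  set R : Λ → ℝ := fun l => ∑ i ∈ J, ∑ x with F i x = l, w x
  set V : Λ → ℝ := fun l => ∑ i ∈ J, ∑ x with F i x = l, (w x - μ)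
  set n : Λ → ℝ := fun l => ∑ i ∈ J, ∑ x with F i x = l, 1
  have hR : ∀ l, R l = V l + μ * n l := fun l => by
    simp only [R, V, n]
    rw [Finset.mul_sum, ← Finset.sum_add_distrib]
    refine Finset.sum_congr rfl fun i _ => ?_
    rw [Finset.mul_sum, ← Finset.sum_add_distrib]
    exact Finset.sum_congr rfl fun x _ => by ring
  have h1 : J.card * ∑ x, w x = ∑ l ∈ U, R l := by
    rw [Finset.sum_comm, ← nsmul_eq_mul, ← Finset.sum_const]
    refine Finset.sum_congr rfl fun i hi => ?_
    have h : ∑ l, ∑ x with F i x = l, w x = ∑ x, w x :=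
      Finset.sum_fiberwise _ _ _
    rw [← h]
    symm
    refine Finset.sum_subset (Finset.subset_univ _) fun l _ hl => Finset.sum_eq_zero fun x hx => ?_
    by_contra h0
    exact hl ((Finset.mem_filter.1 hx).2 ▸ hU i hi x h0)
  have h2 : ∑ l ∈ U, R l ^ 2 ≤ 2 * ∑ l, V l ^ 2 + 2 * μ ^ 2 * ∑ l, n l ^ 2 := by
    calc ∑ l ∈ U, R l ^ 2 ≤ ∑ l, R l ^ 2 :=
          Finset.sum_le_sum_of_subset_of_nonneg (Finset.subset_univ _) fun _ _ _ => sq_nonneg _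
      _ ≤ ∑ l, (2 * V l ^ 2 + 2 * μ ^ 2 * n l ^ 2) := Finset.sum_le_sum fun l _ => by
          rw [hR]
          nlinarith [sq_nonneg (V l - μ * n l)]
      _ = _ := by rw [Finset.sum_add_distrib, Finset.mul_sum, Finset.mul_sum]
  rw [sum_sq_fiber_sum, sum_sq_fiber_sum] at h2
  rw [h1]
  refine sq_sum_le_card_mul_sum_sq.trans (mul_le_mul_of_nonneg_left (h2.trans (le_of_eq ?_))
    (Nat.cast_nonneg _))
  congr 2
  simp
end SecondMoment

section MainInequality
variable {p : ℕ} [Fact p.Prime]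

/-- The product `(X + 1) ... (X + i)`. -/
noncomputable def risingPoly (p i : ℕ) : (ZMod p)[X] := ∏ s ∈ Finset.range i, (X + C ((s : ZMod p) + 1))

theorem risingPoly_monic (i : ℕ) : (risingPoly p i).Monic :=
  monic_prod_of_monic _ _ fun _ _ => monic_X_add_C _

theorem natDegree_risingPoly (i : ℕ) : (risingPoly p i).natDegree = i := by
  rw [risingPoly, natDegree_prod_of_monic _ _ fun _ _ => monic_X_add_C _]
  simp only [natDegree_X_add_C]
  simp

theorem norm_sum_risingPoly_ne_le {i j K : ℕ} (hij : i ≠ j) (hi : i ≤ K) (hj : j ≤ K)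
    (hK : K ^ 2 ≤ p) {ψ : AddChar (ZMod p) ℂ} (hψ : ψ ≠ 1) {a b : ZMod p} (ha : a ≠ 0)
    (hb : b ≠ 0) :
    ‖∑ z : ZMod p × ZMod p with (risingPoly p i).eval z.1 = (risingPoly p j).eval z.2,
      ψ (a * z.1 + b * z.2)‖ ≤ 6 * K ^ 2 * √p := by
  wlog hlt : i < j generalizing i j a b
  · have := this hij.symm hj hi hb ha (by omega)
    refine le_trans (le_of_eq (congrArg _ ?_)) this
    refine Finset.sum_equiv (Equiv.prodComm _ _) (fun z => ?_) fun z _ => ?_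
    · simp [eq_comm]
    · simp [add_comm]
  have h := norm_sum_eval_eq_eval_le (f := risingPoly p i) (risingPoly_monic (p := p) j)
    (by rwa [natDegree_risingPoly, natDegree_risingPoly])
    (by rw [natDegree_risingPoly]; exact (Nat.pow_le_pow_left hj 2).trans hK) ha b hψ
  rw [natDegree_risingPoly] at h
  have : (j : ℝ) ≤ K := by exact_mod_cast hj
  exact h.trans (by gcongr)

theorem card_risingPoly_ne_le {i j K : ℕ} (hip : i.Prime) (hjp : j.Prime) (hij : i ≠ j)
    (hi : i ≤ K) (hj : j ≤ K) (hK : K ^ 2 ≤ p) :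
    ((Finset.univ.filter fun z : ZMod p × ZMod p =>
      (risingPoly p i).eval z.1 = (risingPoly p j).eval z.2).card : ℝ) ≤ p + 5 * K ^ 2 * √p := by
  wlog hlt : i < j generalizing i j
  · have := this hjp hip hij.symm hj hi (by omega)
    refine le_trans (le_of_eq (congrArg _ ?_)) this
    refine Finset.card_equiv (Equiv.prodComm _ _) fun z => ?_
    simp [eq_comm]
  have h := card_eval_eq_eval_le (f := risingPoly p i) (risingPoly_monic (p := p) j)
    (by rw [natDegree_risingPoly]; exact hip.pos)
    (by rwa [natDegree_risingPoly, natDegree_risingPoly])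
    (by rw [natDegree_risingPoly, natDegree_risingPoly]; exact (Nat.coprime_primes hip hjp).2 hij)
    (by rw [natDegree_risingPoly]; exact (Nat.pow_le_pow_left hj 2).trans hK)
  rw [natDegree_risingPoly] at h
  have : (j : ℝ) ≤ K := by exact_mod_cast hj
  exact h.trans (by gcongr)

theorem filter_eval_eq_subset (f : (ZMod p)[X]) :
    (Finset.univ.filter fun z : ZMod p × ZMod p => f.eval z.1 = f.eval z.2) =
      (Finset.univ.filter fun z : ZMod p × ZMod p => divDiff (RingHom.id _) f z.1 z.2 = 0) ∪
      (Finset.univ.filter fun z : ZMod p × ZMod p => z.1 = z.2) := by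
  ext z
  have := divDiff_mul (RingHom.id (ZMod p)) f z.1 z.2
  simp only [Finset.mem_filter, Finset.mem_union, Finset.mem_univ, true_and]
  rw [← sub_eq_zero (a := f.eval z.1), ← sub_eq_zero (a := z.1), ← mul_eq_zero, this]
  rfl

theorem card_filter_fst_eq_snd :
    (Finset.univ.filter fun z : ZMod p × ZMod p => z.1 = z.2).card = p := by
  have : (Finset.univ.filter fun z : ZMod p × ZMod p => z.1 = z.2) = Finset.univ.diag := by
    ext ⟨x, y⟩; simp
  rw [this, Finset.diag_card, Finset.card_univ, ZMod.card]

theorem card_risingPoly_self_le {i K M : ℕ} (hip : i.Prime) (hi : i ≤ K) (hK : K ^ 2 ≤ p)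
    (hM : 0 < M) (hiM : ∀ m, 1 ≤ m → m < M → ¬ i ∣ p ^ m - 1) :
    ((Finset.univ.filter fun z : ZMod p × ZMod p =>
      (risingPoly p i).eval z.1 = (risingPoly p i).eval z.2).card : ℝ) ≤
      p + 5 * K ^ 2 * √p + K / M * p := by
  have h := card_divDiff_le (risingPoly_monic (p := p) i) (by rwa [natDegree_risingPoly])
    (by rw [natDegree_risingPoly]; exact (Nat.pow_le_pow_left hi 2).trans hK) hM
    (by rwa [natDegree_risingPoly])
  rw [natDegree_risingPoly] at h
  have hiK : (i : ℝ) ≤ K := by exact_mod_cast hi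
  have h2 : (i / M * p + 5 * i ^ 2 * √p : ℝ) ≤ K / M * p + 5 * K ^ 2 * √p := by gcongr
  rw [filter_eval_eq_subset]
  have h3 := Finset.card_union_le
    (Finset.univ.filter fun z : ZMod p × ZMod p => divDiff (RingHom.id _) (risingPoly p i) z.1 z.2 = 0)
    (Finset.univ.filter fun z : ZMod p × ZMod p => z.1 = z.2)
  rw [card_filter_fst_eq_snd] at h3
  have h4 := (Nat.cast_le (α := ℝ)).2 h3
  push_cast at h4
  linarith

theorem sum_risingPoly_self_le {i K H : ℕ} (L : ZMod p) (hip : i.Prime) (hi : i ≤ K)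
    (hK : K ^ 2 ≤ p) (hip1 : ¬ i ∣ p - 1) (hH : 0 < H) (hHp : H ≤ p) :
    ∑ z : ZMod p × ZMod p with (risingPoly p i).eval z.1 = (risingPoly p i).eval z.2,
      (triWeight p H L z.1 - H / p) * (triWeight p H L z.2 - H / p) ≤ 6 * K ^ 2 * √p + H := by
  have hψ : (ZMod.stdAddChar (N := p)).IsPrimitive := ZMod.isPrimitive_stdAddChar p
  have hψ1 : (ZMod.stdAddChar (N := p)) ≠ 1 := by
    have := hψ one_ne_zero
    rwa [AddChar.mulShift_one] at this
  have hiK : (i : ℝ) ≤ K := by exact_mod_cast hi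
  rw [filter_eval_eq_subset, ← Finset.union_sdiff_self_eq_union,
    Finset.sum_union Finset.disjoint_sdiff]
  refine add_le_add ?_ ?_
  · refine (le_abs_self _).trans (abs_sum_triWeight_mul_le L hψ hH hHp _ fun a b ha hb => ?_)
    have h := norm_sum_divDiff_le (risingPoly_monic (p := p) i) (by rwa [natDegree_risingPoly])
      (by rwa [natDegree_risingPoly])
      (by rw [natDegree_risingPoly]; exact (Nat.pow_le_pow_left hi 2).trans hK) ha b hψ1
    rw [natDegree_risingPoly] at h
    exact h.trans (by gcongr)
  · refine le_trans ?_ (sum_sq_triWeight_sub_le (H := H) L hHp)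
    have e : ∀ z ∈ (Finset.univ.filter fun z : ZMod p × ZMod p => z.1 = z.2) \
        (Finset.univ.filter fun z : ZMod p × ZMod p =>
          divDiff (RingHom.id _) (risingPoly p i) z.1 z.2 = 0),
        (triWeight p H L z.1 - H / p) * (triWeight p H L z.2 - H / p) =
          (triWeight p H L z.1 - H / p) ^ 2 := fun z hz => by
      have := (Finset.mem_filter.1 (Finset.mem_sdiff.1 hz).1).2
      rw [← this, sq]
    rw [Finset.sum_congr rfl e]
    refine (Finset.sum_le_sum_of_subset_of_nonneg Finset.sdiff_subset
      fun _ _ _ => sq_nonneg _).trans (le_of_eq ?_)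
    refine Finset.sum_bij' (fun z _ => z.1) (fun x _ => (x, x)) ?_ ?_ ?_ ?_ ?_
    · simp
    · simp
    · rintro ⟨x, y⟩ h
      simpa using h
    · simp
    · simp

/-- The second moment inequality for the products of consecutive integers. -/
theorem card_values_risingPoly {K M H : ℕ} (L : ZMod p) (J : Finset ℕ)
    (hJ : ∀ i ∈ J, i.Prime ∧ i ≤ K ∧ ∀ m, 1 ≤ m → m < M → ¬ i ∣ p ^ m - 1) (hK : K ^ 2 ≤ p)
    (hM : 2 ≤ M) (hH : 0 < H) (hHp : H ≤ p) (U : Finset (ZMod p))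
    (hU : ∀ i ∈ J, ∀ n < 2 * H, (risingPoly p i).eval (L + (n : ℕ)) ∈ U) :
    ((J.card : ℝ) * H) ^ 2 ≤ U.card * (2 * (J.card ^ 2 * (6 * K ^ 2 * √p) + J.card * H) +
      2 * (H / p) ^ 2 * (J.card ^ 2 * (p + 5 * K ^ 2 * √p) + J.card * (K / M * p))) := by
  have hψ : (ZMod.stdAddChar (N := p)).IsPrimitive := ZMod.isPrimitive_stdAddChar p
  have hψ1 : (ZMod.stdAddChar (N := p)) ≠ 1 := by
    have := hψ one_ne_zero
    rwa [AddChar.mulShift_one] at this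
  have h := sq_sum_le_card_mul J (fun i x => (risingPoly p i).eval x) (triWeight p H L) (H / p) U
    fun i hi x hx => by
      obtain ⟨n, hn, rfl⟩ := exists_of_triWeight_ne_zero L hx
      exact hU i hi n hn
  rw [sum_triWeight] at h
  refine h.trans (mul_le_mul_of_nonneg_left ?_ (Nat.cast_nonneg _))
  have key : ∀ A B : ℝ, ∑ i ∈ J, ∑ j ∈ J, (A + if i = j then B else 0) =
      J.card ^ 2 * A + J.card * B := fun A B => by
    simp_rw [Finset.sum_add_distrib]
    simp [Finset.sum_ite_eq]
    ring
  refine add_le_add ?_ ?_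
  · rw [← key]
    refine mul_le_mul_of_nonneg_left ?_ zero_le_two
    refine Finset.sum_le_sum fun i hi => Finset.sum_le_sum fun j hj => ?_
    obtain ⟨hi1, hi2, hi3⟩ := hJ i hi
    obtain ⟨hj1, hj2, hj3⟩ := hJ j hj
    by_cases hij : i = j
    · subst hij
      rw [if_pos rfl]
      exact sum_risingPoly_self_le L hi1 hi2 hK (by simpa using hi3 1 le_rfl (by omega)) hH hHp
    · rw [if_neg hij, add_zero]
      exact (le_abs_self _).trans (abs_sum_triWeight_mul_le L hψ hH hHp _ fun a b ha hb =>
        norm_sum_risingPoly_ne_le hij hi2 hj2 hK hψ1 ha hb)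
  · rw [← key]
    refine mul_le_mul_of_nonneg_left ?_ (by positivity)
    refine Finset.sum_le_sum fun i hi => Finset.sum_le_sum fun j hj => ?_
    obtain ⟨hi1, hi2, hi3⟩ := hJ i hi
    obtain ⟨hj1, hj2, hj3⟩ := hJ j hj
    by_cases hij : i = j
    · subst hij
      rw [if_pos rfl]
      exact card_risingPoly_self_le hi1 hi2 hK (by omega) hi3
    · rw [if_neg hij, add_zero]
      exact card_risingPoly_ne_le hi1 hj1 hij hi2 hj2 hK
end MainInequality

end

section
open Polynomial

section FinalBound

/-- A nonzero natural number has at most `log a / log 2` prime factors. -/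
theorem card_primeFactors_mul_log_two_le {a : ℕ} (ha : a ≠ 0) :
    (a.primeFactors.card : ℝ) * Real.log 2 ≤ Real.log a := by
  have h1 : 2 ^ a.primeFactors.card ≤ a := by
    refine le_trans ?_ (Nat.le_of_dvd (Nat.pos_of_ne_zero ha) (Nat.prod_primeFactors_dvd a))
    exact Finset.pow_card_le_prod _ _ _ fun q hq => (Nat.prime_of_mem_primeFactors hq).two_le
  rw [← Real.log_pow]
  exact Real.log_le_log (by positivity) (by exact_mod_cast h1)

/-- Few primes divide one of the numbers `p ^ m - 1` with `m` small. -/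
theorem exists_primes_not_dvd_pow_sub_one {p K M n : ℕ} (hp : 2 ≤ p)
    (h : (n : ℝ) + M ^ 2 * Real.log p / Real.log 2 ≤ Nat.primeCounting K) :
    ∃ J : Finset ℕ, J.card = n ∧
      ∀ i ∈ J, i.Prime ∧ i ≤ K ∧ ∀ m, 1 ≤ m → m < M → ¬ i ∣ p ^ m - 1 := by
  have hl2 : 0 < Real.log 2 := Real.log_pos one_lt_two
  have hp0 : (0 : ℝ) < p := by positivity
  have hlp : 0 ≤ Real.log p := Real.log_natCast_nonneg p
  set B := (Finset.Ico 1 M).biUnion fun m => (p ^ m - 1).primeFactors with hB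
  have hpos : ∀ m, 1 ≤ m → p ^ m - 1 ≠ 0 := fun m hm => by
    have : 2 ^ 1 ≤ p ^ m := (Nat.pow_le_pow_left hp 1).trans (Nat.pow_le_pow_right (by omega) hm)
    omega
  have hBc : (B.card : ℝ) ≤ M ^ 2 * Real.log p / Real.log 2 := by
    rw [le_div_iff₀ hl2]
    calc (B.card : ℝ) * Real.log 2
        ≤ (∑ m ∈ Finset.Ico 1 M, ((p ^ m - 1).primeFactors.card : ℝ)) * Real.log 2 := by
          gcongr
          exact_mod_cast Finset.card_biUnion_le
      _ = ∑ m ∈ Finset.Ico 1 M, ((p ^ m - 1).primeFactors.card : ℝ) * Real.log 2 :=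
          Finset.sum_mul _ _ _
      _ ≤ ∑ m ∈ Finset.Ico 1 M, M * Real.log p := by
          refine Finset.sum_le_sum fun m hm => ?_
          obtain ⟨h1, h2⟩ := Finset.mem_Ico.1 hm
          refine (card_primeFactors_mul_log_two_le (hpos m h1)).trans ?_
          have : Real.log ((p ^ m - 1 : ℕ) : ℝ) ≤ Real.log ((p : ℝ) ^ m) := by
            refine Real.log_le_log (by exact_mod_cast Nat.pos_of_ne_zero (hpos m h1)) ?_
            exact_mod_cast Nat.sub_le _ _
          refine this.trans ?_
          rw [Real.log_pow]
          gcongr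
      _ ≤ M ^ 2 * Real.log p := by
          rw [Finset.sum_const, Nat.card_Ico, nsmul_eq_mul, sq, mul_assoc]
          gcongr
          exact_mod_cast Nat.sub_le _ _
  have hcard : n ≤ ((Finset.range (K + 1)).filter Nat.Prime \ B).card := by
    have h1 := Finset.le_card_sdiff B ((Finset.range (K + 1)).filter Nat.Prime)
    have h2 : ((Finset.range (K + 1)).filter Nat.Prime).card = Nat.primeCounting K := by
      rw [Nat.primeCounting, Nat.primeCounting', Nat.count_eq_card_filter_range]
    have h3 : n + B.card ≤ Nat.primeCounting K := by
      have : (n : ℝ) + B.card ≤ Nat.primeCounting K := by linarith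
      exact_mod_cast this
    omega
  obtain ⟨J, hJ, hJn⟩ := Finset.exists_subset_card_eq hcard
  refine ⟨J, hJn, fun i hi => ?_⟩
  have := hJ hi
  simp only [Finset.mem_sdiff, Finset.mem_filter, Finset.mem_range] at this
  refine ⟨this.1.2, by omega, fun m h1 h2 hd => this.2 ?_⟩
  rw [hB, Finset.mem_biUnion]
  exact ⟨m, Finset.mem_Ico.2 ⟨h1, h2⟩, Nat.mem_primeFactors.2 ⟨this.1.2, hd, hpos m h1⟩⟩

theorem div_four_log_le_primeCounting {K : ℕ} (hK : 16 ≤ K) :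
    (K : ℝ) / (4 * Real.log K) ≤ Nat.primeCounting K := by
  have hK' : (16 : ℝ) ≤ K := by exact_mod_cast hK
  have hlK : 0 < Real.log K := Real.log_pos (by linarith)
  refine le_trans ?_ (Chebyshev.pi_ge K)
  rw [← div_div]
  gcongr
  have h1 := Real.log_le_sub_one_of_pos (x := ((K : ℝ) + 1) / 8) (by positivity)
  rw [Real.log_div (by positivity) (by norm_num), show (8 : ℝ) = 2 ^ 3 by norm_num,
    Real.log_pow] at h1
  push_cast at h1
  nlinarith [Real.log_two_gt_d9, Real.log_two_lt_d9]

theorem add_le_primeCounting {p K M n : ℕ} {y s : ℝ} (hs : Real.log p = s ^ 3) (hs16 : 16 ≤ s)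
    (hy2 : 16 * s ^ 3 * (2 + 2 * (s ^ 6 + 2) ^ 2 * s ^ 3) ≤ y) (hKy' : y / 2 ≤ K)
    (hK16 : 16 ≤ K) (hK2 : K ^ 2 ≤ p) (hMs' : (M : ℝ) ≤ s ^ 6 + 2) (hn2 : (n : ℝ) ≤ y / s ^ 4 + 1) :
    (n : ℝ) + M ^ 2 * Real.log p / Real.log 2 ≤ Nat.primeCounting K := by
  have hs0 : 0 < s := by linarith
  have hy0 : 0 ≤ y := le_trans (by positivity) hy2
  refine le_trans ?_ (div_four_log_le_primeCounting hK16)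
  have hl : Real.log K ≤ s ^ 3 := by
    rw [← hs]
    refine Real.log_le_log (by exact_mod_cast (by omega : 0 < K)) ?_
    exact_mod_cast (Nat.le_self_pow two_ne_zero K).trans hK2
  have hl0 : 0 < Real.log K := Real.log_pos (by exact_mod_cast (by omega : 1 < K))
  have h1 : y / (8 * s ^ 3) ≤ K / (4 * Real.log K) := by
    calc y / (8 * s ^ 3) = y / 2 / (4 * s ^ 3) := by field_simp; ring
      _ ≤ K / (4 * Real.log K) := by gcongr
  refine le_trans ?_ h1
  have h2 : y / s ^ 4 ≤ y / (16 * s ^ 3) := by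
    gcongr
    rw [pow_succ' s 3]
    gcongr
  have h3 : (M : ℝ) ^ 2 * Real.log p / Real.log 2 ≤ 2 * (s ^ 6 + 2) ^ 2 * s ^ 3 := by
    rw [hs, div_le_iff₀ (Real.log_pos one_lt_two)]
    have : (M : ℝ) ^ 2 * s ^ 3 ≤ (s ^ 6 + 2) ^ 2 * s ^ 3 := by gcongr
    have h5 : 0 ≤ (s ^ 6 + 2) ^ 2 * s ^ 3 := by positivity
    nlinarith [Real.log_two_gt_d9]
  have h4 : 2 + 2 * (s ^ 6 + 2) ^ 2 * s ^ 3 ≤ y / (16 * s ^ 3) := by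
    rw [le_div_iff₀ (by positivity)]
    linarith
  have h5 : y / (8 * s ^ 3) = y / (16 * s ^ 3) + y / (16 * s ^ 3) := by field_simp; ring
  linarith

/-- The choice of parameters balances the terms of the second moment inequality. -/
theorem mul_le_of_second_moment {p s y N n H K M U : ℝ} (hp0 : 0 < p) (hs0 : 0 < s)
    (hs4 : 16 ≤ s ^ 4) (hs46 : s ^ 4 ≤ s ^ 6) (hy0 : 0 < y) (hy : y ^ 3 * √p = N) (hN0 : 0 < N)
    (hyN : y * N ≤ p * s ^ 4) (hK0 : 0 ≤ K) (hKy : K ≤ y) (hMs : s ^ 6 ≤ M)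
    (hn1 : y / s ^ 4 ≤ n) (hn3 : n ≤ 2 * (y / s ^ 4)) (hH1 : H ≤ N / 4) (hH2 : N / 8 ≤ H)
    (hK2p : K ^ 2 * √p ≤ p) (hU : 0 ≤ U)
    (main : (n * H) ^ 2 ≤ U * (2 * (n ^ 2 * (6 * K ^ 2 * √p) + n * H) +
      2 * (H / p) ^ 2 * (n ^ 2 * (p + 5 * K ^ 2 * √p) + n * (K / M * p)))) :
    y * N / (224 * s ^ 4) ≤ U := by
  have hn0 : 0 < n := lt_of_lt_of_le (by positivity) hn1
  have hH0 : 0 < H := by linarith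
  have b1 : n * (K ^ 2 * √p) ≤ H := by
    have e : y / s ^ 4 * (y ^ 2 * √p) = N / s ^ 4 := by rw [← hy]; ring
    calc n * (K ^ 2 * √p) ≤ 2 * (y / s ^ 4) * (y ^ 2 * √p) := by gcongr
      _ = 2 * (N / s ^ 4) := by rw [mul_assoc, e]
      _ ≤ 2 * (N / 16) := by gcongr
      _ ≤ H := by linarith
  have b2 : K / M ≤ n := by
    calc K / M ≤ y / s ^ 4 := by
          gcongr
          linarith
      _ ≤ n := hn1
  have b3 : n * H ≤ p := by
    calc n * H ≤ 2 * (y / s ^ 4) * (N / 4) := by gcongr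
      _ = y * N / (2 * s ^ 4) := by field_simp; norm_num
      _ ≤ p := by
        rw [div_le_iff₀ (by positivity)]
        have := mul_pos hp0 (pow_pos hs0 4)
        linarith
  have c1 : n ^ 2 * (6 * K ^ 2 * √p) + n * H ≤ 7 * (n * H) := by
    have := mul_le_mul_of_nonneg_left b1 hn0.le
    linarith
  have c2 : n ^ 2 * (p + 5 * K ^ 2 * √p) + n * (K / M * p) ≤ 7 * (n ^ 2 * p) := by
    have h1 : n ^ 2 * (K ^ 2 * √p) ≤ n ^ 2 * p := by gcongr
    have h2 : n * (K / M * p) ≤ n * (n * p) := by gcongr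
    linarith
  have c3 : 2 * (H / p) ^ 2 * (7 * (n ^ 2 * p)) ≤ 14 * (n * H) := by
    have e : 2 * (H / p) ^ 2 * (7 * (n ^ 2 * p)) = 14 * (n * H) * (n * H / p) := by
      field_simp; norm_num
    rw [e]
    refine mul_le_of_le_one_right (by positivity) ?_
    rwa [div_le_one hp0]
  have c4 : (n * H) ^ 2 ≤ U * (28 * (n * H)) := by
    refine main.trans (mul_le_mul_of_nonneg_left ?_ hU)
    have : 2 * (H / p) ^ 2 * (n ^ 2 * (p + 5 * K ^ 2 * √p) + n * (K / M * p)) ≤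
        2 * (H / p) ^ 2 * (7 * (n ^ 2 * p)) := by gcongr
    linarith
  have c5 : n * H ≤ U * 28 := by
    refine le_of_mul_le_mul_right (a := n * H) ?_ (by positivity)
    linarith
  calc y * N / (224 * s ^ 4) = y / s ^ 4 * (N / 8) / 28 := by field_simp; norm_num
    _ ≤ n * H / 28 := by gcongr
    _ ≤ _ := by linarith

variable {p : ℕ} [Fact p.Prime]

/-- A product of consecutive integers is a ratio of factorials. -/
theorem risingPoly_eval_mul_factorial (i m : ℕ) :
    (risingPoly p i).eval (m : ZMod p) * (m.factorial : ZMod p) = ((m + i).factorial : ZMod p) := by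
  induction i with
  | zero => simp [risingPoly]
  | succ i ih =>
    rw [← add_assoc, Nat.factorial_succ, Nat.cast_mul, ← ih, risingPoly, Finset.prod_range_succ,
      eval_mul, ← risingPoly]
    simp only [eval_add, eval_X, eval_C]
    push_cast
    ring

theorem risingPoly_eval_mem_ratio {L N i m : ℕ} (hm : L + 1 ≤ m) (hmi : m + i ≤ L + N)
    (hp : L + N < p) : (risingPoly p i).eval (m : ZMod p) ∈ intervalFactorialsRatio p L N := by
  have hne : (m.factorial : ZMod p) ≠ 0 := by
    rw [Ne, ZMod.natCast_eq_zero_iff, (Fact.out : p.Prime).dvd_factorial]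
    omega
  refine Finset.mem_image₂.2 ⟨((m + i).factorial : ZMod p), ?_, (m.factorial : ZMod p), ?_, ?_⟩
  · exact Finset.mem_image.2 ⟨m + i, Finset.mem_Icc.2 ⟨by omega, hmi⟩, rfl⟩
  · exact Finset.mem_image.2 ⟨m, Finset.mem_Icc.2 ⟨hm, by omega⟩, rfl⟩
  · rw [← risingPoly_eval_mul_factorial, mul_inv_cancel_right₀ hne]

/-- The lower bound for the ratio set, with the parameters `y = (N / √p) ^ (1/3)` and
`s = (log p) ^ (1/3)`. -/
theorem card_intervalFactorialsRatio_ge {L N : ℕ} (hp : L + N < p) {y s : ℝ}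
    (hs : Real.log p = s ^ 3) (hs16 : 16 ≤ s) (hy : y ^ 3 * √p = N)
    (hy2 : 16 * s ^ 3 * (2 + 2 * (s ^ 6 + 2) ^ 2 * s ^ 3) ≤ y) (hyN : y * N ≤ p * s ^ 4) :
    y * N / (224 * s ^ 4) ≤ (intervalFactorialsRatio p L N).card := by
  have hpr : p.Prime := Fact.out
  have hp0 : (0 : ℝ) < p := by exact_mod_cast hpr.pos
  have hp1 : (1 : ℝ) ≤ p := by exact_mod_cast hpr.one_le
  have hr1 : 1 ≤ √(p : ℝ) := Real.one_le_sqrt.2 hp1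
  have hrr : √(p : ℝ) * √p = p := Real.mul_self_sqrt hp0.le
  have hs0 : 0 < s := by linarith
  have hs3 : 1 ≤ s ^ 3 := one_le_pow₀ (by linarith)
  have hs4 : 16 ≤ s ^ 4 := by
    calc (16 : ℝ) ≤ s := hs16
      _ ≤ s ^ 4 := le_self_pow₀ (by linarith) (by norm_num)
  have hs6 : 1 ≤ s ^ 6 := one_le_pow₀ (by linarith)
  have hs46 : s ^ 4 ≤ s ^ 6 := pow_le_pow_right₀ (by linarith) (by norm_num)
  have hys : 32 * s ^ 6 ≤ y := by
    refine le_trans ?_ hy2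
    have : s ^ 6 ≤ (s ^ 6 + 2) ^ 2 := by nlinarith
    have e : 16 * s ^ 3 * (2 + 2 * (s ^ 6 + 2) ^ 2 * s ^ 3) =
      32 * s ^ 3 + 32 * s ^ 6 * (s ^ 6 + 2) ^ 2 := by ring
    rw [e]
    nlinarith
  have hy0 : 32 ≤ y := by linarith
  have hN0 : (0 : ℝ) ≤ N := Nat.cast_nonneg N
  have hNp : (N : ℝ) ≤ p := by exact_mod_cast (by omega : N ≤ p)
  have hy3r : y ^ 3 ≤ √p := by
    have : y ^ 3 * √p ≤ √p * √p := by rw [hy, hrr]; exact hNp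
    exact le_of_mul_le_mul_right this (by linarith)
  have hy2r : y ^ 2 ≤ √p := (pow_le_pow_right₀ (by linarith) (by norm_num)).trans hy3r
  have hyyN : 1024 * y ≤ N := by
    rw [← hy]
    have : y ^ 3 = y * y ^ 2 := by ring
    have h2 : 1024 ≤ y ^ 2 := by nlinarith
    have h3 : 1024 * y ≤ y ^ 3 := by nlinarith
    nlinarith [pow_pos (by linarith : 0 < y) 3]
  -- the parameters
  set K := ⌊y⌋₊ with hKd
  set M := ⌈s ^ 6⌉₊ + 1 with hMd
  set n := ⌈y / s ^ 4⌉₊ with hnd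
  set H := N / 4 with hHd
  have hKy : (K : ℝ) ≤ y := Nat.floor_le (by linarith)
  have hKy' : y / 2 ≤ K := by
    have := Nat.lt_floor_add_one y
    rw [← hKd] at this
    linarith
  have hK16 : 16 ≤ K := by
    have : (16 : ℝ) ≤ K := by linarith
    exact_mod_cast this
  have hMs : s ^ 6 ≤ M := by
    rw [hMd]; push_cast
    linarith [Nat.le_ceil (s ^ 6)]
  have hMs' : (M : ℝ) ≤ s ^ 6 + 2 := by
    rw [hMd]; push_cast
    linarith [Nat.ceil_lt_add_one (by positivity : 0 ≤ s ^ 6)]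
  have hM2 : 2 ≤ M := by
    have : 0 < ⌈s ^ 6⌉₊ := Nat.ceil_pos.2 (by positivity)
    omega
  have hyd : 1 ≤ y / s ^ 4 := by rw [le_div_iff₀ (by positivity)]; linarith
  have hn1 : y / s ^ 4 ≤ n := Nat.le_ceil _
  have hn2 : (n : ℝ) ≤ y / s ^ 4 + 1 := (Nat.ceil_lt_add_one (by linarith)).le
  have hn3 : (n : ℝ) ≤ 2 * (y / s ^ 4) := by linarith
  have hn0 : (0 : ℝ) < n := by linarith
  have hH1 : (H : ℝ) ≤ N / 4 := by exact_mod_cast Nat.cast_div_le (α := ℝ) (m := N) (n := 4)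
  have hH2 : (N : ℝ) / 8 ≤ H := by
    have : N < 4 * (H + 1) := by omega
    have : (N : ℝ) < 4 * (H + 1) := by exact_mod_cast this
    linarith
  have hH0 : (0 : ℝ) < H := by linarith
  have hK2r : (K : ℝ) ^ 2 ≤ √p := le_trans (by gcongr) hy2r
  have hK2p : (K : ℝ) ^ 2 * √p ≤ p := by
    calc (K : ℝ) ^ 2 * √p ≤ √p * √p := by gcongr
      _ = p := hrr
  have hK2 : K ^ 2 ≤ p := by
    have : (K : ℝ) ^ 2 ≤ p := by nlinarith
    exact_mod_cast this
  -- the primes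
  obtain ⟨J, hJn, hJ⟩ := exists_primes_not_dvd_pow_sub_one (p := p) (K := K) (M := M) (n := n)
    hpr.two_le (add_le_primeCounting hs hs16 hy2 hKy' hK16 hK2 hMs' hn2)
  have hHN : 2 * H + K ≤ N := by
    have : (2 * H + K : ℝ) ≤ N := by linarith
    exact_mod_cast this
  have main := card_values_risingPoly (p := p) (K := K) (M := M) (H := H) ((L + 1 : ℕ) : ZMod p) J
    hJ hK2 hM2 (by exact_mod_cast hH0) (by omega) (intervalFactorialsRatio p L N)
    (fun i hi m hm => by
      rw [← Nat.cast_add]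
      exact risingPoly_eval_mem_ratio (by omega) (by have := (hJ i hi).2.1; omega) hp)
  rw [hJn] at main
  exact mul_le_of_second_moment hp0 hs0 hs4 hs46 (by linarith) hy (by linarith) hyN
    (Nat.cast_nonneg K) hKy hMs hn1 hn3 hH1 hH2 hK2p (Nat.cast_nonneg _) main

end FinalBound

end

section
open Polynomial

/-- The numerical conditions that hold for all large `ℓ = log p`. -/
theorem exists_large_log : ∃ ℓ₀ : ℝ, 0 < ℓ₀ ∧ ∀ ℓ : ℝ, ℓ₀ ≤ ℓ → 4096 ≤ ℓ ∧
    16 * ℓ * (2 + 2 * (ℓ ^ 2 + 2) ^ 2 * ℓ) ≤ Real.exp (ℓ / 10) ∧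
    ℓ ^ 2 ≤ Real.exp (7 * ℓ / 40) := by
  have h := (isLittleO_pow_exp_pos_mul_atTop 10 (b := 1 / 10) (by norm_num)).bound
    (c := 1) one_pos
  obtain ⟨a, ha⟩ := Filter.eventually_atTop.1 h
  refine ⟨max a 4096, by positivity, fun ℓ hℓ => ?_⟩
  have h4 : 4096 ≤ ℓ := (le_max_right _ _).trans hℓ
  have h1 := ha ℓ ((le_max_left _ _).trans hℓ)
  rw [Real.norm_of_nonneg (by positivity), Real.norm_of_nonneg (Real.exp_pos _).le, one_mul] at h1
  have hl1 : 1 ≤ ℓ := by linarith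
  refine ⟨h4, ?_, ?_⟩
  · refine le_trans ?_ (h1.trans (le_of_eq (by ring_nf)))
    have a1 : ℓ ^ 2 + 2 ≤ ℓ ^ 3 := by nlinarith [mul_nonneg (by linarith : 0 ≤ ℓ - 2) (sq_nonneg ℓ)]
    have a2 : (ℓ ^ 2 + 2) ^ 2 ≤ ℓ ^ 6 := by
      calc (ℓ ^ 2 + 2) ^ 2 ≤ (ℓ ^ 3) ^ 2 := by gcongr
        _ = ℓ ^ 6 := by ring
    have a3 : 2 ≤ 2 * ℓ ^ 7 := by linarith [one_le_pow₀ hl1 (n := 7)]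
    calc 16 * ℓ * (2 + 2 * (ℓ ^ 2 + 2) ^ 2 * ℓ) ≤ 16 * ℓ * (2 * ℓ ^ 7 + 2 * ℓ ^ 6 * ℓ) := by gcongr
      _ = 64 * ℓ ^ 8 := by ring
      _ ≤ ℓ ^ 2 * ℓ ^ 8 := by
        gcongr
        nlinarith
      _ = ℓ ^ 10 := by ring
  · calc ℓ ^ 2 ≤ ℓ ^ 10 := pow_le_pow_right₀ hl1 (by norm_num)
      _ ≤ Real.exp (1 / 10 * ℓ) := h1
      _ ≤ Real.exp (7 * ℓ / 40) := Real.exp_le_exp.2 (by linarith)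

end

/-- **Theorem 2, Case 3.** If `c₃·p^{4/5}·(log p)^{8/5} ≤ N ≤ c₂·p^{7/8}·log p` then
`|A_N / A_N| ≥ c·N·Q^{1/3}·(log Q)^{-2/3}` where `Q = N/(√p·(log p)²)`. -/
theorem card_intervalFactorialsRatio_ge_case3 :
    ∃ c c₂ c₃ : ℝ, c > 0 ∧ c₂ > 0 ∧ c₃ > 0 ∧ ∀ p L N : ℕ, p.Prime →
      0 < L + 1 → L + 1 < L + N → L + N < p →
      c₃ * (p : ℝ) ^ ((4 : ℝ) / 5) * (Real.log p) ^ ((8 : ℝ) / 5) ≤ (N : ℝ) →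
      (N : ℝ) ≤ c₂ * (p : ℝ) ^ ((7 : ℝ) / 8) * Real.log p →
      ((intervalFactorialsRatio p L N).card : ℝ) ≥
        c * (N : ℝ) * ((N : ℝ) / (Real.sqrt p * (Real.log p) ^ 2)) ^ ((1 : ℝ) / 3) *
          (Real.log ((N : ℝ) / (Real.sqrt p * (Real.log p) ^ 2))) ^ (-(2 : ℝ) / 3) := by
  obtain ⟨ℓ₀, hℓ₀, hE⟩ := exists_large_log
  refine ⟨1 / 896, 1, 4 * Real.exp ℓ₀, by norm_num, one_pos, by positivity, ?_⟩
  intro p L N hpr _ hN1 hLN h3 h2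
  have := Fact.mk hpr
  have hp0 : (0 : ℝ) < p := by exact_mod_cast hpr.pos
  have hp1 : (1 : ℝ) ≤ p := by exact_mod_cast hpr.one_le
  have hNpos : (0 : ℝ) < N := by exact_mod_cast (by omega : 0 < N)
  obtain ⟨ℓ, hℓ⟩ : ∃ ℓ, ℓ = Real.log p := ⟨_, rfl⟩
  have hpe : (p : ℝ) = Real.exp ℓ := by rw [hℓ, Real.exp_log hp0]
  have hpow : ∀ a : ℝ, (p : ℝ) ^ a = Real.exp (ℓ * a) := fun a => by
    rw [hpe, ← Real.exp_mul]
  have hsqrt : √(p : ℝ) = Real.exp (ℓ / 2) := by rw [hpe, Real.exp_half]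
  rw [← hℓ] at h3 h2 ⊢
  rw [hpow] at h3 h2
  have hl2 : 1 / 2 ≤ ℓ := by
    have : Real.log 2 ≤ ℓ := by
      rw [hℓ]
      exact Real.log_le_log two_pos (by exact_mod_cast hpr.two_le)
    linarith [Real.log_two_gt_d9]
  have hl85 : 1 / 4 ≤ ℓ ^ ((8 : ℝ) / 5) := by
    calc (1 / 4 : ℝ) = (1 / 2 : ℝ) ^ (2 : ℝ) := by norm_num
      _ ≤ (1 / 2 : ℝ) ^ ((8 : ℝ) / 5) :=
        Real.rpow_le_rpow_of_exponent_ge (by norm_num) (by norm_num) (by norm_num)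
      _ ≤ ℓ ^ ((8 : ℝ) / 5) := Real.rpow_le_rpow (by norm_num) hl2 (by norm_num)
  have h3' : Real.exp ℓ₀ * Real.exp (ℓ * (4 / 5)) ≤ N := by
    refine le_trans ?_ h3
    have := mul_le_mul_of_nonneg_left hl85
      (by positivity : 0 ≤ 4 * Real.exp ℓ₀ * Real.exp (ℓ * (4 / 5)))
    linarith
  have hℓℓ : ℓ₀ ≤ ℓ := by
    have h : Real.exp (ℓ₀ + ℓ * (4 / 5)) < Real.exp ℓ := by
      rw [Real.exp_add, ← hpe]
      exact lt_of_le_of_lt h3' (by exact_mod_cast (by omega : N < p))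
    have := Real.exp_lt_exp.1 h
    linarith
  obtain ⟨h4096, hE1, hE2⟩ := hE ℓ hℓℓ
  have hNl : Real.exp (ℓ * (4 / 5)) ≤ N :=
    le_trans (le_mul_of_one_le_left (Real.exp_pos _).le (Real.one_le_exp hℓ₀.le)) h3'
  have hℓ0 : 0 < ℓ := by linarith
  have cube : ∀ {x : ℝ}, 0 ≤ x → (x ^ ((1 : ℝ) / 3)) ^ 3 = x := fun hx => by
    rw [← Real.rpow_natCast, ← Real.rpow_mul hx]
    norm_num
  obtain ⟨s, hs⟩ : ∃ s, s = ℓ ^ ((1 : ℝ) / 3) := ⟨_, rfl⟩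
  obtain ⟨y, hy⟩ : ∃ y, y = (N / √(p : ℝ)) ^ ((1 : ℝ) / 3) := ⟨_, rfl⟩
  have hs0 : 0 < s := hs ▸ Real.rpow_pos_of_pos hℓ0 _
  have hy0 : 0 < y := hy ▸ Real.rpow_pos_of_pos (by positivity) _
  have hs3 : s ^ 3 = ℓ := by rw [hs, cube hℓ0.le]
  have hy3 : y ^ 3 = N / √(p : ℝ) := by rw [hy, cube (by positivity)]
  have hs16 : 16 ≤ s := by
    refine le_of_pow_le_pow_left₀ (n := 3) (by norm_num) hs0.le ?_
    rw [hs3]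
    linarith
  have hy3l : Real.exp (ℓ * (3 / 10)) ≤ y ^ 3 := by
    rw [hy3, hsqrt, le_div_iff₀ (Real.exp_pos _), ← Real.exp_add]
    refine le_trans (le_of_eq ?_) hNl
    ring_nf
  have hyl : Real.exp (ℓ / 10) ≤ y := by
    refine le_of_pow_le_pow_left₀ (n := 3) (by norm_num) hy0.le ?_
    rw [← Real.exp_nat_mul]
    refine le_trans (le_of_eq ?_) hy3l
    push_cast
    ring_nf
  have hyN : y * N ≤ p * s ^ 4 := by
    refine le_of_pow_le_pow_left₀ (n := 3) (by norm_num) (by positivity) ?_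
    rw [one_mul] at h2
    have e1 : (y * N) ^ 3 = N ^ 4 / Real.exp (ℓ / 2) := by rw [mul_pow, hy3, hsqrt]; ring
    have e2 : ((p : ℝ) * s ^ 4) ^ 3 = p ^ 3 * ℓ ^ 4 := by rw [← hs3]; ring
    rw [e1, e2, div_le_iff₀ (Real.exp_pos _)]
    calc (N : ℝ) ^ 4 ≤ (Real.exp (ℓ * (7 / 8)) * ℓ) ^ 4 := by gcongr
      _ = p ^ 3 * ℓ ^ 4 * Real.exp (ℓ / 2) := by
        rw [hpe, mul_pow, ← Real.exp_nat_mul, ← Real.exp_nat_mul, mul_right_comm, ← Real.exp_add]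
        push_cast
        ring_nf
  have main := card_intervalFactorialsRatio_ge (L := L) (N := N) hLN (y := y) (s := s)
    (by rw [hs3, hℓ]) hs16 (by rw [hy3, div_mul_cancel₀ _ (by positivity)])
    (by rw [show s ^ 6 = (s ^ 3) ^ 2 by ring, hs3]; exact hE1.trans hyl) hyN
  have hQ : (N : ℝ) / (√p * ℓ ^ 2) = y ^ 3 / ℓ ^ 2 := by rw [hy3, div_div]
  have hQ1 : ((N : ℝ) / (√p * ℓ ^ 2)) ^ ((1 : ℝ) / 3) = y / s ^ 2 := by
    have e : (N : ℝ) / (√p * ℓ ^ 2) = (y / s ^ 2) ^ 3 := by rw [hQ, ← hs3]; ring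
    rw [e, ← Real.rpow_natCast, ← Real.rpow_mul (by positivity)]
    norm_num
  have hQ2 : ℓ / 8 ≤ Real.log ((N : ℝ) / (√p * ℓ ^ 2)) := by
    rw [Real.le_log_iff_exp_le (by positivity), hQ, le_div_iff₀ (by positivity)]
    calc Real.exp (ℓ / 8) * ℓ ^ 2 ≤ Real.exp (ℓ / 8) * Real.exp (7 * ℓ / 40) := by gcongr
      _ = Real.exp (ℓ * (3 / 10)) := by rw [← Real.exp_add]; ring_nf
      _ ≤ y ^ 3 := hy3l
  have hQ3 : (Real.log ((N : ℝ) / (√p * ℓ ^ 2))) ^ (-(2 : ℝ) / 3) ≤ 4 / s ^ 2 := by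
    refine (Real.rpow_le_rpow_of_nonpos (by positivity) hQ2 (by norm_num)).trans (le_of_eq ?_)
    have e : ℓ / 8 = (s / 2) ^ (3 : ℝ) := by rw [← hs3]; norm_num; ring
    rw [e, ← Real.rpow_mul (by positivity), show (3 : ℝ) * (-2 / 3) = -(2 : ℕ) by norm_num,
      Real.rpow_neg (by positivity), Real.rpow_natCast]
    field_simp
    norm_num
  rw [hQ1, ge_iff_le]
  calc 1 / 896 * (N : ℝ) * (y / s ^ 2) * _ ≤ 1 / 896 * (N : ℝ) * (y / s ^ 2) * (4 / s ^ 2) := by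
        gcongr
    _ = y * N / (224 * s ^ 4) := by field_simp; norm_num
    _ ≤ _ := main
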